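/- Let q be a prime power with q ≡ 1 (mod 4), F_q a finite field with q elements, and H = Sp(2n, F_q). Let R be a complete set of irreducible complex representations of H, and let δ = 1 or δ = −1. Then Σ_{ρ ∈ R, ε(χ_ρ) = δ} dim ρ = (1/2) · ( q^{n(n+1)/2} ∏_{i=1}^{n} (q^i + 1) + δ · Σ_{k=0}^{n} q^{2k(n−k)} · binom(n,k)_{q²} ), where χ_ρ is the character of ρ. -/

import Mathlib

section

open Matrix CategoryTheory
open scoped Classical

noncomputable section

/-- The Frobenius–Schur indicator of a complex-valued function on a finite group. -/
def fsIndicator (G : Type*) [Group G] [Fintype G] (χ : G → ℂ) : ℂ :=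
  (Fintype.card G : ℂ)⁻¹ * ∑ g : G, χ (g * g)

/-- The twisted Frobenius–Schur indicator of a complex-valued function on a finite group,
with respect to a map `σ`. -/
def twistedFSIndicator (G : Type*) [Group G] [Fintype G] (σ : G → G) (χ : G → ℂ) : ℂ :=
  (Fintype.card G : ℂ)⁻¹ * ∑ g : G, χ (g * σ g)

/-- A complex-valued function is real-valued if all its values are real. -/
def IsRealValued {G : Type*} (χ : G → ℂ) : Prop := ∀ g : G, ∃ r : ℝ, χ g = (r : ℂ)

/-- The Gaussian binomial coefficient `binom(m,k)_q` as a real number. -/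
def gbinom (m k : ℕ) (q : ℝ) : ℝ := ∏ i ∈ Finset.Icc 1 k, (q ^ (m - k + i) - 1) / (q ^ i - 1)

section Groups

variable {N F : Type*} [Fintype N] [DecidableEq N] [Field F]

theorem sim_one (J : Matrix N N F) :
    ((1 : GL N F) : Matrix N N F)ᵀ * J * ((1 : GL N F) : Matrix N N F) = ((1 : Fˣ) : F) • J := by
  simp

theorem sim_mul {J : Matrix N N F} (a b : GL N F) (c d : Fˣ)
    (hc : (a : Matrix N N F)ᵀ * J * (a : Matrix N N F) = (c : F) • J)
    (hd : (b : Matrix N N F)ᵀ * J * (b : Matrix N N F) = (d : F) • J) :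
    ((a * b : GL N F) : Matrix N N F)ᵀ * J * ((a * b : GL N F) : Matrix N N F)
      = ((c * d : Fˣ) : F) • J := by
  calc ((a * b : GL N F) : Matrix N N F)ᵀ * J * ((a * b : GL N F) : Matrix N N F)
      = (b : Matrix N N F)ᵀ * ((a : Matrix N N F)ᵀ * J * (a : Matrix N N F)) *
          (b : Matrix N N F) := by
        rw [show ((a * b : GL N F) : Matrix N N F) = (a : Matrix N N F) * b from rfl,
          transpose_mul]
        simp only [Matrix.mul_assoc]
    _ = (b : Matrix N N F)ᵀ * ((c : F) • J) * (b : Matrix N N F) := by rw [hc]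
    _ = (c : F) • ((b : Matrix N N F)ᵀ * J * (b : Matrix N N F)) := by
        rw [Matrix.mul_smul, Matrix.smul_mul]
    _ = (c : F) • ((d : F) • J) := by rw [hd]
    _ = ((c * d : Fˣ) : F) • J := by rw [smul_smul, Units.val_mul]

theorem sim_inv {J : Matrix N N F} (a : GL N F) (c : Fˣ)
    (hc : (a : Matrix N N F)ᵀ * J * (a : Matrix N N F) = (c : F) • J) :
    ((a⁻¹ : GL N F) : Matrix N N F)ᵀ * J * ((a⁻¹ : GL N F) : Matrix N N F)
      = ((c⁻¹ : Fˣ) : F) • J := by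
  have ht : ((a⁻¹ : GL N F) : Matrix N N F)ᵀ * (a : Matrix N N F)ᵀ = 1 := by
    rw [← transpose_mul, a.mul_inv, transpose_one]
  have key : ((a⁻¹ : GL N F) : Matrix N N F)ᵀ * ((a : Matrix N N F)ᵀ * J * (a : Matrix N N F)) *
      ((a⁻¹ : GL N F) : Matrix N N F) = J := by
    calc ((a⁻¹ : GL N F) : Matrix N N F)ᵀ * ((a : Matrix N N F)ᵀ * J * (a : Matrix N N F)) *
        ((a⁻¹ : GL N F) : Matrix N N F)
        = (((a⁻¹ : GL N F) : Matrix N N F)ᵀ * (a : Matrix N N F)ᵀ) * J *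
          ((a : Matrix N N F) * ((a⁻¹ : GL N F) : Matrix N N F)) := by
          simp only [Matrix.mul_assoc]
      _ = J := by rw [ht, a.mul_inv, Matrix.one_mul, Matrix.mul_one]
  have key2 : ((a⁻¹ : GL N F) : Matrix N N F)ᵀ * ((c : F) • J) * ((a⁻¹ : GL N F) : Matrix N N F)
      = (c : F) • (((a⁻¹ : GL N F) : Matrix N N F)ᵀ * J * ((a⁻¹ : GL N F) : Matrix N N F)) := by
    rw [Matrix.mul_smul, Matrix.smul_mul]
  have h3 : (c : F) • (((a⁻¹ : GL N F) : Matrix N N F)ᵀ * J *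
      ((a⁻¹ : GL N F) : Matrix N N F)) = J := by rw [← key2, ← hc, key]
  calc ((a⁻¹ : GL N F) : Matrix N N F)ᵀ * J * ((a⁻¹ : GL N F) : Matrix N N F)
      = ((c⁻¹ : Fˣ) : F) • ((c : F) • (((a⁻¹ : GL N F) : Matrix N N F)ᵀ * J *
          ((a⁻¹ : GL N F) : Matrix N N F))) := by
        rw [smul_smul, ← Units.val_mul, inv_mul_cancel, Units.val_one, one_smul]
    _ = ((c⁻¹ : Fˣ) : F) • J := by rw [h3]

/-- The similitude group of the bilinear form given by the matrix `J`:  all invertible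
matrices `g` with `gᵀ * J * g = c • J` for some nonzero scalar `c` (the similitude of `g`). -/
def similitudeGroup (J : Matrix N N F) : Subgroup (GL N F) where
  carrier := {g | ∃ c : Fˣ, (g : Matrix N N F)ᵀ * J * (g : Matrix N N F) = (c : F) • J}
  one_mem' := ⟨1, sim_one J⟩
  mul_mem' := by rintro a b ⟨c, hc⟩ ⟨d, hd⟩; exact ⟨c * d, sim_mul a b c d hc hd⟩
  inv_mem' := by rintro a ⟨c, hc⟩; exact ⟨c⁻¹, sim_inv a c hc⟩

/-- The isometry group of the bilinear form given by the matrix `J`:  all invertible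
matrices `g` with `gᵀ * J * g = J`. -/
def fixGroup (J : Matrix N N F) : Subgroup (GL N F) where
  carrier := {g | (g : Matrix N N F)ᵀ * J * (g : Matrix N N F) = J}
  one_mem' := by simp
  mul_mem' := by
    intro a b ha hb
    have := sim_mul (J := J) a b 1 1 (by simpa using ha) (by simpa using hb)
    simpa using this
  inv_mem' := by
    intro a ha
    have := sim_inv (J := J) a 1 (by simpa using ha)
    simpa using this

/-- The group of isometries of determinant one of the bilinear form given by the matrix `J`. -/
def specialFixGroup (J : Matrix N N F) : Subgroup (GL N F) where
  carrier := {g | (g : Matrix N N F)ᵀ * J * (g : Matrix N N F) = J ∧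
    ((g : Matrix N N F)).det = 1}
  one_mem' := ⟨by simp, by simp⟩
  mul_mem' := by
    rintro a b ⟨ha1, ha2⟩ ⟨hb1, hb2⟩
    refine ⟨(fixGroup J).mul_mem ha1 hb1, ?_⟩
    rw [show ((a * b : GL N F) : Matrix N N F) = (a : Matrix N N F) * b from rfl,
      Matrix.det_mul, ha2, hb2, one_mul]
  inv_mem' := by
    rintro a ⟨ha1, ha2⟩
    refine ⟨(fixGroup J).inv_mem ha1, ?_⟩
    have h := congrArg Matrix.det a.mul_inv
    rw [Matrix.det_mul, ha2, one_mul, Matrix.det_one] at h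
    exact h

/-- The connected component of the similitude group of the symmetric bilinear form on a
`2 * m`-dimensional space given by the matrix `J`:  all similitudes `g`, with similitude
character `μ`, such that `det g = μ(g) ^ m`. -/
def connSimilitudeGroup (J : Matrix N N F) (m : ℕ) : Subgroup (GL N F) where
  carrier := {g | ∃ c : Fˣ, (g : Matrix N N F)ᵀ * J * (g : Matrix N N F) = (c : F) • J ∧
    ((g : Matrix N N F)).det = (c : F) ^ m}
  one_mem' := ⟨1, sim_one J, by simp⟩
  mul_mem' := by
    rintro a b ⟨c, hc1, hc2⟩ ⟨d, hd1, hd2⟩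
    refine ⟨c * d, sim_mul a b c d hc1 hd1, ?_⟩
    rw [show ((a * b : GL N F) : Matrix N N F) = (a : Matrix N N F) * b from rfl,
      Matrix.det_mul, hc2, hd2, Units.val_mul, mul_pow]
  inv_mem' := by
    rintro a ⟨c, hc1, hc2⟩
    refine ⟨c⁻¹, sim_inv a c hc1, ?_⟩
    have h := congrArg Matrix.det a.mul_inv
    rw [Matrix.det_mul, hc2, Matrix.det_one] at h
    have hc : ((c : F) ^ m)⁻¹ = ((c⁻¹ : Fˣ) : F) ^ m := by
      rw [← inv_pow]
      norm_cast
    rw [← hc]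
    exact (inv_eq_of_mul_eq_one_right h).symm

theorem neg_one_mem_similitudeGroup (J : Matrix N N F) : (-1 : GL N F) ∈ similitudeGroup J := by
  refine ⟨1, ?_⟩
  have h : ((-1 : GL N F) : Matrix N N F) = -1 := by simp
  rw [h]
  simp

/-- The standard symplectic form matrix `[[0, I], [-I, 0]]`. -/
def Jsp (n : ℕ) (F : Type*) [Field F] : Matrix (Fin n ⊕ Fin n) (Fin n ⊕ Fin n) F :=
  Matrix.fromBlocks 0 1 (-1) 0

/-- The standard split symmetric form matrix `[[0, I], [I, 0]]`. -/
def Jsplit (n : ℕ) (F : Type*) [Field F] : Matrix (Fin n ⊕ Fin n) (Fin n ⊕ Fin n) F :=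
  Matrix.fromBlocks 0 1 1 0

/-- A symmetric matrix `J` of size `2n` is split if it is congruent to `[[0, I], [I, 0]]`. -/
def IsSplit {n : ℕ} (J : Matrix (Fin n ⊕ Fin n) (Fin n ⊕ Fin n) F) : Prop :=
  ∃ P : GL (Fin n ⊕ Fin n) F,
    (P : Matrix (Fin n ⊕ Fin n) (Fin n ⊕ Fin n) F)ᵀ * J * P = Jsplit n F

/-- The symplectic similitude group `GSp(2n, F)`. -/
def GSp (n : ℕ) (F : Type*) [Field F] : Subgroup (GL (Fin n ⊕ Fin n) F) :=
  similitudeGroup (Jsp n F)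

/-- The symplectic group `Sp(2n, F)`. -/
def Sp (n : ℕ) (F : Type*) [Field F] : Subgroup (GL (Fin n ⊕ Fin n) F) :=
  fixGroup (Jsp n F)


/-- The underlying matrix of an element of a matrix subgroup. -/
def matOf {S : Subgroup (GL N F)} (g : ↥S) : Matrix N N F := ((g : GL N F) : Matrix N N F)

end Groups

noncomputable instance subgroupFintype {G : Type*} [Group G] [Finite G] (S : Subgroup G) :
    Fintype S := Fintype.ofFinite _

end

end

section

open scoped Classical

/-- In a finite `p`-group, a normal subgroup `M` not contained in the normal subgroup `N`
contains an element outside `N` which is central modulo `N`. -/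
theorem IsPGroup.exists_central_mod {p : ℕ} [Fact p.Prime] {T : Type*} [Group T] [Finite T]
    (hT : IsPGroup p T) (N M : Subgroup T) [N.Normal] [M.Normal] (h : ¬ M ≤ N) (hNM : N ≤ M) :
    ∃ x ∈ M, x ∉ N ∧ ∀ g : T, g * x * g⁻¹ * x⁻¹ ∈ N := by
  have hQ : IsPGroup p (T ⧸ N) := hT.to_quotient N
  let Mb : Subgroup (T ⧸ N) := M.map (QuotientGroup.mk' N)
  have hMbn : Mb.Normal := Subgroup.Normal.map inferInstance _ (QuotientGroup.mk'_surjective N)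
  have hT' : IsPGroup p (ConjAct (T ⧸ N)) := hQ
  have hne : Mb ≠ ⊥ := by
    intro hb
    apply h
    have := (Subgroup.map_eq_bot_iff M).1 hb
    simpa using this
  have hdvd : p ∣ Nat.card Mb := by
    have hp : IsPGroup p Mb := hQ.to_subgroup _
    obtain ⟨k, hk⟩ := IsPGroup.iff_card.1 hp
    rw [hk]
    apply dvd_pow_self
    rintro rfl
    apply hne
    rw [pow_zero] at hk
    exact Subgroup.card_eq_one.1 hk
  obtain ⟨b, hb, hb1⟩ := hT'.exists_fixed_point_of_prime_dvd_card_of_fixed_point Mb hdvd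
    (a := 1) (by intro g; ext; simp)
  obtain ⟨x, hxM, hx⟩ := b.2
  have hxb : ((x : T) : T ⧸ N) = (b : T ⧸ N) := hx
  refine ⟨x, hxM, ?_, ?_⟩
  · intro hxN
    apply hb1
    ext
    rw [← hxb]
    exact ((QuotientGroup.eq_one_iff x).2 hxN).symm
  · intro g
    have := hb (ConjAct.toConjAct (g : T ⧸ N))
    have h2 := congrArg Subtype.val this
    rw [ConjAct.Subgroup.val_conj_smul, ConjAct.smul_def, ConjAct.ofConjAct_toConjAct, ← hxb] at h2
    rw [← QuotientGroup.eq_one_iff]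
    change (g : T ⧸ N) * (x : T ⧸ N) * (g : T ⧸ N)⁻¹ * (x : T ⧸ N)⁻¹ = 1
    rw [h2, mul_inv_cancel]

/-- A finite `p`-group has a self-centralizing normal abelian subgroup. -/
theorem IsPGroup.exists_normal_selfCentralizing {p : ℕ} [Fact p.Prime] {T : Type*} [Group T]
    [Finite T] (hT : IsPGroup p T) :
    ∃ A : Subgroup T, A.Normal ∧ ∀ g : T, g ∈ A ↔ ∀ a ∈ A, g * a = a * g := by
  have hfin : Finite (Subgroup T) := inferInstance
  let S : Set (Subgroup T) := {A | A.Normal ∧ ∀ a ∈ A, ∀ b ∈ A, a * b = b * a}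
  have hS : S.Nonempty := ⟨⊥, Subgroup.normal_bot, by simp⟩
  obtain ⟨A, hA⟩ := S.toFinite.exists_maximal hS
  obtain ⟨⟨hAn, hAc⟩, hmax⟩ := hA
  refine ⟨A, hAn, fun g => ⟨fun hg a ha => hAc g hg a ha, fun hg => ?_⟩⟩
  by_contra hgA
  have hle : A ≤ Subgroup.centralizer (A : Set T) := fun a ha =>
    Subgroup.mem_centralizer_iff.2 fun b hb => hAc b hb a ha
  have hnle : ¬ Subgroup.centralizer (A : Set T) ≤ A := fun h =>
    hgA (h (Subgroup.mem_centralizer_iff.2 fun b hb => (hg b hb).symm))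
  obtain ⟨x, hxC, hxA, hx⟩ := hT.exists_central_mod A _ hnle hle
  rw [Subgroup.mem_centralizer_iff] at hxC
  let B : Subgroup T := Subgroup.closure (insert x (A : Set T))
  have hAB : A ≤ B := fun a ha => Subgroup.subset_closure (Set.mem_insert_of_mem _ ha)
  have hxB : x ∈ B := Subgroup.subset_closure (Set.mem_insert _ _)
  have hBn : B.Normal := by
    refine ⟨fun b hb g => ?_⟩
    induction hb using Subgroup.closure_induction with
    | mem y hy =>
      rcases hy with rfl | hy
      · have : g * y * g⁻¹ = (g * y * g⁻¹ * y⁻¹) * y := by group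
        rw [this]
        exact B.mul_mem (hAB (hx g)) hxB
      · exact hAB (hAn.conj_mem y hy g)
    | one => simp
    | mul y w _ _ hy hw =>
      have : g * (y * w) * g⁻¹ = (g * y * g⁻¹) * (g * w * g⁻¹) := by group
      rw [this]; exact B.mul_mem hy hw
    | inv y _ hy =>
      have : g * y⁻¹ * g⁻¹ = (g * y * g⁻¹)⁻¹ := by group
      rw [this]; exact B.inv_mem hy
  have hBc : ∀ a ∈ B, ∀ b ∈ B, a * b = b * a := by
    have h1 : B ≤ Subgroup.centralizer (insert x (A : Set T)) := by
      rw [Subgroup.closure_le]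
      intro y hy
      rw [SetLike.mem_coe, Subgroup.mem_centralizer_iff]
      rintro w (rfl | hw)
      · rcases hy with rfl | hy
        · rfl
        · exact (hxC y hy).symm
      · rcases hy with rfl | hy
        · exact hxC w hw
        · exact hAc w hw y hy
    have h2 : B ≤ Subgroup.centralizer (B : Set T) := by
      rw [Subgroup.closure_le]
      intro y hy
      rw [SetLike.mem_coe, Subgroup.mem_centralizer_iff]
      intro w hw
      exact (Subgroup.mem_centralizer_iff.1 (h1 hw) y hy).symm
    intro a ha b hb
    exact Subgroup.mem_centralizer_iff.1 (h2 hb) a ha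
  exact hxA (hmax ⟨hBn, hBc⟩ hAB hxB)

/-- A finite abelian `2`-group with at most two square roots of `1` is cyclic. -/
theorem IsPGroup.isCyclic_of_card_sq_eq_one_le {A : Type*} [CommGroup A] [Fintype A]
    (hA : IsPGroup 2 A) (h : (Finset.univ.filter fun y : A => y ^ 2 = 1).card ≤ 2) :
    IsCyclic A := by
  have key : ∀ k : ℕ, (Finset.univ.filter fun y : A => y ^ (2 ^ k) = 1).card ≤ 2 ^ k := by
    intro k
    induction k with
    | zero =>
      simp only [pow_zero, pow_one]
      rw [Finset.card_le_one]
      intro a ha b hb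
      rw [(Finset.mem_filter.1 ha).2, (Finset.mem_filter.1 hb).2]
    | succ k ih =>
      have hmap : ∀ y ∈ (Finset.univ.filter fun y : A => y ^ (2 ^ (k + 1)) = 1),
          y ^ 2 ∈ (Finset.univ.filter fun y : A => y ^ (2 ^ k) = 1) := by
        intro y hy
        simp only [Finset.mem_filter, Finset.mem_univ, true_and] at hy ⊢
        rw [← pow_mul, ← pow_succ', hy]
      refine (Finset.card_le_mul_card_image_of_maps_to hmap 2 ?_).trans ?_
      · intro b _
        by_cases hb : ∃ y0 : A, y0 ^ 2 = b
        · obtain ⟨y0, rfl⟩ := hb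
          refine le_trans (Finset.card_le_card_of_injOn (fun y => y * y0⁻¹) ?_ ?_) h
          · intro y hy
            simp only [Finset.coe_filter, Finset.mem_filter, Finset.mem_univ, true_and,
              Set.mem_ofPred_eq] at hy ⊢
            rw [mul_pow, hy.2, inv_pow, mul_inv_cancel]
          · intro y _ w _ hyw
            simpa using hyw
        · rw [Finset.card_eq_zero.2]
          · omega
          · ext y
            simp only [Finset.mem_filter, Finset.mem_univ, true_and, Finset.notMem_empty,
              iff_false, not_and]
            exact fun _ hy => hb ⟨y, hy⟩
      · rw [pow_succ']; omega
  refine isCyclic_of_card_pow_eq_one_le fun n hn => ?_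
  obtain ⟨m, hm⟩ := IsPGroup.iff_card.1 hA
  obtain ⟨k, hk1, hk⟩ := (Nat.dvd_prime_pow Nat.prime_two).1
    (Nat.gcd_dvd_right n (2 ^ m))
  have hle : 2 ^ k ≤ n := hk ▸ Nat.gcd_le_left _ hn
  refine le_trans (Finset.card_le_card ?_) ((key k).trans hle)
  intro y hy
  simp only [Finset.mem_filter, Finset.mem_univ, true_and] at hy ⊢
  rw [← hk]
  rw [← orderOf_dvd_iff_pow_eq_one] at hy ⊢
  exact Nat.dvd_gcd hy (hm ▸ orderOf_dvd_natCard y)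

/-- In a finite `2`-group `T` with a central involution `z`, either there is an involution
`s ≠ z` whose conjugates all lie in `{s, z s}`, or `T` has a cyclic normal subgroup of index
at most `2`. -/
theorem IsPGroup.exists_involution_or_cyclic {T : Type*} [Group T] [Finite T] (hT : IsPGroup 2 T)
    (z : T) (hz : ∀ g, g * z = z * g) (hz2 : z * z = 1) (hz1 : z ≠ 1) :
    (∃ s : T, s * s = 1 ∧ s ≠ 1 ∧ s ≠ z ∧ ∀ g, g * s * g⁻¹ = s ∨ g * s * g⁻¹ = z * s) ∨
      ∃ a : T, (Subgroup.zpowers a).Normal ∧ (Subgroup.zpowers a).index ≤ 2 := by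
  obtain ⟨A, hAn, hAC⟩ := hT.exists_normal_selfCentralizing
  have hcomm : ∀ a ∈ A, ∀ b ∈ A, a * b = b * a := fun a ha => (hAC a).1 ha
  have hzA : z ∈ A := (hAC z).2 fun a _ => (hz a).symm
  have hzz : ∀ g, g * z * g⁻¹ = z := fun g => by rw [hz g, mul_inv_cancel_right]
  have hZ : ∀ y, y ∈ Subgroup.zpowers z ↔ y = 1 ∨ y = z := by
    intro y
    constructor
    · rintro ⟨k, rfl⟩
      rcases Int.even_or_odd k with hk | hk
      · left
        obtain ⟨l, rfl⟩ := hk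
        beta_reduce
        rw [← two_mul, zpow_mul, zpow_two, hz2, one_zpow]
      · right
        obtain ⟨l, rfl⟩ := hk
        beta_reduce
        rw [zpow_add, zpow_mul, zpow_two, hz2, one_zpow, one_mul, zpow_one]
    · rintro (rfl | rfl)
      · exact Subgroup.one_mem _
      · exact Subgroup.mem_zpowers _
  letI : CommGroup A := { (inferInstance : Group A) with
    mul_comm := fun a b => Subtype.ext (hcomm a a.2 b b.2) }
  letI : Fintype A := Fintype.ofFinite A
  by_cases hcard : ∃ s ∈ A, s * s = 1 ∧ s ≠ 1 ∧ s ≠ z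
  · left
    let M : Subgroup T :=
      { carrier := {y | y ∈ A ∧ y * y = 1}
        mul_mem' := by
          rintro a b ⟨ha, ha2⟩ ⟨hb, hb2⟩
          refine ⟨A.mul_mem ha hb, ?_⟩
          rw [mul_assoc, ← mul_assoc b, ← hcomm a ha b hb, mul_assoc a, hb2, mul_one, ha2]
        one_mem' := ⟨A.one_mem, by simp⟩
        inv_mem' := by
          rintro a ⟨ha, ha2⟩
          exact ⟨A.inv_mem ha, by rw [← mul_inv_rev, ha2, inv_one]⟩ }
    have hMn : M.Normal := ⟨by
      rintro a ⟨ha, ha2⟩ g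
      refine ⟨hAn.conj_mem a ha g, ?_⟩
      have : g * a * g⁻¹ * (g * a * g⁻¹) = g * (a * a) * g⁻¹ := by group
      rw [this, ha2]; simp⟩
    have hNn : (Subgroup.zpowers z).Normal := ⟨by
      intro a ha g
      rcases (hZ a).1 ha with rfl | rfl
      · simp
      · rw [hzz]; exact ha⟩
    obtain ⟨s, hsA, hs2, hs1, hsz⟩ := hcard
    obtain ⟨x, hxM, hxN, hx⟩ := hT.exists_central_mod (Subgroup.zpowers z) M
      (fun h => by
        rcases (hZ s).1 (h (show s ∈ M from ⟨hsA, hs2⟩)) with h | h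
        · exact hs1 h
        · exact hsz h)
      (fun y hy => by
        rcases (hZ y).1 hy with rfl | rfl
        · exact M.one_mem
        · exact ⟨hzA, hz2⟩)
    rw [hZ, not_or] at hxN
    refine ⟨x, hxM.2, hxN.1, hxN.2, fun g => ?_⟩
    rcases (hZ _).1 (hx g) with h | h
    · left; exact mul_inv_eq_one.1 h
    · right; exact mul_inv_eq_iff_eq_mul.1 h
  · push Not at hcard
    have hinv : ∀ s ∈ A, s * s = 1 → s = 1 ∨ s = z := by
      intro s hs hs2
      by_cases h : s = 1
      · exact Or.inl h
      · exact Or.inr (hcard s hs hs2 h)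
    have hcyc : IsCyclic A := by
      refine IsPGroup.isCyclic_of_card_sq_eq_one_le (hT.to_subgroup A) ?_
      refine le_trans (Finset.card_le_card (t := {1, ⟨z, hzA⟩}) ?_) Finset.card_le_two
      intro y hy
      simp only [Finset.mem_filter, Finset.mem_univ, true_and] at hy
      have hy' : (y : T) * y = 1 := by
        have := congrArg Subtype.val hy
        simpa [sq] using this
      rcases hinv y y.2 hy' with h | h
      · simp [Subtype.ext_iff, h]
      · simp [Subtype.ext_iff, h]
    obtain ⟨⟨a, haA⟩, ha⟩ := hcyc.exists_generator
    have hAa : ∀ y, y ∈ A ↔ ∃ k : ℤ, a ^ k = y := by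
      intro y
      constructor
      · intro hy
        obtain ⟨k, hk⟩ := ha ⟨y, hy⟩
        exact ⟨k, by simpa using congrArg Subtype.val hk⟩
      · rintro ⟨k, rfl⟩
        exact A.zpow_mem haA k
    have hAeq : A = Subgroup.zpowers a := by
      ext y; rw [hAa]; rfl
    -- it suffices to treat the case of index at least three
    by_cases hidx : A.index ≤ 2
    · right; exact ⟨a, hAeq ▸ hAn, hAeq ▸ hidx⟩
    left
    have hpow : ∀ y ∈ A, y ≠ 1 → y ≠ z → ∃ j : ℕ, y ^ j * y ^ j = z := by
      intro y hy hy1 hyz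
      obtain ⟨j, hj⟩ := (IsPGroup.iff_orderOf.1 hT) y
      have hne : ∀ i < j, y ^ (2 ^ i) ≠ 1 := by
        intro i hi h
        have := orderOf_dvd_of_pow_eq_one h
        rw [hj, Nat.pow_dvd_pow_iff_le_right (by norm_num)] at this
        omega
      have hone : y ^ (2 ^ j) = 1 := hj ▸ pow_orderOf_eq_one y
      have h0 : j ≠ 0 := by
        rintro rfl
        exact hy1 (by simpa using hone)
      have h1 : j ≠ 1 := by
        rintro rfl
        rcases hinv y hy (by rw [← sq]; simpa using hone) with h | h
        · exact hy1 h
        · exact hyz h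
      obtain ⟨i, rfl⟩ : ∃ i, j = i + 2 := ⟨j - 2, by omega⟩
      refine ⟨2 ^ i, ?_⟩
      rw [← pow_add, ← two_mul, ← pow_succ']
      refine (hinv _ (A.pow_mem hy _) ?_).resolve_left (hne _ (by omega))
      rw [← pow_add, ← two_mul, ← pow_succ']
      exact hone
    obtain ⟨b, hbA, hb⟩ : ∃ b ∈ A, b * b = z := by
      by_contra hcon
      push Not at hcon
      have hAz : ∀ y ∈ A, y = 1 ∨ y = z := by
        intro y hy
        by_contra h
        rw [not_or] at h
        obtain ⟨j, hj⟩ := hpow y hy h.1 h.2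
        exact hcon _ (A.pow_mem hy j) hj
      have : A = ⊤ := by
        rw [eq_top_iff]
        intro g _
        rw [hAC]
        intro y hy
        rcases hAz y hy with rfl | rfl
        · simp
        · exact hz g
      apply hidx
      rw [this, Subgroup.index_top]
      norm_num
    have hsqrt : ∀ y ∈ A, y * y = z → y = b ∨ y = z * b := by
      intro y hy hyz
      have h1 : y * b⁻¹ * (y * b⁻¹) = 1 := by
        have : y * b⁻¹ * (y * b⁻¹) = y * (b⁻¹ * y) * b⁻¹ := by group
        rw [this, hcomm _ (A.inv_mem hbA) y hy]
        have : y * (y * b⁻¹) * b⁻¹ = (y * y) * (b * b)⁻¹ := by group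
        rw [this, hyz, hb, mul_inv_cancel]
      rcases hinv _ (A.mul_mem hy (A.inv_mem hbA)) h1 with h | h
      · left; exact mul_inv_eq_one.1 h
      · right; exact mul_inv_eq_iff_eq_mul.1 h
    have hconjb : ∀ g : T, g * b * g⁻¹ = b ∨ g * b * g⁻¹ = z * b := by
      intro g
      refine hsqrt _ (hAn.conj_mem b hbA g) ?_
      have : g * b * g⁻¹ * (g * b * g⁻¹) = g * (b * b) * g⁻¹ := by group
      rw [this, hb, hzz]
    obtain ⟨g0, hg0b, hg0A⟩ : ∃ g, g * b = b * g ∧ g ∉ A := by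
      by_contra hcon
      push Not at hcon
      apply hidx
      let f : T ⧸ A → Bool := fun x => decide (x.out * b * x.out⁻¹ = b)
      have hf : Function.Injective f := by
        intro x y hxy
        have hxy' : x.out * b * x.out⁻¹ = y.out * b * y.out⁻¹ := by
          have h := hxy
          simp only [f, decide_eq_decide] at h
          rcases hconjb x.out with hx | hx <;> rcases hconjb y.out with hy | hy
          · rw [hx, hy]
          · rw [hx, h.1 hx]
          · rw [h.2 hy, hy]
          · rw [hx, hy]
        have hmem : (x.out)⁻¹ * y.out ∈ A := by
          apply hcon
          have h2 := congrArg (fun w => x.out⁻¹ * w * y.out) hxy'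
          beta_reduce at h2
          have e1 : x.out⁻¹ * (x.out * b * x.out⁻¹) * y.out = b * (x.out⁻¹ * y.out) := by group
          have e2 : x.out⁻¹ * (y.out * b * y.out⁻¹) * y.out = x.out⁻¹ * y.out * b := by group
          rw [e1, e2] at h2
          exact h2.symm
        rw [← QuotientGroup.out_eq' x, ← QuotientGroup.out_eq' y]
        exact QuotientGroup.eq.2 hmem
      have := Nat.card_le_card_of_injective f hf
      simpa [Subgroup.index] using this
    obtain ⟨g, hgb, hgA, hg2⟩ : ∃ g, g * b = b * g ∧ g ∉ A ∧ g * g ∈ A := by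
      have hex : ∃ j : ℕ, g0 ^ (2 ^ j) ∈ A := by
        obtain ⟨k, hk⟩ := hT g0
        exact ⟨k, by rw [hk]; exact A.one_mem⟩
      have hj := Nat.find_spec hex
      have hj0 : Nat.find hex ≠ 0 := by
        intro h
        rw [h] at hj
        exact hg0A (by simpa using hj)
      refine ⟨g0 ^ (2 ^ (Nat.find hex - 1)), ?_, Nat.find_min hex (by omega), ?_⟩
      · exact (show Commute g0 b from hg0b).pow_left _
      · rw [← pow_add, ← two_mul, ← pow_succ', Nat.sub_add_cancel (by omega)]
        exact hj
    have hM : ∀ y ∈ A, g * y * g⁻¹ = y⁻¹ → y = 1 ∨ y = z := by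
      intro y hy hgy
      by_contra h
      rw [not_or] at h
      obtain ⟨j, hj⟩ := hpow y hy h.1 h.2
      have h1 : g * y ^ j * g⁻¹ = (y ^ j)⁻¹ := by rw [← conj_pow, hgy, inv_pow]
      have h2 : g * y ^ j * g⁻¹ = y ^ j := by
        rcases hsqrt _ (A.pow_mem hy j) hj with h | h
        · rw [h, hgb, mul_inv_cancel_right]
        · rw [h, ← mul_assoc, hz g, mul_assoc z, hgb, mul_assoc, mul_inv_cancel_right]
      rw [h2] at h1
      apply hz1
      rw [← hj]
      nth_rewrite 2 [h1]
      rw [mul_inv_cancel]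
    have hga : g * a * g⁻¹ = z * a := by
      have hyA : g * a * g⁻¹ * a⁻¹ ∈ A := A.mul_mem (hAn.conj_mem a haA g) (A.inv_mem haA)
      have hgg : g * (g * a * g⁻¹ * a⁻¹) * g⁻¹ = (g * a * g⁻¹ * a⁻¹)⁻¹ := by
        have e1 : g * (g * a * g⁻¹ * a⁻¹) * g⁻¹ = (g * g * a) * (g * g)⁻¹ * (g * a⁻¹ * g⁻¹) := by
          group
        rw [e1, hcomm _ hg2 a haA]
        group
      rcases hM _ hyA hgg with h | h
      · exfalso
        apply hgA
        rw [hAC]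
        intro y hy
        obtain ⟨k, rfl⟩ := (hAa y).1 hy
        have : Commute g a := by
          have := mul_inv_eq_one.1 h
          exact mul_inv_eq_iff_eq_mul.1 this
        exact this.zpow_right k
      · exact mul_inv_eq_iff_eq_mul.1 h
    have hgak : ∀ k : ℤ, g * a ^ k * g⁻¹ = z ^ k * a ^ k := by
      intro k
      rw [← conj_zpow, hga]
      exact (show Commute z a from (hz a).symm).mul_zpow k
    obtain ⟨s, h, hhA, rfl, hs2⟩ : ∃ s, ∃ h ∈ A, s = g * h ∧ s * s = 1 := by
      obtain ⟨k, hk⟩ := (hAa _).1 hg2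
      have hzk : z ^ k = 1 := by
        have h1 := hgak k
        rw [hk] at h1
        have e1 : g * (g * g) * g⁻¹ = 1 * (g * g) := by group
        rw [e1] at h1
        exact (mul_right_cancel h1).symm
      have hke : Even k := by
        by_contra hodd
        rw [Int.not_even_iff_odd] at hodd
        obtain ⟨l, rfl⟩ := hodd
        apply hz1
        rw [zpow_add, zpow_mul, zpow_two, hz2, one_zpow, one_mul, zpow_one] at hzk
        exact hzk
      obtain ⟨l, rfl⟩ := hke
      have hs0 : g * a ^ (-l) * (g * a ^ (-l)) = z ^ (-l) := by
        have e1 : g * a ^ (-l) * (g * a ^ (-l)) = (g * a ^ (-l) * g⁻¹) * (g * g) * a ^ (-l) := by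
          group
        rw [e1, hgak, ← hk, mul_assoc, mul_assoc, ← zpow_add, ← zpow_add]
        simp
      rcases (hZ (z ^ (-l))).1 (Subgroup.zpow_mem _ (Subgroup.mem_zpowers z) _) with h1 | h1
      · exact ⟨_, a ^ (-l), A.zpow_mem haA _, rfl, hs0.trans h1⟩
      · refine ⟨_, a ^ (-l) * b, A.mul_mem (A.zpow_mem haA _) hbA, rfl, ?_⟩
        have hc1 : Commute b (g * a ^ (-l)) :=
          (show Commute b g from hgb.symm).mul_right (hcomm b hbA _ (A.zpow_mem haA _))
        have e1 : g * (a ^ (-l) * b) * (g * (a ^ (-l) * b)) =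
            g * a ^ (-l) * (b * (g * a ^ (-l))) * b := by group
        rw [e1, hc1.eq]
        have e2 : g * a ^ (-l) * (g * a ^ (-l) * b) * b =
            g * a ^ (-l) * (g * a ^ (-l)) * (b * b) := by group
        rw [e2, hs0, h1, hb, hz2]
    have hsA : g * h ∉ A := fun hc => hgA (by simpa using A.mul_mem hc (A.inv_mem hhA))
    refine ⟨g * h, hs2, fun hc => hsA (hc ▸ A.one_mem), fun hc => hsA (hc ▸ hzA), fun r => ?_⟩
    generalize hs : g * h = s at *
    have hconj : ∀ u : T, ∃ i : ℤ, ∀ k : ℤ, u * a ^ k * u⁻¹ = a ^ (i * k) := by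
      intro u
      obtain ⟨i, hi⟩ := (hAa _).1 (hAn.conj_mem a haA u)
      exact ⟨i, fun k => by rw [← conj_zpow, ← hi, zpow_mul]⟩
    obtain ⟨i, hi⟩ := hconj r
    obtain ⟨j, hj⟩ := hconj s
    have hcA : r * s * r⁻¹ * s⁻¹ ∈ A := by
      rw [hAC]
      intro y hy
      obtain ⟨k, hk⟩ := (hAa _).1 (hAn.conj_mem y hy ((s * r)⁻¹))
      have h1 : (s * r) * a ^ k * (s * r)⁻¹ = y := by rw [hk]; group
      have h2 : (r * s) * a ^ k * (r * s)⁻¹ = y := by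
        rw [← h1]
        have e1 : (r * s) * a ^ k * (r * s)⁻¹ = r * (s * a ^ k * s⁻¹) * r⁻¹ := by group
        have e2 : (s * r) * a ^ k * (s * r)⁻¹ = s * (r * a ^ k * r⁻¹) * s⁻¹ := by group
        rw [e1, e2, hi, hj, hi, hj]
        congr 1; ring
      nth_rewrite 1 [← h1]
      rw [← h2]
      group
    generalize hc : r * s * r⁻¹ * s⁻¹ = c at *
    have hrs : r * s * r⁻¹ = c * s := by rw [← hc]; group
    have hss : s⁻¹ = s := inv_eq_of_mul_eq_one_left hs2
    have h1 : s * c * s⁻¹ = c⁻¹ := by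
      rw [eq_inv_iff_mul_eq_one]
      have : (r * s * r⁻¹) * (r * s * r⁻¹) = 1 := by
        have : (r * s * r⁻¹) * (r * s * r⁻¹) = r * (s * s) * r⁻¹ := by group
        rw [this, hs2]; simp
      rw [hrs] at this
      rw [hss]
      have e : s * c * s * c = c⁻¹ * (c * s * (c * s)) * c := by group
      rw [e, this]; simp
    have h2 : s * c * s⁻¹ = g * c * g⁻¹ := by
      rw [← hs]
      have e : g * h * c * (g * h)⁻¹ = g * (h * c) * h⁻¹ * g⁻¹ := by group
      rw [e, hcomm h hhA c hcA]; group
    rw [hrs]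
    rcases hM c hcA (h2 ▸ h1) with h | h
    · left; rw [h, one_mul]
    · right; rw [h]
end

section

open scoped Classical
variable {Γ Γ₁ Γ₂ I J : Type*} [Group Γ] [Fintype Γ] [Group Γ₁] [Fintype Γ₁] [Group Γ₂] [Fintype Γ₂]
  [Fintype I] [Fintype J]

/-- The matrix of right translation by a finite family of group elements. -/
noncomputable def translationMatrix (s : I → Γ) : Matrix Γ Γ ℝ :=
  Matrix.of fun g h => ∑ i, if g * s i = h then (1 : ℝ) else 0

theorem translationMatrix_apply (s : I → Γ) (g h : Γ) :
    translationMatrix s g h = ∑ i, if g * s i = h then (1 : ℝ) else 0 := rfl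

/-- A finite family of elements of a group is positive if the associated sum of right translations
is a positive semidefinite matrix. -/
def IsPosFamily (s : I → Γ) : Prop := (translationMatrix s).PosSemidef

theorem dotProduct_translationMatrix (s : I → Γ) (c : Γ → ℝ) :
    dotProduct c ((translationMatrix s).mulVec c) = ∑ i, ∑ g, c g * c (g * s i) := by
  simp only [dotProduct, Matrix.mulVec, translationMatrix_apply]
  rw [Finset.sum_comm]
  refine Finset.sum_congr rfl fun g _ => ?_
  simp only [Finset.sum_mul]
  rw [Finset.sum_comm]
  simp [Finset.mul_sum]

theorem isPosFamily_iff (s : I → Γ) : IsPosFamily s ↔ (translationMatrix s).IsSymm ∧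
    ∀ c : Γ → ℝ, 0 ≤ ∑ i, ∑ g, c g * c (g * s i) := by
  unfold IsPosFamily
  rw [Matrix.posSemidef_iff_dotProduct_mulVec]
  simp only [star_trivial, dotProduct_translationMatrix]
  rw [Matrix.IsHermitian, Matrix.conjTranspose_eq_transpose_of_trivial]
  rfl

theorem IsPosFamily.reindex {s : I → Γ} (hs : IsPosFamily s) (e : J ≃ I) :
    IsPosFamily (fun j => s (e j)) := by
  have : translationMatrix (fun j => s (e j)) = translationMatrix s := by
    ext g h
    simp only [translationMatrix_apply]
    exact e.sum_comp fun i => if g * s i = h then (1 : ℝ) else 0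
  rwa [IsPosFamily, this]

theorem translationMatrix_isSymm (s : I → Γ) (e : I ≃ I) (he : ∀ i, s (e i) = (s i)⁻¹) :
    (translationMatrix s).IsSymm := by
  ext g h
  simp only [Matrix.transpose_apply, translationMatrix_apply]
  rw [← e.sum_comp]
  refine Finset.sum_congr rfl fun i _ => if_congr ?_ rfl rfl
  rw [he, mul_inv_eq_iff_eq_mul, eq_comm]

theorem IsPosFamily.map {s : I → Γ₁} (hs : IsPosFamily s) (φ : Γ₁ →* Γ) :
    IsPosFamily (fun i => φ (s i)) := by
  rw [isPosFamily_iff] at hs ⊢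
  obtain ⟨h1, h2⟩ := hs
  have hsum : ∀ k : Γ₁, ∑ i, (if s i = k then (1 : ℝ) else 0) = ∑ i, if s i = k⁻¹ then (1 : ℝ) else 0 := by
    intro k
    have := congrFun (congrFun h1 1) k
    simp only [Matrix.transpose_apply, translationMatrix_apply, one_mul] at this
    rw [← this]
    refine Finset.sum_congr rfl fun i _ => if_congr ?_ rfl rfl
    rw [mul_eq_one_iff_inv_eq, eq_comm]
  refine ⟨?_, fun c => ?_⟩
  · have key : ∀ f : Γ₁ → ℝ, ∑ i, f (s i) = ∑ k, f k * ∑ i, (if s i = k then (1 : ℝ) else 0) := by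
      intro f
      simp only [Finset.mul_sum]
      rw [Finset.sum_comm]
      simp
    ext g h
    simp only [Matrix.transpose_apply, translationMatrix_apply]
    rw [key (fun k => if h * φ k = g then (1 : ℝ) else 0),
      key (fun k => if g * φ k = h then (1 : ℝ) else 0),
      ← Equiv.sum_comp (Equiv.inv Γ₁)]
    refine Finset.sum_congr rfl fun k _ => ?_
    simp only [Equiv.inv_apply]
    rw [hsum k, map_inv, if_congr (mul_inv_eq_iff_eq_mul.trans eq_comm) rfl rfl]
  · have h3 : ∀ k : Γ₁, ∑ i, ∑ g, c (g * φ k) * c (g * φ (k * s i)) =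
        ∑ i, ∑ g, c g * c (g * φ (s i)) := by
      intro k
      refine Finset.sum_congr rfl fun i _ => ?_
      rw [← Equiv.sum_comp (Equiv.mulRight (φ k)) fun g => c g * c (g * φ (s i))]
      simp [mul_assoc]
    have h4 : 0 ≤ ∑ k : Γ₁, ∑ i, ∑ g, c (g * φ k) * c (g * φ (k * s i)) := by
      have : ∑ k : Γ₁, ∑ i, ∑ g, c (g * φ k) * c (g * φ (k * s i)) =
          ∑ g, ∑ i, ∑ k : Γ₁, c (g * φ k) * c (g * φ (k * s i)) := by
        rw [Finset.sum_comm, Finset.sum_congr rfl fun i _ => Finset.sum_comm, Finset.sum_comm]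
      rw [this]
      exact Finset.sum_nonneg fun g _ => h2 fun k => c (g * φ k)
    simp only [h3, Finset.sum_const, Finset.card_univ, nsmul_eq_mul] at h4
    exact nonneg_of_mul_nonneg_right h4 (by exact_mod_cast Fintype.card_pos)

theorem IsPosFamily.prod {s₁ : I → Γ₁} {s₂ : J → Γ₂} (h₁ : IsPosFamily s₁) (h₂ : IsPosFamily s₂) :
    IsPosFamily (fun i : I × J => (s₁ i.1, s₂ i.2)) := by
  have : translationMatrix (fun i : I × J => (s₁ i.1, s₂ i.2)) =
      Matrix.kronecker (translationMatrix s₁) (translationMatrix s₂) := by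
    ext ⟨g, g'⟩ ⟨h, h'⟩
    change _ = translationMatrix s₁ g h * translationMatrix s₂ g' h'
    simp only [translationMatrix_apply, Finset.sum_mul_sum, Prod.mk_mul_mk, Prod.mk.injEq]
    rw [Fintype.sum_prod_type]
    refine Finset.sum_congr rfl fun i _ => Finset.sum_congr rfl fun j _ => ?_
    split_ifs <;> simp_all
  rw [IsPosFamily, this]
  exact Matrix.PosSemidef.kronecker h₁ h₂

theorem IsPosFamily.sum {s : I → Γ} {s' : J → Γ} (h : IsPosFamily s) (h' : IsPosFamily s') :
    IsPosFamily (Sum.elim s s') := by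
  have : translationMatrix (Sum.elim s s') = translationMatrix s + translationMatrix s' := by
    ext g h
    simp only [Matrix.add_apply, translationMatrix_apply, Fintype.sum_sum_type, Sum.elim_inl, Sum.elim_inr]
    rfl
  rw [IsPosFamily, this]
  exact Matrix.PosSemidef.add h h'

theorem IsPosFamily.union {s : I × J → Γ} (h : ∀ j, IsPosFamily fun i => s (i, j)) :
    IsPosFamily s := by
  have : translationMatrix s = ∑ j, translationMatrix fun i => s (i, j) := by
    ext g h
    simp only [Matrix.sum_apply, translationMatrix_apply, Fintype.sum_prod_type]
    exact Finset.sum_comm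
  rw [IsPosFamily, this]
  exact Matrix.posSemidef_sum _ fun j _ => h j

theorem IsPosFamily.group : IsPosFamily (fun g : Γ => g) := by
  rw [isPosFamily_iff]
  refine ⟨translationMatrix_isSymm _ (Equiv.inv Γ) fun i => rfl, fun c => ?_⟩
  rw [Finset.sum_comm]
  have : ∀ g, ∑ k, c g * c (g * k) = c g * ∑ k, c k := fun g => by
    rw [← Finset.mul_sum]
    exact congrArg _ (Equiv.sum_comp (Equiv.mulLeft g) c)
  simp only [this, ← Finset.sum_mul]
  exact mul_self_nonneg _

/-- Diagonal dominance. -/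
theorem IsPosFamily.of_card_le (s : I → Γ) (e : I ≃ I) (he : ∀ i, s (e i) = (s i)⁻¹)
    (hs : Fintype.card I ≤ 2 * (Finset.univ.filter fun i => s i = 1).card) : IsPosFamily s := by
  rw [isPosFamily_iff]
  refine ⟨translationMatrix_isSymm s e he, fun c => ?_⟩
  have h1 : ∀ i, (if s i = 1 then (2:ℝ) else 0) * (∑ g, c g ^ 2) - ∑ g, c g ^ 2 ≤ ∑ g, c g * c (g * s i) := by
    intro i
    split_ifs with h
    · rw [h]; simp only [mul_one]
      apply le_of_eq
      rw [two_mul, add_sub_cancel_right]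
      exact Finset.sum_congr rfl fun g _ => sq (c g)
    · have h2 : ∑ g, c (g * s i) ^ 2 = ∑ g, c g ^ 2 := Equiv.sum_comp (Equiv.mulRight (s i)) fun g => c g ^ 2
      have : 0 ≤ ∑ g, (c g + c (g * s i)) ^ 2 := Finset.sum_nonneg fun g _ => sq_nonneg _
      have h3 : ∑ g, (c g + c (g * s i)) ^ 2 = ∑ g, c g ^ 2 + ∑ g, c (g * s i) ^ 2 + 2 * ∑ g, c g * c (g * s i) := by
        rw [Finset.mul_sum, ← Finset.sum_add_distrib, ← Finset.sum_add_distrib]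
        exact Finset.sum_congr rfl fun g _ => by ring
      linarith
  refine le_trans ?_ (Finset.sum_le_sum fun i _ => h1 i)
  rw [Finset.sum_sub_distrib, ← Finset.sum_mul, Finset.sum_const, Finset.card_univ, nsmul_eq_mul,
    ← sub_mul]
  refine mul_nonneg ?_ (Finset.sum_nonneg fun g _ => sq_nonneg _)
  rw [← Finset.sum_filter, Finset.sum_const, nsmul_eq_mul, sub_nonneg]
  have : (Fintype.card I : ℝ) ≤ ((2 * (Finset.univ.filter fun i => s i = 1).card : ℕ) : ℝ) := by
    exact_mod_cast hs
  push_cast at this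
  linarith
end

section

open scoped Classical
variable {Γ Γ₁ Γ₂ : Type*} [Group Γ] [Fintype Γ] [Group Γ₁] [Fintype Γ₁] [Group Γ₂] [Fintype Γ₂]

/-- The subgroup `C` has a maximal `2`-subgroup `T` normalised by some `t ∈ S` with `t ^ 2 ∈ T` such
that the family of squares of the coset `T t` is positive. -/
def HasPosTwist (C : Subgroup Γ) (S : Set Γ) : Prop :=
  ∃ T : Subgroup Γ, T ≤ C ∧ IsPGroup 2 T ∧
    (∀ Q : Subgroup Γ, Q ≤ C → IsPGroup 2 Q → Nat.card Q ≤ Nat.card T) ∧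
    ∃ t ∈ S, (∀ g ∈ T, t * g * t⁻¹ ∈ T) ∧ t * t ∈ T ∧
      IsPosFamily (fun h : T => (h : Γ) * t * (h * t))

theorem card_le_card_mul_card_of_le_range (Φ : Γ₁ × Γ₂ →* Γ) (hΦ : Function.Injective Φ)
    {C₁ : Subgroup Γ₁} {C₂ : Subgroup Γ₂} {n₁ n₂ : ℕ}
    (h₁ : ∀ Q : Subgroup Γ₁, Q ≤ C₁ → IsPGroup 2 Q → Nat.card Q ≤ n₁)
    (h₂ : ∀ Q : Subgroup Γ₂, Q ≤ C₂ → IsPGroup 2 Q → Nat.card Q ≤ n₂)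
    (P : Subgroup Γ) (hP2 : IsPGroup 2 P) (hP : ∀ a b, Φ (a, b) ∈ P → a ∈ C₁ ∧ b ∈ C₂)
    (hPr : P ≤ Φ.range) : Nat.card P ≤ n₁ * n₂ := by
  have hQ : IsPGroup 2 (P.comap Φ) := hP2.comap_of_injective Φ hΦ
  have hcard : Nat.card P = Nat.card (P.comap Φ) := by
    rw [← Subgroup.card_map_of_injective hΦ, Subgroup.map_comap_eq_self hPr]
  have hle : P.comap Φ ≤ ((P.comap Φ).map (MonoidHom.fst Γ₁ Γ₂)).prod
      ((P.comap Φ).map (MonoidHom.snd Γ₁ Γ₂)) := fun x hx => ⟨⟨x, hx, rfl⟩, ⟨x, hx, rfl⟩⟩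
  rw [hcard]
  refine (Subgroup.card_le_of_le hle).trans ?_
  rw [Nat.card_congr (Subgroup.prodEquiv _ _).toEquiv, Nat.card_prod]
  refine Nat.mul_le_mul (h₁ _ ?_ (hQ.map _)) (h₂ _ ?_ (hQ.map _))
  · rintro _ ⟨⟨a, b⟩, hx, rfl⟩
    exact (hP a b hx).1
  · rintro _ ⟨⟨a, b⟩, hx, rfl⟩
    exact (hP a b hx).2

theorem HasPosTwist.prod {C₁ : Subgroup Γ₁} {C₂ : Subgroup Γ₂} {S₁ : Set Γ₁} {S₂ : Set Γ₂}
    (h₁ : HasPosTwist C₁ S₁) (h₂ : HasPosTwist C₂ S₂) {C : Subgroup Γ} {S : Set Γ}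
    (Φ : Γ₁ × Γ₂ →* Γ) (hΦ : Function.Injective Φ)
    (hC : ∀ a b, Φ (a, b) ∈ C ↔ a ∈ C₁ ∧ b ∈ C₂)
    (hS : ∀ a ∈ S₁, ∀ b ∈ S₂, Φ (a, b) ∈ S)
    (P : Subgroup Γ) (hPC : P ≤ C) (hP2 : IsPGroup 2 P)
    (hPmax : ∀ Q : Subgroup Γ, Q ≤ C → IsPGroup 2 Q → Nat.card Q ≤ Nat.card P)
    (hPr : P ≤ Φ.range) : HasPosTwist C S := by
  obtain ⟨T₁, hT₁, hp₁, hm₁, t₁, ht₁, hn₁, hs₁, pos₁⟩ := h₁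
  obtain ⟨T₂, hT₂, hp₂, hm₂, t₂, ht₂, hn₂, hs₂, pos₂⟩ := h₂
  have hcard : Nat.card ((T₁.prod T₂).map Φ) = Nat.card T₁ * Nat.card T₂ := by
    rw [Subgroup.card_map_of_injective hΦ, Nat.card_congr (Subgroup.prodEquiv _ _).toEquiv,
      Nat.card_prod]
  refine ⟨(T₁.prod T₂).map Φ, ?_, ?_, ?_, Φ (t₁, t₂), hS _ ht₁ _ ht₂, ?_, ?_, ?_⟩
  · rintro _ ⟨⟨a, b⟩, hx, rfl⟩
    exact (hC a b).2 ⟨hT₁ hx.1, hT₂ hx.2⟩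
  · obtain ⟨k, hk⟩ := IsPGroup.iff_card.1 hp₁
    obtain ⟨l, hl⟩ := IsPGroup.iff_card.1 hp₂
    exact IsPGroup.of_card (n := k + l) (by rw [hcard, hk, hl, pow_add])
  · intro Q hQ hQ2
    rw [hcard]
    exact (hPmax Q hQ hQ2).trans (card_le_card_mul_card_of_le_range Φ hΦ hm₁ hm₂ P hP2
      (fun a b h => (hC a b).1 (hPC h)) hPr)
  · rintro _ ⟨⟨a, b⟩, hx, rfl⟩
    exact ⟨(t₁ * a * t₁⁻¹, t₂ * b * t₂⁻¹), ⟨hn₁ _ hx.1, hn₂ _ hx.2⟩, by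
      rw [← map_inv, ← map_mul, ← map_mul]; rfl⟩
  · exact ⟨(t₁ * t₁, t₂ * t₂), ⟨hs₁, hs₂⟩, by rw [← map_mul]; rfl⟩
  · let e := ((Subgroup.prodEquiv T₁ T₂).symm.trans
      ((T₁.prod T₂).equivMapOfInjective Φ hΦ)).toEquiv
    have := ((pos₁.prod pos₂).map Φ).reindex e.symm
    convert this using 2 with h
    obtain ⟨⟨a, b⟩, rfl⟩ := e.surjective h
    rw [e.symm_apply_apply]
    have : ((e (a, b) : (T₁.prod T₂).map Φ) : Γ) = Φ ((a : Γ₁), (b : Γ₂)) := rfl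
    rw [this, ← map_mul, ← map_mul]
    rfl

theorem HasPosTwist.swap {C₁ : Subgroup Γ₁} {S₁ : Set Γ₁}
    (h₁ : HasPosTwist C₁ S₁) {C : Subgroup Γ} {S : Set Γ}
    (Φ : Γ₁ × Γ₁ →* Γ) (hΦ : Function.Injective Φ)
    (hC : ∀ a b, Φ (a, b) ∈ C ↔ a ∈ C₁ ∧ b ∈ C₁)
    (hS : ∀ a ∈ S₁, Φ (a, a) ∈ S) (w : Γ) (hw2 : w * w = 1) (hwC : w ∈ C) (hwr : w ∉ Φ.range)
    (hw : ∀ a b, w * Φ (a, b) * w = Φ (b, a))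
    (P : Subgroup Γ) (hPC : P ≤ C) (hP2 : IsPGroup 2 P)
    (hPmax : ∀ Q : Subgroup Γ, Q ≤ C → IsPGroup 2 Q → Nat.card Q ≤ Nat.card P)
    (hPr : ∀ g ∈ P, g ∈ Φ.range ∨ g * w ∈ Φ.range) : HasPosTwist C S := by
  obtain ⟨T₁, hT₁, hp₁, hm₁, t₁, ht₁, hn₁, hs₁, pos₁⟩ := h₁
  obtain ⟨T₀, hT₀⟩ : ∃ T₀, T₀ = (T₁.prod T₁).map Φ := ⟨_, rfl⟩
  have hww : ∀ g, g * w * w = g := fun g => by rw [mul_assoc, hw2, mul_one]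
  have hww' : ∀ g, w * (w * g) = g := fun g => by rw [← mul_assoc, hw2, one_mul]
  have hwinv : w⁻¹ = w := inv_eq_of_mul_eq_one_left hw2
  have hcard : Nat.card T₀ = Nat.card T₁ * Nat.card T₁ := by
    rw [hT₀, Subgroup.card_map_of_injective hΦ, Nat.card_congr (Subgroup.prodEquiv _ _).toEquiv,
      Nat.card_prod]
  have hmem : ∀ a b, Φ (a, b) ∈ T₀ ↔ a ∈ T₁ ∧ b ∈ T₁ := by
    intro a b
    rw [hT₀, Subgroup.mem_map_iff_mem hΦ]; rfl
  have hT₀r : T₀ ≤ Φ.range := by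
    rw [hT₀]; exact Subgroup.map_le_range _ _
  have hwT : ∀ g ∈ T₀, w * g * w ∈ T₀ := by
    intro g hg
    obtain ⟨⟨a, b⟩, rfl⟩ := hT₀r hg
    rw [hw, hmem]
    exact ((hmem _ _).1 hg).symm
  let T : Subgroup Γ :=
    { carrier := {g | g ∈ T₀ ∨ g * w ∈ T₀}
      one_mem' := Or.inl T₀.one_mem
      mul_mem' := by
        rintro g h (hg | hg) (hh | hh)
        · exact Or.inl (T₀.mul_mem hg hh)
        · right; rw [mul_assoc]; exact T₀.mul_mem hg hh
        · right
          have := T₀.mul_mem hg (hwT h hh)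
          simp only [← mul_assoc, hww] at this
          exact this
        · left
          have := T₀.mul_mem hg (hwT _ hh)
          rwa [← mul_assoc (g * w), ← mul_assoc (g * w), hww, ← mul_assoc, hww] at this
      inv_mem' := by
        rintro g (hg | hg)
        · exact Or.inl (T₀.inv_mem hg)
        · right
          have := hwT _ (T₀.inv_mem hg)
          simpa only [mul_inv_rev, hwinv, mul_assoc, hww', hw2, mul_one] using this }
  have hTmem : ∀ g, g ∈ T ↔ g ∈ T₀ ∨ g * w ∈ T₀ := fun g => Iff.rfl
  let f : T₀ ⊕ T₀ → T := Sum.elim (fun h => ⟨h, Or.inl h.2⟩)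
    (fun h => ⟨h * w, Or.inr (by rw [hww]; exact h.2)⟩)
  have hf : Function.Bijective f := by
    have hne : ∀ a b : T₀, (a : Γ) ≠ b * w := by
      intro a b h
      apply hwr
      have : w = (b : Γ)⁻¹ * a := by rw [h]; group
      rw [this]
      exact Φ.range.mul_mem (Φ.range.inv_mem (hT₀r b.2)) (hT₀r a.2)
    refine ⟨?_, ?_⟩
    · rintro (a | a) (b | b) h
      · exact congrArg Sum.inl (Subtype.ext (congrArg (fun x : T => (x : Γ)) h))
      · exact absurd (congrArg Subtype.val h) (hne a b)
      · exact absurd (congrArg Subtype.val h).symm (hne b a)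
      · exact congrArg Sum.inr (Subtype.ext (mul_right_cancel (congrArg (fun x : T => (x : Γ)) h)))
    · rintro ⟨g, hg | hg⟩
      · exact ⟨Sum.inl ⟨g, hg⟩, rfl⟩
      · exact ⟨Sum.inr ⟨g * w, hg⟩, Subtype.ext (hww g)⟩
  have hcardT : Nat.card T = 2 * (Nat.card T₁ * Nat.card T₁) := by
    rw [← Nat.card_congr (Equiv.ofBijective f hf), Nat.card_sum, hcard, two_mul]
  have htw : w * Φ (t₁, t₁) = Φ (t₁, t₁) * w := by
    rw [← hww (w * Φ (t₁, t₁)), hw]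
  refine ⟨T, ?_, ?_, ?_, Φ (t₁, t₁), hS _ ht₁, ?_, ?_, ?_⟩
  · have h0 : T₀ ≤ C := by
      intro g hg
      obtain ⟨⟨a, b⟩, rfl⟩ := hT₀r hg
      exact (hC a b).2 ⟨hT₁ ((hmem _ _).1 hg).1, hT₁ ((hmem _ _).1 hg).2⟩
    rintro g (hg | hg)
    · exact h0 hg
    · rw [← hww g]; exact C.mul_mem (h0 hg) hwC
  · obtain ⟨k, hk⟩ := IsPGroup.iff_card.1 hp₁
    exact IsPGroup.of_card (n := k + k + 1) (by rw [hcardT, hk]; ring)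
  · intro Q hQ hQ2
    refine (hPmax Q hQ hQ2).trans ?_
    have h0 : Nat.card (P ⊓ Φ.range : Subgroup Γ) ≤ Nat.card T₁ * Nat.card T₁ :=
      card_le_card_mul_card_of_le_range Φ hΦ hm₁ hm₁ _ (hP2.to_le inf_le_left)
      (fun a b h => (hC a b).1 (hPC h.1)) inf_le_right
    have h1 : Nat.card P ≤ 2 * Nat.card (P ⊓ Φ.range : Subgroup Γ) := by
      by_cases hall : ∀ g ∈ P, g ∈ Φ.range
      · rw [inf_eq_left.2 hall]; omega
      · push Not at hall
        obtain ⟨p, hp, hpr⟩ := hall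
        have hpw := (hPr p hp).resolve_left hpr
        let F : (P ⊓ Φ.range : Subgroup Γ) ⊕ (P ⊓ Φ.range : Subgroup Γ) → P :=
          Sum.elim (fun h => ⟨h, h.2.1⟩) (fun h => ⟨h * p, P.mul_mem h.2.1 hp⟩)
        have hF : Function.Surjective F := by
          rintro ⟨g, hg⟩
          by_cases hgr : g ∈ Φ.range
          · exact ⟨Sum.inl ⟨g, hg, hgr⟩, rfl⟩
          · have hgw := (hPr g hg).resolve_left hgr
            refine ⟨Sum.inr ⟨g * p⁻¹, P.mul_mem hg (P.inv_mem hp), ?_⟩, Subtype.ext ?_⟩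
            · change g * p⁻¹ ∈ Φ.range
              have := Φ.range.mul_mem hgw (Φ.range.inv_mem hpw)
              simpa only [mul_inv_rev, mul_assoc, mul_inv_cancel_left] using this
            · simp [F]
        have := Nat.card_le_card_of_surjective F hF
        rw [Nat.card_sum] at this
        omega
    rw [hcardT]; omega
  · have h0 : ∀ g ∈ T₀, Φ (t₁, t₁) * g * (Φ (t₁, t₁))⁻¹ ∈ T₀ := by
      intro g hg
      obtain ⟨⟨a, b⟩, rfl⟩ := hT₀r hg
      rw [← map_inv, ← map_mul, ← map_mul]
      exact (hmem _ _).2 ⟨hn₁ _ ((hmem _ _).1 hg).1, hn₁ _ ((hmem _ _).1 hg).2⟩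
    rintro g (hg | hg)
    · exact Or.inl (h0 g hg)
    · right
      have := h0 _ hg
      have e : Φ (t₁, t₁) * g * (Φ (t₁, t₁))⁻¹ * w = Φ (t₁, t₁) * (g * w) * (Φ (t₁, t₁))⁻¹ := by
        have : (Φ (t₁, t₁))⁻¹ * w = w * (Φ (t₁, t₁))⁻¹ := by
          rw [inv_mul_eq_iff_eq_mul, ← mul_assoc, ← htw, mul_assoc, mul_inv_cancel, mul_one]
        simp only [mul_assoc, this]
      rwa [e]
  · left
    rw [← map_mul]
    exact (hmem _ _).2 ⟨hs₁, hs₁⟩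
  · obtain ⟨e, he⟩ : ∃ e : T₁ × T₁ ≃ T₀, ∀ a b, (e (a, b) : Γ) = Φ (a, b) := by
      subst hT₀
      exact ⟨((Subgroup.prodEquiv T₁ T₁).symm.trans
        ((T₁.prod T₁).equivMapOfInjective Φ hΦ)).toEquiv, fun a b => rfl⟩
    have hA : IsPosFamily (fun h : T₀ => (h : Γ) * Φ (t₁, t₁) * (h * Φ (t₁, t₁))) := by
      convert ((pos₁.prod pos₁).map Φ).reindex e.symm using 2 with h
      obtain ⟨⟨a, b⟩, rfl⟩ := e.surjective h
      rw [e.symm_apply_apply, he, ← map_mul, ← map_mul]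
      rfl
    have hB : IsPosFamily (fun h : T₀ => (h : Γ) * w * Φ (t₁, t₁) * (h * w * Φ (t₁, t₁))) := by
      have hg : ∀ y : Γ₁, IsPosFamily (fun p : T₁ => ((p : Γ₁), y * p * y⁻¹)) := by
        intro y
        exact IsPosFamily.group.map ((T₁.subtype).prod ((MulAut.conj y).toMonoidHom.comp T₁.subtype))
      have hu : IsPosFamily (fun i : T₁ × T₁ => ((i.1 : Γ₁), (i.2 * t₁ : Γ₁) * i.1 * (i.2 * t₁)⁻¹)) :=
        IsPosFamily.union fun j => hg (j * t₁)
      let m : T₁ → T₁ := fun h => ⟨t₁ * h * t₁⁻¹ * (t₁ * t₁), T₁.mul_mem (hn₁ _ h.2) hs₁⟩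
      let e' : T₁ × T₁ ≃ T₁ × T₁ :=
        { toFun := fun i => (i.1 * m i.2, i.2)
          invFun := fun i => (i.1 * (m i.2)⁻¹, i.2)
          left_inv := fun i => by simp
          right_inv := fun i => by simp }
      convert ((hu.reindex e').map Φ).reindex e.symm using 2 with h
      obtain ⟨⟨a, b⟩, rfl⟩ := e.surjective h
      rw [e.symm_apply_apply, he]
      have : Φ (a, b) * w * Φ (t₁, t₁) * (Φ (a, b) * w * Φ (t₁, t₁)) =
          Φ (a, b) * Φ (t₁, t₁) * (w * Φ (a, b) * w) * Φ (t₁, t₁) := by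
        have h2 : ∀ g, w * (Φ (t₁, t₁) * g) = Φ (t₁, t₁) * (w * g) := fun g => by
          rw [← mul_assoc, htw, mul_assoc]
        simp only [mul_assoc, h2, htw]
      rw [this, hw, ← map_mul, ← map_mul, ← map_mul]
      refine congrArg Φ (Prod.ext ?_ ?_)
      · simp [e', m, mul_assoc]
      · simp [e', m, mul_assoc]
    convert (hA.sum hB).reindex (Equiv.ofBijective f hf).symm using 2 with h
    obtain ⟨h | h, rfl⟩ := hf.2 h
    · rw [Equiv.ofBijective_symm_apply_apply]; rfl
    · rw [Equiv.ofBijective_symm_apply_apply]; rfl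
end

section

open scoped Classical
open scoped Pointwise
variable {Γ : Type*} [Group Γ] [Fintype Γ]

theorem exists_sylow_invariant {G : Type*} [Group G] [Finite G] (φ : MulAut G) (hφ : φ * φ = 1) :
    ∃ Q : Sylow 2 G, ∀ g ∈ Q, φ g ∈ Q := by
  have : Fintype (Sylow 2 G) := Fintype.ofFinite _
  have hodd : ¬ 2 ∣ Fintype.card (Sylow 2 G) := by
    rw [← Nat.card_eq_fintype_card]; exact not_dvd_card_sylow 2 G
  obtain ⟨Q, hQ⟩ := Equiv.Perm.exists_fixed_point_of_prime (n := 1) hodd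
    (σ := MulAction.toPerm φ) (by
      rw [pow_one, sq]
      ext1 Q
      change φ • φ • Q = Q
      rw [smul_smul, hφ, one_smul])
  refine ⟨Q, fun g hg => ?_⟩
  have hQ' : φ • Q = Q := hQ
  rw [← hQ']
  exact Subgroup.smul_mem_pointwise_smul g φ Q.toSubgroup hg

theorem HasPosTwist.of_cyclic {C : Subgroup Γ} {S : Set Γ}
    (P : Subgroup Γ) (hPC : P ≤ C) (hP2 : IsPGroup 2 P)
    (hPmax : ∀ Q : Subgroup Γ, Q ≤ C → IsPGroup 2 Q → Nat.card Q ≤ Nat.card P)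
    (a : Γ) (haP : a ∈ P) (hnorm : ∀ p ∈ P, ∀ g ∈ Subgroup.zpowers a, p * g * p⁻¹ ∈ Subgroup.zpowers a)
    (hidx : Nat.card P ≤ 2 * Nat.card (Subgroup.zpowers a)) (t : Γ) (htS : t ∈ S)
    (ht2 : t * t = 1) (hta : t * a * t⁻¹ = a⁻¹) (htC : ∀ g ∈ C, t * g * t⁻¹ ∈ C) :
    HasPosTwist C S := by
  have hinv : t⁻¹ = t := inv_eq_of_mul_eq_one_left ht2
  have htz : ∀ g ∈ Subgroup.zpowers a, t * g * t⁻¹ = g⁻¹ := by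
    rintro g ⟨k, rfl⟩
    beta_reduce
    rw [← conj_zpow, hta, inv_zpow]
  let N : Subgroup Γ :=
    { carrier := {g | g ∈ C ∧ ∀ h, h ∈ Subgroup.zpowers a ↔ g * h * g⁻¹ ∈ Subgroup.zpowers a}
      one_mem' := ⟨C.one_mem, fun h => by simp⟩
      mul_mem' := fun {x y} hx hy => ⟨C.mul_mem hx.1 hy.1, fun h => by
        rw [hy.2, hx.2]; simp only [mul_inv_rev, mul_assoc]⟩
      inv_mem' := fun {x} hx => ⟨C.inv_mem hx.1, fun h => by
        rw [hx.2 (x⁻¹ * h * x⁻¹⁻¹)]; simp [mul_assoc]⟩ }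
  have hNC : N ≤ C := fun g hg => hg.1
  have hPN : P ≤ N := fun p hp => ⟨hPC hp, fun h => ⟨hnorm p hp h, fun hh => by
    have := hnorm _ (P.inv_mem hp) _ hh
    simpa [mul_assoc] using this⟩⟩
  have htN : ∀ g ∈ N, t * g * t⁻¹ ∈ N := by
    intro g hg
    refine ⟨htC g hg.1, fun h => ?_⟩
    have h1 : ∀ h, h ∈ Subgroup.zpowers a ↔ t * h * t⁻¹ ∈ Subgroup.zpowers a := fun h =>
      ⟨fun hh => by rw [htz h hh]; exact inv_mem hh, fun hh => by
        have := htz _ hh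
        rw [hinv] at this hh
        simp only [mul_assoc, ht2, mul_one] at this
        rw [← mul_assoc, ht2, one_mul] at this
        rw [this]
        simpa [mul_assoc] using inv_mem hh⟩
    rw [h1, hg.2, h1]
    simp only [hinv, mul_inv_rev, mul_assoc]
  let φ : MulAut N :=
    { toFun := fun g => ⟨t * g * t⁻¹, htN g g.2⟩
      invFun := fun g => ⟨t * g * t⁻¹, htN g g.2⟩
      left_inv := fun g => Subtype.ext (by
        simp only [hinv, mul_assoc, ht2, mul_one]; rw [← mul_assoc, ht2, one_mul])
      right_inv := fun g => Subtype.ext (by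
        simp only [hinv, mul_assoc, ht2, mul_one]; rw [← mul_assoc, ht2, one_mul])
      map_mul' := fun g h => Subtype.ext (by simp) }
  have hφ : φ * φ = 1 := MulEquiv.ext fun g => φ.left_inv g
  obtain ⟨Q, hQ⟩ := exists_sylow_invariant φ hφ
  have hcardT : Nat.card (Q.toSubgroup.map N.subtype) = Nat.card Q :=
    Subgroup.card_map_of_injective N.subtype_injective
  have haT : Subgroup.zpowers a ≤ Q.toSubgroup.map N.subtype := by
    have haN : Subgroup.zpowers a ≤ N := (Subgroup.zpowers_le.2 haP).trans hPN
    have hnor : ((Subgroup.zpowers a).subgroupOf N).Normal :=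
      ⟨fun n hn g => (g.2.2 n).1 hn⟩
    have h2 : IsPGroup 2 ((Subgroup.zpowers a).subgroupOf N) :=
      (hP2.to_le (Subgroup.zpowers_le.2 haP)).comap_of_injective _ N.subtype_injective
    have := Q.is_maximal' (h2.to_sup_of_normal_left Q.isPGroup') le_sup_right
    intro g hg
    exact ⟨⟨g, haN hg⟩, this ▸ (le_sup_left (a := (Subgroup.zpowers a).subgroupOf N)) hg, rfl⟩
  have hcardP : Nat.card P ≤ Nat.card (Q.toSubgroup.map N.subtype) := by
    have h2 : IsPGroup 2 (P.subgroupOf N) := hP2.comap_of_injective _ N.subtype_injective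
    obtain ⟨Q', hQ'⟩ := h2.exists_le_sylow
    rw [hcardT, Nat.card_congr (Sylow.equiv Q Q').toEquiv, ← Nat.card_congr (Subgroup.subgroupOfEquivOfLe hPN).toEquiv]
    exact Subgroup.card_le_of_le hQ'
  have hT2 : IsPGroup 2 (Q.toSubgroup.map N.subtype) := Q.isPGroup'.map _
  have hTC : Q.toSubgroup.map N.subtype ≤ C := (Subgroup.map_subtype_le _).trans hNC
  have hTt : ∀ g ∈ Q.toSubgroup.map N.subtype, t * g * t⁻¹ ∈ Q.toSubgroup.map N.subtype := by
    rintro _ ⟨g, hg, rfl⟩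
    exact ⟨φ g, hQ g hg, rfl⟩
  generalize Q.toSubgroup.map N.subtype = T at *
  refine ⟨T, hTC, hT2, fun R hR hR2 => (hPmax R hR hR2).trans hcardP, t, htS, hTt, ?_, ?_⟩
  · rw [ht2]; exact T.one_mem
  · let e : T ≃ T :=
      { toFun := fun h => ⟨t * h⁻¹ * t⁻¹, hTt _ (T.inv_mem h.2)⟩
        invFun := fun h => ⟨t * h⁻¹ * t⁻¹, hTt _ (T.inv_mem h.2)⟩
        left_inv := fun h => Subtype.ext (by
          change t * (t * (h : Γ)⁻¹ * t⁻¹)⁻¹ * t⁻¹ = h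
          simp only [mul_inv_rev, inv_inv, hinv, mul_assoc, ht2, mul_one]
          rw [← mul_assoc, ht2, one_mul])
        right_inv := fun h => Subtype.ext (by
          change t * (t * (h : Γ)⁻¹ * t⁻¹)⁻¹ * t⁻¹ = h
          simp only [mul_inv_rev, inv_inv, hinv, mul_assoc, ht2, mul_one]
          rw [← mul_assoc, ht2, one_mul]) }
    refine IsPosFamily.of_card_le _ e (fun h => ?_) ?_
    · simp [e, mul_assoc, hinv, ht2]
    · rw [← Nat.card_eq_fintype_card]
      refine (hPmax T hTC hT2).trans (hidx.trans (Nat.mul_le_mul_left 2 ?_))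
      rw [← Fintype.card_coe, ← Nat.card_eq_fintype_card]
      refine Nat.card_le_card_of_injective (fun g => ⟨⟨g, haT g.2⟩, ?_⟩) ?_
      · rw [Finset.mem_filter]
        refine ⟨Finset.mem_univ _, ?_⟩
        have := htz g g.2
        rw [hinv] at this
        simp only [mul_assoc] at this ⊢
        rw [this, mul_inv_cancel]
      · intro g h hgh
        exact Subtype.ext (congrArg (fun x => ((x : T) : Γ)) (Subtype.mk.inj hgh))
end

section

universe u

variable {F R : Type*} [Field F] [CommRing R] [Algebra F R]

/-- An alternating nondegenerate form on a torsion `R`-module whose adjoint involution restricts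
to `σ` on scalars from `R`. -/
structure IsAdjointForm (σ : R ≃ₐ[F] R) {V : Type u} [AddCommGroup V] [Module F V] [Module R V]
    (B : LinearMap.BilinForm F V) : Prop where
  alt : ∀ v, B v v = 0
  sep : ∀ v, (∀ w, B v w = 0) → v = 0
  adj : ∀ (r : R) v w, B (r • v) w = B v (σ r • w)
  tors : ∃ m : R, m ≠ 0 ∧ ∀ v : V, m • v = 0

/-- There is a `σ`-semilinear involution which is a skew-isometry for `B`. -/
def HasSkewReversal (σ : R ≃ₐ[F] R) {V : Type u} [AddCommGroup V] [Module F V] [Module R V]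
    (B : LinearMap.BilinForm F V) : Prop :=
  ∃ t : V →ₗ[F] V, (∀ v, t (t v) = v) ∧ (∀ v w, B (t v) (t w) = -B v w) ∧
    ∀ (r : R) v, t (r • v) = σ r • t v

variable {V : Type u} [AddCommGroup V] [Module F V] [Module R V] [IsScalarTower F R V]

/-- The restriction of a bilinear form to an `R`-submodule. -/
def restrictForm (B : LinearMap.BilinForm F V) (W : Submodule R V) : LinearMap.BilinForm F W :=
  B.compl₁₂ (W.subtype.restrictScalars F) (W.subtype.restrictScalars F)

@[simp] theorem restrictForm_apply (B : LinearMap.BilinForm F V) (W : Submodule R V) (x y : W) :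
    restrictForm B W x y = B x y := rfl

variable {σ : R ≃ₐ[F] R} {B : LinearMap.BilinForm F V}

theorem IsAdjointForm.neg (hB : IsAdjointForm σ B) (v w : V) : B v w = -B w v := by
  have h := hB.alt (v + w)
  simp only [map_add, LinearMap.add_apply, hB.alt, zero_add, add_zero] at h
  linear_combination h

theorem HasSkewReversal.of_isCompl (hB : IsAdjointForm σ B) {W W' : Submodule R V}
    (h : IsCompl W W') (ho : ∀ w ∈ W, ∀ w' ∈ W', B w w' = 0)
    (hW : HasSkewReversal σ (restrictForm B W)) (hW' : HasSkewReversal σ (restrictForm B W')) :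
    HasSkewReversal σ B := by
  obtain ⟨t, t1, t2, t3⟩ := hW
  obtain ⟨s, s1, s2, s3⟩ := hW'
  let e := Submodule.prodEquivOfIsCompl W W' h
  let T : V →ₗ[F] V := (e.restrictScalars F).toLinearMap ∘ₗ (t.prodMap s) ∘ₗ
    (e.symm.restrictScalars F).toLinearMap
  have hT : ∀ (a : W) (b : W'), T ((a : V) + b) = (t a : V) + s b := by
    intro a b
    have : e.symm ((a : V) + b) = (a, b) := by
      rw [LinearEquiv.symm_apply_eq]; rfl
    simp only [T, LinearMap.comp_apply, LinearEquiv.coe_coe, LinearEquiv.restrictScalars_apply,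
      this]
    rfl
  have hsurj : ∀ v : V, ∃ (a : W) (b : W'), v = (a : V) + b := by
    intro v
    refine ⟨(e.symm v).1, (e.symm v).2, ?_⟩
    exact (e.apply_symm_apply v).symm
  have ho' : ∀ (a : W) (b : W'), B (a : V) b = 0 := fun a b => ho a a.2 b b.2
  have ho'' : ∀ (b : W') (a : W), B (b : V) a = 0 := fun b a => by
    rw [hB.neg, ho', neg_zero]
  refine ⟨T, ?_, ?_, ?_⟩
  · intro v
    obtain ⟨a, b, rfl⟩ := hsurj v
    rw [hT, hT, t1, s1]
  · intro v w
    obtain ⟨a, b, rfl⟩ := hsurj v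
    obtain ⟨c, d, rfl⟩ := hsurj w
    have h1 := t2 a c
    have h2 := s2 b d
    simp only [restrictForm_apply] at h1 h2
    rw [hT, hT]
    simp only [map_add, LinearMap.add_apply, ho', ho'', h1, h2]
    ring
  · intro r v
    obtain ⟨a, b, rfl⟩ := hsurj v
    have h1 : r • ((a : V) + b) = ((r • a : W) : V) + (r • b : W') := by simp
    rw [h1, hT, hT, t3, s3]
    simp

/-- The reversal on a nondegenerate submodule generated by two elements `v, w`,
acting as `r v + s w ↦ σ(r) v - σ(s) w`. -/
theorem HasSkewReversal.of_pair (hσ : ∀ r, σ (σ r) = r) (hB : IsAdjointForm σ B) (v w : V)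
    (hvw : ∀ c : R, B v (c • w) = B v (σ c • w)) (W : Submodule R V)
    (hW : ∀ x, x ∈ W ↔ ∃ r s : R, x = r • v + s • w)
    (hnd : ∀ x ∈ W, (∀ y ∈ W, B x y = 0) → x = 0) :
    HasSkewReversal σ (restrictForm B W) := by
  have hmem : ∀ r s : R, r • v + s • w ∈ W := fun r s => (hW _).2 ⟨r, s, rfl⟩
  have hB' : ∀ a b c d : R, B (σ a • v - σ b • w) (σ c • v - σ d • w) =
      -B (a • v + b • w) (c • v + d • w) := by
    intro a b c d
    have h1 : B (σ a • v) (σ c • v) = -B (a • v) (c • v) := by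
      rw [hB.adj, hσ, hB.neg (a • v), hB.adj, smul_smul, smul_smul, mul_comm, neg_neg]
    have h2 : B (σ b • w) (σ d • w) = -B (b • w) (d • w) := by
      rw [hB.adj, hσ, hB.neg (b • w), hB.adj, smul_smul, smul_smul, mul_comm, neg_neg]
    have h3 : ∀ a d : R, B (σ a • v) (σ d • w) = B (a • v) (d • w) := by
      intro a d
      rw [hB.adj, hσ, hB.adj a, smul_smul, smul_smul, hvw (a * σ d)]
      simp [hσ]
    have h4 : B (σ b • w) (σ c • v) = B (b • w) (c • v) := by
      rw [hB.neg, h3, ← hB.neg]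
    simp only [map_add, map_sub, LinearMap.add_apply, LinearMap.sub_apply, h1, h2, h3, h4]
    ring
  have hwd : ∀ a b c d : R, a • v + b • w = c • v + d • w →
      σ a • v - σ b • w = σ c • v - σ d • w := by
    intro a b c d h
    have h0 : (a - c) • v + (b - d) • w = 0 := by
      rw [sub_smul, sub_smul]
      calc a • v - c • v + (b • w - d • w) = (a • v + b • w) - (c • v + d • w) := by abel
        _ = 0 := by rw [h, sub_self]
    have h1 : σ (a - c) • v - σ (b - d) • w = 0 := by
      apply hnd
      · have := hmem (σ (a - c)) (-σ (b - d))
        rwa [neg_smul, ← sub_eq_add_neg] at this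
      · intro y hy
        obtain ⟨r, s, rfl⟩ := (hW y).1 hy
        have := hB' (a - c) (b - d) (σ r) (-σ s)
        rw [h0] at this
        simpa [hσ] using this
    have h2 : σ (a - c) • v - σ (b - d) • w =
        (σ a • v - σ b • w) - (σ c • v - σ d • w) := by
      rw [map_sub, map_sub, sub_smul, sub_smul]; abel
    rw [h2] at h1
    exact sub_eq_zero.1 h1
  have hch : ∀ x : W, ∃ a : R × R, (x : V) = a.1 • v + a.2 • w := fun x => by
    obtain ⟨r, s, h⟩ := (hW x).1 x.2
    exact ⟨(r, s), h⟩
  choose c hc using hch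
  let t0 : W → W := fun x => ⟨σ (c x).1 • v - σ (c x).2 • w, by
    have := hmem (σ (c x).1) (-σ (c x).2)
    rwa [neg_smul, ← sub_eq_add_neg] at this⟩
  have ht0 : ∀ (x : W) (a b : R), (x : V) = a • v + b • w →
      (t0 x : V) = σ a • v - σ b • w := fun x a b h => hwd _ _ _ _ (by rw [← hc, h])
  let t : W →ₗ[F] W :=
    { toFun := t0
      map_add' := fun x y => by
        ext
        rw [ht0 (x + y) ((c x).1 + (c y).1) ((c x).2 + (c y).2) (by
          rw [Submodule.coe_add, hc x, hc y, add_smul, add_smul]; abel)]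
        simp only [t0, Submodule.coe_add, map_add, add_smul]
        abel
      map_smul' := fun k x => by
        ext
        rw [ht0 (k • x) (k • (c x).1) (k • (c x).2) (by
          rw [smul_assoc, smul_assoc, ← smul_add, ← hc x]; rfl)]
        simp only [map_smul, smul_assoc, RingHom.id_apply]
        rw [← smul_sub]; rfl }
  have ht : ∀ (x : W) (a b : R), (x : V) = a • v + b • w →
      (t x : V) = σ a • v - σ b • w := ht0
  refine ⟨t, ?_, ?_, ?_⟩
  · intro x
    ext
    rw [ht (t x) (σ (c x).1) (-σ (c x).2) (by
      rw [ht x _ _ (hc x), neg_smul, sub_eq_add_neg]), hσ, map_neg, hσ, neg_smul, sub_neg_eq_add,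
      ← hc x]
  · intro x y
    simp only [restrictForm_apply]
    rw [ht x _ _ (hc x), ht y _ _ (hc y), hB', ← hc x, ← hc y]
  · intro r x
    ext
    rw [ht (r • x) (r * (c x).1) (r * (c x).2) (by
      rw [mul_smul, mul_smul, ← smul_add, ← hc x]; rfl), Submodule.coe_smul, ht x _ _ (hc x),
      map_mul, map_mul, mul_smul, mul_smul, smul_sub]

/-- The orthogonal complement of an `R`-submodule. -/
def IsAdjointForm.orth (hσ : ∀ r, σ (σ r) = r) (hB : IsAdjointForm σ B) (W : Submodule R V) :
    Submodule R V where
  carrier := {x | ∀ w ∈ W, B w x = 0}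
  add_mem' := fun {a b} ha hb w hw => by rw [map_add, ha w hw, hb w hw, add_zero]
  zero_mem' := fun w _ => by rw [map_zero]
  smul_mem' := fun r x hx w hw => by
    have := hB.adj (σ r) w x
    rw [hσ] at this
    rw [← this]
    exact hx _ (W.smul_mem _ hw)

theorem IsAdjointForm.isCompl_orth (hσ : ∀ r, σ (σ r) = r) (hB : IsAdjointForm σ B)
    [Module.Finite F V] (W : Submodule R V)
    (hnd : ∀ x ∈ W, (∀ y ∈ W, B x y = 0) → x = 0) : IsCompl W (hB.orth hσ W) := by
  have hrefl : B.IsRefl := fun x y h => by rw [hB.neg, h, neg_zero]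
  have hn : (B.restrict (W.restrictScalars F)).Nondegenerate := by
    constructor
    · intro x hx
      exact Subtype.ext (hnd x x.2 fun y hy => hx ⟨y, hy⟩)
    · intro x hx
      exact Subtype.ext (hnd x x.2 fun y hy => by
        rw [hB.neg, neg_eq_zero]; exact hx ⟨y, hy⟩)
  have h := LinearMap.BilinForm.isCompl_orthogonal_of_restrict_nondegenerate hrefl hn
  constructor
  · rw [Submodule.disjoint_def]
    intro x hx hx'
    exact Submodule.disjoint_def.1 h.1 x hx fun y hy => hx' y hy
  · rw [codisjoint_iff, Submodule.eq_top_iff']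
    intro x
    have hx : x ∈ W.restrictScalars F ⊔ B.orthogonal (W.restrictScalars F) := by
      rw [codisjoint_iff.1 h.2]; trivial
    obtain ⟨y, hy, z, hz, rfl⟩ := Submodule.mem_sup.1 hx
    exact Submodule.mem_sup.2 ⟨y, hy, z, fun w hw => hz w hw, rfl⟩

theorem IsAdjointForm.restrict (hB : IsAdjointForm σ B) (W : Submodule R V)
    (hnd : ∀ x ∈ W, (∀ y ∈ W, B x y = 0) → x = 0) : IsAdjointForm σ (restrictForm B W) where
  alt v := hB.alt _
  sep v h := Subtype.ext (hnd v v.2 fun y hy => h ⟨y, hy⟩)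
  adj r v w := hB.adj _ _ _
  tors := by
    obtain ⟨m, hm, h⟩ := hB.tors
    exact ⟨m, hm, fun v => Subtype.ext (h v)⟩

end

section
universe u
variable {F R : Type*} [Field F] [CommRing R] [Algebra F R]
variable {V : Type u} [AddCommGroup V] [Module F V] [Module R V] [IsScalarTower F R V]
variable {σ : R ≃ₐ[F] R} {B : LinearMap.BilinForm F V}

theorem HasSkewReversal.of_nondegenerate (hσ : ∀ r, σ (σ r) = r) (hB : IsAdjointForm σ B)
    [Module.Finite F V]
    (IH : ∀ W : Submodule R V, W ≠ ⊤ → IsAdjointForm σ (restrictForm B W) →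
      HasSkewReversal σ (restrictForm B W))
    (W : Submodule R V) (hnd : ∀ x ∈ W, (∀ y ∈ W, B x y = 0) → x = 0) (hW : W ≠ ⊥)
    (h : HasSkewReversal σ (restrictForm B W)) : HasSkewReversal σ B := by
  have hc := hB.isCompl_orth hσ W hnd
  refine HasSkewReversal.of_isCompl hB hc (fun w hw w' hw' => hw' w hw) h (IH _ ?_ ?_)
  · intro ht
    rw [ht] at hc
    exact hW (by simpa using hc.1.eq_bot)
  · refine hB.restrict _ fun x hx hxy => hB.sep x fun w => ?_
    have hw : w ∈ W ⊔ hB.orth hσ W := by rw [codisjoint_iff.1 hc.2]; trivial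
    obtain ⟨y, hy, z, hz, rfl⟩ := Submodule.mem_sup.1 hw
    rw [map_add, hxy z hz, hB.neg, hx y hy]
    simp

theorem HasSkewReversal.of_isCoprime (hB : IsAdjointForm σ B)
    (IH : ∀ W : Submodule R V, W ≠ ⊤ → IsAdjointForm σ (restrictForm B W) →
      HasSkewReversal σ (restrictForm B W))
    (a b : R) (hab : IsCoprime a b) (hkill : ∀ v : V, (a * b) • v = 0) (ha : a ∣ σ a)
    (ha' : ∃ v : V, a • v ≠ 0) (hb' : ∃ v : V, b • v ≠ 0) : HasSkewReversal σ B := by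
  let W : R → Submodule R V := fun a => LinearMap.range (LinearMap.lsmul R V a)
  have hW : ∀ a x, x ∈ W a ↔ ∃ v, a • v = x := fun a x => Iff.rfl
  obtain ⟨c, d, hcd⟩ := hab
  have hv : ∀ v : V, v = a • (c • v) + b • (d • v) := fun v => by
    rw [smul_smul, smul_smul, ← add_smul, mul_comm a, mul_comm b, hcd, one_smul]
  have ho : ∀ w ∈ W a, ∀ w' ∈ W b, B w w' = 0 := by
    rintro w ⟨v, rfl⟩ w' ⟨v', rfl⟩
    obtain ⟨e, he⟩ := ha
    simp only [LinearMap.lsmul_apply]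
    rw [hB.adj, he, smul_smul]
    have : a * e * b = e * (a * b) := by ring
    rw [this, mul_smul, hkill, smul_zero, map_zero]
  have hcompl : IsCompl (W a) (W b) := by
    constructor
    · rw [Submodule.disjoint_def]
      rintro x ⟨v, rfl⟩ ⟨w, hw⟩
      simp only [LinearMap.lsmul_apply] at hw ⊢
      rw [hv (a • v)]
      have h1 : b • d • a • v = d • ((a * b) • v) := by
        simp only [smul_smul]; congr 1; ring
      have h2 : a • c • a • v = c • ((a * b) • w) := by
        rw [← hw]; simp only [smul_smul]; congr 1; ring
      rw [h1, h2, hkill, hkill, smul_zero, smul_zero, add_zero]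
    · rw [codisjoint_iff, Submodule.eq_top_iff']
      intro x
      exact Submodule.mem_sup.2 ⟨_, ⟨c • x, rfl⟩, _, ⟨d • x, rfl⟩, (hv x).symm⟩
  have hsplit : ∀ w : V, ∃ y ∈ W a, ∃ z ∈ W b, w = y + z := fun w =>
    ⟨_, ⟨c • w, rfl⟩, _, ⟨d • w, rfl⟩, hv w⟩
  refine HasSkewReversal.of_isCompl hB hcompl ho (IH _ ?_ ?_) (IH _ ?_ ?_)
  · intro ht
    obtain ⟨v, hv⟩ := hb'
    obtain ⟨w, rfl⟩ := (hW a v).1 (ht ▸ trivial)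
    apply hv
    rw [smul_smul, mul_comm, hkill]
  · refine hB.restrict _ fun x hx hxy => hB.sep x fun w => ?_
    obtain ⟨y, hy, z, hz, rfl⟩ := hsplit w
    rw [map_add, hxy y hy, ho x hx z hz, add_zero]
  · intro ht
    obtain ⟨v, hv⟩ := ha'
    obtain ⟨w, rfl⟩ := (hW b v).1 (ht ▸ trivial)
    apply hv
    rw [smul_smul, hkill]
  · refine hB.restrict _ fun x hx hxy => hB.sep x fun w => ?_
    obtain ⟨y, hy, z, hz, rfl⟩ := hsplit w
    rw [map_add, hxy z hz, hB.neg, ho y hy x hx, neg_zero, add_zero]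


theorem Irreducible.exists_mul_smul_eq [IsDomain R] [IsPrincipalIdealRing R] {p : R} (hp : Irreducible p) (k : ℕ) {s : R}
    (hs : ¬ p ∣ s) : ∃ a : R, ∀ v : V, p ^ k • v = 0 → (a * s) • v = v := by
  have hc : IsCoprime s (p ^ k) := ((hp.coprime_iff_not_dvd.2 hs).symm).pow_right
  obtain ⟨a, b, hab⟩ := hc
  refine ⟨a, fun v hv => ?_⟩
  have : (a * s + b * p ^ k) • v = v := by rw [hab, one_smul]
  rwa [add_smul, mul_smul b, hv, smul_zero, add_zero] at this

theorem exists_pow_mul_pow_mul_of_not_dvd (p : R) : ∀ (k : ℕ) (r s : R),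
    ¬ (p ^ k ∣ r ∧ p ^ k ∣ s) →
    ∃ j < k, ∃ r' s' : R, r = p ^ j * r' ∧ s = p ^ j * s' ∧ (¬ p ∣ r' ∨ ¬ p ∣ s') := by
  intro k
  induction k with
  | zero => intro r s h; simp at h
  | succ k ih =>
    intro r s h
    by_cases hp : p ∣ r ∧ p ∣ s
    · obtain ⟨⟨r, rfl⟩, ⟨s, rfl⟩⟩ := hp
      obtain ⟨j, hj, r', s', rfl, rfl, h'⟩ := ih r s (fun ⟨h1, h2⟩ => h
        ⟨by rw [pow_succ']; exact mul_dvd_mul_left p h1,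
          by rw [pow_succ']; exact mul_dvd_mul_left p h2⟩)
      exact ⟨j + 1, by omega, r', s', by rw [pow_succ']; ring, by rw [pow_succ']; ring, h'⟩
    · exact ⟨0, by omega, r, s, by simp, by simp, by tauto⟩

theorem Irreducible.exists_smul_smul_eq [IsDomain R] [IsPrincipalIdealRing R] {p : R} (hp : Irreducible p) (k : ℕ) {r : R} {v : V}
    (hv : p ^ k • v = 0) (hr : r • v ≠ 0) : ∃ c : R, p ^ (k - 1) • v = c • r • v := by
  obtain ⟨j, hj, s, s', hrs, hrs', hs⟩ := exists_pow_mul_pow_mul_of_not_dvd p k r r (by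
    rintro ⟨⟨c, rfl⟩, -⟩
    apply hr
    rw [mul_comm, mul_smul, hv, smul_zero])
  obtain rfl : s = s' := mul_left_cancel₀ (pow_ne_zero j hp.ne_zero) (hrs.symm.trans hrs')
  rw [or_self] at hs
  subst hrs
  obtain ⟨a, ha⟩ := hp.exists_mul_smul_eq (V := V) k hs
  refine ⟨p ^ (k - 1 - j) * a, ?_⟩
  nth_rewrite 1 [← ha v hv]
  simp only [smul_smul]
  congr 1
  rw [show k - 1 = k - 1 - j + j by omega, pow_add]
  simp only [Nat.add_sub_cancel]
  ring

end

section
universe u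
variable {F R : Type*} [Field F] [CommRing R] [Algebra F R]
variable {V : Type u} [AddCommGroup V] [Module F V] [Module R V] [IsScalarTower F R V]
variable {σ : R ≃ₐ[F] R} {B : LinearMap.BilinForm F V}

/-- Splitting off a nondegenerate cyclic submodule. -/
theorem HasSkewReversal.of_cyclic (hσ : ∀ r, σ (σ r) = r) (hB : IsAdjointForm σ B)
    [Module.Finite F V]
    (IH : ∀ W : Submodule R V, W ≠ ⊤ → IsAdjointForm σ (restrictForm B W) →
      HasSkewReversal σ (restrictForm B W))
    (v : V) (hv : v ≠ 0) (hnd : ∀ r : R, (∀ s : R, B (r • v) (s • v) = 0) → r • v = 0) :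
    HasSkewReversal σ B := by
  have hnd' : ∀ x ∈ Submodule.span R {v}, (∀ y ∈ Submodule.span R {v}, B x y = 0) → x = 0 := by
    intro x hx hxy
    obtain ⟨r, rfl⟩ := Submodule.mem_span_singleton.1 hx
    exact hnd r fun s => hxy _ (Submodule.mem_span_singleton.2 ⟨s, rfl⟩)
  refine HasSkewReversal.of_nondegenerate hσ hB IH (Submodule.span R {v}) hnd'
    (by simpa using hv) (HasSkewReversal.of_pair hσ hB v 0 (by simp) _ ?_ hnd')
  intro x
  rw [Submodule.mem_span_singleton]
  constructor
  · rintro ⟨r, rfl⟩; exact ⟨r, 0, by simp⟩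
  · rintro ⟨r, s, rfl⟩; exact ⟨r, by simp⟩

variable [IsDomain R] [IsPrincipalIdealRing R]

/-- The case of a primary module for a self-dual prime. -/
theorem HasSkewReversal.of_associated (hσ : ∀ r, σ (σ r) = r) (h2 : (2 : F) ≠ 0)
    (hB : IsAdjointForm σ B) [Module.Finite F V]
    (IH : ∀ W : Submodule R V, W ≠ ⊤ → IsAdjointForm σ (restrictForm B W) →
      HasSkewReversal σ (restrictForm B W))
    (p : R) (hp : Irreducible p) (hps : Associated p (σ p)) (k : ℕ)
    (hk : ∀ v : V, p ^ k • v = 0) (v0 : V) (hv0 : p ^ (k - 1) • v0 ≠ 0) :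
    HasSkewReversal σ B := by
  by_cases hA : ∃ (v : V) (r : R), B ((p ^ (k - 1) * r) • v) v ≠ 0
  · obtain ⟨v, r, hvr⟩ := hA
    refine HasSkewReversal.of_cyclic hσ hB IH v ?_ ?_
    · rintro rfl; simp at hvr
    · intro s hs
      by_contra hsv
      obtain ⟨c, hc⟩ := hp.exists_smul_smul_eq k (hk v) hsv
      apply hvr
      rw [mul_comm, mul_smul, hc, ← mul_smul r c, hB.adj]
      exact hs _
  · push Not at hA
    have hsym : ∀ (r : R) (v w : V), B ((p ^ (k - 1) * r) • v) w = B v ((p ^ (k - 1) * r) • w) := by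
      intro r v w
      have h := hA (v + w) r
      simp only [smul_add, map_add, LinearMap.add_apply, hA, zero_add, add_zero] at h
      rw [hB.neg v]
      linear_combination h
    obtain ⟨w, hw⟩ : ∃ w, B (p ^ (k - 1) • v0) w ≠ 0 := by
      by_contra hcon
      push Not at hcon
      exact hv0 (hB.sep _ hcon)
    -- make the functional `c ↦ B v0 (c w)` invariant under `σ`
    have hann : ∀ r : R, r • v0 = 0 → σ r • v0 = 0 := by
      intro r hr
      by_contra hcon
      have : p ^ k ∣ r := by
        by_contra hd
        obtain ⟨j, hj, s, s', h1, h2, hs⟩ := exists_pow_mul_pow_mul_of_not_dvd p k r r (by simpa)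
        obtain rfl : s = s' := mul_left_cancel₀ (pow_ne_zero j hp.ne_zero) (h1.symm.trans h2)
        rw [or_self] at hs
        obtain ⟨a, ha⟩ := hp.exists_mul_smul_eq (V := V) k hs
        apply hv0
        rw [← ha v0 (hk v0), smul_smul]
        have : p ^ (k - 1) * (a * s) = p ^ (k - 1 - j) * a * r := by
          rw [h1, show k - 1 = k - 1 - j + j by omega, pow_add]
          simp only [Nat.add_sub_cancel]
          ring
        rw [this, mul_smul, hr, smul_zero]
      obtain ⟨c, rfl⟩ := this
      apply hcon
      obtain ⟨e, he⟩ := hps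
      rw [map_mul, map_pow, ← he, mul_pow]
      have : p ^ k * (e : R) ^ k * σ c = ((e : R) ^ k * σ c) * p ^ k := by ring
      rw [this, mul_smul, hk, smul_zero]
    let lam : R →ₗ[F] F :=
      { toFun := fun c => B v0 (c • w) + B v0 (σ c • w)
        map_add' := fun c d => by simp only [add_smul, map_add]; ring
        map_smul' := fun a c => by
          simp only [map_smul, smul_assoc, RingHom.id_apply, smul_eq_mul]; ring }
    have hlam0 : ∀ r : R, r • v0 = 0 → lam r = 0 := by
      intro r hr
      have h1 : B v0 (σ r • w) = 0 := by rw [← hB.adj, hr]; simp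
      have h2 : B v0 (r • w) = 0 := by
        have := hB.adj (σ r) v0 w
        rw [hσ] at this
        rw [← this, hann r hr]; simp
      change B v0 (r • w) + B v0 (σ r • w) = 0
      rw [h1, h2, add_zero]
    have hlamσ : ∀ r, lam (σ r) = lam r := by
      intro r
      change B v0 (σ r • w) + B v0 (σ (σ r) • w) = B v0 (r • w) + B v0 (σ r • w)
      rw [hσ, add_comm]
    let π : R →ₗ[F] V := (LinearMap.toSpanSingleton R V v0).restrictScalars F
    have hπ : ∀ r, π r = r • v0 := fun r => rfl
    obtain ⟨φ, hφ⟩ : ∃ φ : V →ₗ[F] F, ∀ r, φ (r • v0) = lam r := by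
      have hker : LinearMap.ker π ≤ LinearMap.ker lam := fun r hr => hlam0 r hr
      obtain ⟨φ, hφ⟩ := LinearMap.exists_extend
        (((LinearMap.ker π).liftQ lam hker) ∘ₗ π.quotKerEquivRange.symm.toLinearMap)
      refine ⟨φ, fun r => ?_⟩
      have h1 := LinearMap.congr_fun hφ ⟨π r, r, rfl⟩
      have h2 : π.quotKerEquivRange.symm ⟨π r, r, rfl⟩ = (LinearMap.ker π).mkQ r := by
        rw [LinearEquiv.symm_apply_eq]
        rfl
      simp only [LinearMap.comp_apply, LinearEquiv.coe_coe, h2] at h1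
      simpa [hπ] using h1
    have hnB : B.Nondegenerate := ⟨hB.sep, fun x hx => hB.sep x fun y => by
      rw [hB.neg, hx y, neg_zero]⟩
    obtain ⟨w', hw'⟩ : ∃ w' : V, ∀ x, B x w' = φ x := by
      refine ⟨-(B.toDual hnB).symm φ, fun x => ?_⟩
      rw [map_neg, hB.neg, neg_neg]
      exact LinearMap.BilinForm.apply_toDual_symm_apply _ _
    have hinv : ∀ c : R, B v0 (c • w') = B v0 (σ c • w') := by
      intro c
      have h1 := hB.adj (σ c) v0 w'
      have h2 := hB.adj c v0 w'
      rw [hσ] at h1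
      rw [← h1, ← h2, hw', hw', hφ, hφ, hlamσ]
    have hsoc : B (p ^ (k - 1) • v0) w' ≠ 0 := by
      rw [hw', hφ]
      change B v0 (p ^ (k - 1) • w) + B v0 (σ (p ^ (k - 1)) • w) ≠ 0
      rw [← hB.adj]
      have := hsym 1 v0 w
      rw [mul_one] at this
      rw [← this, ← two_mul]
      exact mul_ne_zero h2 hw
    have hsoc' : B (p ^ (k - 1) • w') v0 ≠ 0 := by
      have := hsym 1 w' v0
      rw [mul_one] at this
      rw [this, hB.neg]
      exact neg_ne_zero.2 hsoc
    let W : Submodule R V := Submodule.span R {v0, w'}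
    have hW : ∀ x, x ∈ W ↔ ∃ r s : R, x = r • v0 + s • w' := fun x => by
      rw [Submodule.mem_span_pair]
      exact ⟨fun ⟨r, s, h⟩ => ⟨r, s, h.symm⟩, fun ⟨r, s, h⟩ => ⟨r, s, h.symm⟩⟩
    have hnd : ∀ x ∈ W, (∀ y ∈ W, B x y = 0) → x = 0 := by
      intro x hx hxy
      have hxv : ∀ c : R, B (c • x) v0 = 0 := fun c => by
        rw [hB.adj]
        exact hxy _ (W.smul_mem _ (Submodule.subset_span (by simp)))
      have hxw : ∀ c : R, B (c • x) w' = 0 := fun c => by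
        rw [hB.adj]
        exact hxy _ (W.smul_mem _ (Submodule.subset_span (by simp)))
      obtain ⟨r, s, rfl⟩ := (hW x).1 hx
      by_cases hd : p ^ k ∣ r ∧ p ^ k ∣ s
      · obtain ⟨⟨c, rfl⟩, ⟨d, rfl⟩⟩ := hd
        rw [mul_smul, mul_smul, hk, hk, add_zero]
      exfalso
      obtain ⟨j, hj, r', s', rfl, rfl, h⟩ := exists_pow_mul_pow_mul_of_not_dvd p k r s hd
      have hpk : p ^ (k - 1 - j) * p ^ j = p ^ (k - 1) := by
        rw [← pow_add]; congr 1; omega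
      rcases h with h | h
      · obtain ⟨a, ha⟩ := hp.exists_mul_smul_eq (V := V) k h
        have h1 : (p ^ (k - 1 - j) * a) • ((p ^ j * r') • v0 + (p ^ j * s') • w') =
            p ^ (k - 1) • v0 + (p ^ (k - 1) * (a * s')) • w' := by
          rw [smul_add, smul_smul, smul_smul]
          congr 1
          · nth_rewrite 2 [← ha v0 (hk v0)]
            rw [smul_smul, ← hpk]; congr 1; ring
          · rw [← hpk]; congr 1; ring
        have h3 := hxw (p ^ (k - 1 - j) * a)
        rw [h1, map_add, LinearMap.add_apply, hA, add_zero] at h3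
        exact hsoc h3
      · obtain ⟨a, ha⟩ := hp.exists_mul_smul_eq (V := V) k h
        have h1 : (p ^ (k - 1 - j) * a) • ((p ^ j * r') • v0 + (p ^ j * s') • w') =
            (p ^ (k - 1) * (a * r')) • v0 + p ^ (k - 1) • w' := by
          rw [smul_add, smul_smul, smul_smul]
          congr 1
          · rw [← hpk]; congr 1; ring
          · nth_rewrite 2 [← ha w' (hk w')]
            rw [smul_smul, ← hpk]; congr 1; ring
        have h3 := hxv (p ^ (k - 1 - j) * a)
        rw [h1, map_add, LinearMap.add_apply, hA, zero_add] at h3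
        exact hsoc' h3
    refine HasSkewReversal.of_nondegenerate hσ hB IH W hnd ?_
      (HasSkewReversal.of_pair hσ hB v0 w' hinv W hW hnd)
    intro hb
    apply hv0
    have : v0 ∈ W := Submodule.subset_span (by simp)
    rw [hb, Submodule.mem_bot] at this
    rw [this, smul_zero]

/-- The case of a module supported on two primes swapped by `σ`. -/
theorem HasSkewReversal.of_not_associated (hσ : ∀ r, σ (σ r) = r)
    (hB : IsAdjointForm σ B) [Module.Finite F V]
    (IH : ∀ W : Submodule R V, W ≠ ⊤ → IsAdjointForm σ (restrictForm B W) →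
      HasSkewReversal σ (restrictForm B W))
    (p : R) (hp : Irreducible p) (hps : ¬ Associated p (σ p)) (k : ℕ)
    (hk : ∀ v : V, (p ^ k * σ p ^ k) • v = 0) (y : V)
    (hy : (p ^ (k - 1) * σ p ^ k) • y ≠ 0) : HasSkewReversal σ B := by
  have hq : Irreducible (σ p) := (MulEquiv.irreducible_iff σ).2 hp
  have hcop : IsCoprime (p ^ k) (σ p ^ k) :=
    ((hp.coprime_iff_not_dvd.2 fun h => hps (hp.associated_of_dvd hq h)).pow)
  obtain ⟨α, β, hαβ⟩ := hcop
  obtain ⟨z, hz⟩ : ∃ z, B ((p ^ (k - 1) * σ p ^ k) • y) z ≠ 0 := by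
    by_contra hcon
    push Not at hcon
    exact hy (hB.sep _ hcon)
  obtain ⟨v1, h1k, h1⟩ : ∃ v1 : V, p ^ k • v1 = 0 ∧ p ^ (k - 1) • v1 = (p ^ (k - 1) * σ p ^ k) • y :=
    ⟨σ p ^ k • y, by rw [smul_smul, hk], by rw [smul_smul]⟩
  rw [← h1] at hz
  have h1β : (β * σ p ^ k) • v1 = v1 := by
    have : (α * p ^ k + β * σ p ^ k) • v1 = v1 := by rw [hαβ, one_smul]
    rwa [add_smul, mul_smul α, h1k, smul_zero, zero_add] at this
  obtain ⟨v2, h2k, h2⟩ : ∃ v2 : V, σ p ^ k • v2 = 0 ∧ B (p ^ (k - 1) • v1) v2 ≠ 0 := by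
    refine ⟨(σ β * p ^ k) • z, ?_, ?_⟩
    · rw [smul_smul]
      have : σ p ^ k * (σ β * p ^ k) = σ β * (p ^ k * σ p ^ k) := by ring
      rw [this, mul_smul, hk, smul_zero]
    · have := hB.adj (β * σ p ^ k) (p ^ (k - 1) • v1) z
      rw [smul_comm, h1β, map_mul, map_pow, hσ] at this
      rwa [← this]
  have h2α : (α * p ^ k) • v2 = v2 := by
    have : (α * p ^ k + β * σ p ^ k) • v2 = v2 := by rw [hαβ, one_smul]
    rwa [add_smul, mul_smul β, h2k, smul_zero, add_zero] at this
  have h11 : ∀ r s : R, B (r • v1) (s • v1) = 0 := by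
    intro r s
    rw [hB.adj, ← h1β, hB.adj, h1β, map_mul, map_pow, hσ, smul_smul, smul_smul]
    have : σ β * p ^ k * σ r * s = (σ β * σ r * s) * p ^ k := by ring
    rw [this, mul_smul, h1k, smul_zero, map_zero]
  have h22 : ∀ r s : R, B (r • v2) (s • v2) = 0 := by
    intro r s
    rw [hB.adj, ← h2α, hB.adj, h2α, map_mul, map_pow, smul_smul, smul_smul]
    have : σ α * σ p ^ k * σ r * s = (σ α * σ r * s) * σ p ^ k := by ring
    rw [this, mul_smul, h2k, smul_zero, map_zero]
  have hu1 : ∀ s : R, s • v1 = (s * (β * σ p ^ k)) • (v1 + v2) := by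
    intro s
    rw [mul_smul, smul_add, h1β, mul_smul β, h2k, smul_zero, add_zero]
  have hu2 : ∀ s : R, s • v2 = (s * (α * p ^ k)) • (v1 + v2) := by
    intro s
    rw [mul_smul, smul_add, h2α, mul_smul α, h1k, smul_zero, zero_add]
  refine HasSkewReversal.of_cyclic hσ hB IH (v1 + v2) ?_ ?_
  · intro h0
    apply h2
    rw [hu1 (p ^ (k - 1)), h0, smul_zero, map_zero, LinearMap.zero_apply]
  · intro r hr
    have hr2 : ∀ s : R, B (r • v1) (s • v2) = 0 := by
      intro s
      have := hr (s * (α * p ^ k))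
      rw [← hu2, smul_add, map_add, LinearMap.add_apply, h22, add_zero] at this
      exact this
    have hr1 : ∀ s : R, B (r • v2) (s • v1) = 0 := by
      intro s
      have := hr (s * (β * σ p ^ k))
      rw [← hu1, smul_add, map_add, LinearMap.add_apply, h11, zero_add] at this
      exact this
    have e1 : r • v1 = 0 := by
      by_contra hne
      obtain ⟨c, hc⟩ := hp.exists_smul_smul_eq k h1k hne
      apply h2
      rw [hc, hB.adj]
      exact hr2 _
    have e2 : r • v2 = 0 := by
      by_contra hne
      obtain ⟨c, hc⟩ := hq.exists_smul_smul_eq k h2k hne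
      apply h2
      rw [hB.neg]
      have : B v2 (p ^ (k - 1) • v1) = B (σ p ^ (k - 1) • v2) v1 := by
        rw [hB.adj, map_pow, hσ]
      rw [this, hc, hB.adj, hr1, neg_zero]
    rw [smul_add, e1, e2, add_zero]

theorem HasSkewReversal.of_smaller (hσ : ∀ r, σ (σ r) = r) (h2 : (2 : F) ≠ 0)
    (hB : IsAdjointForm σ B) [Module.Finite F V]
    (IH : ∀ W : Submodule R V, W ≠ ⊤ → IsAdjointForm σ (restrictForm B W) →
      HasSkewReversal σ (restrictForm B W)) : HasSkewReversal σ B := by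
  rcases subsingleton_or_nontrivial V with hV | hV
  · exact ⟨LinearMap.id, fun v => rfl, fun v w => by
      rw [Subsingleton.elim v 0]; simp, fun r v => Subsingleton.elim _ _⟩
  obtain ⟨m, hm⟩ : ∃ m : R, ∀ r, (∀ v : V, r • v = 0) ↔ m ∣ r := by
    refine ⟨Submodule.IsPrincipal.generator (Module.annihilator R V), fun r => ?_⟩
    rw [← Module.mem_annihilator, Submodule.IsPrincipal.mem_iff_generator_dvd]
  have hm0 : m ≠ 0 := by
    rintro rfl
    obtain ⟨n, hn, hn'⟩ := hB.tors
    exact hn (zero_dvd_iff.1 ((hm n).1 hn'))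
  have hmu : ¬ IsUnit m := by
    intro hu
    obtain ⟨v, hv⟩ := exists_ne (0 : V)
    apply hv
    have := (hm 1).2 (hu.dvd) v
    rwa [one_smul] at this
  have hσm : σ m ∣ m := by
    have : m ∣ σ m := by
      rw [← hm]
      intro v
      apply hB.sep
      intro w
      rw [hB.adj, hσ, (hm m).2 dvd_rfl, map_zero]
    have := map_dvd σ this
    rwa [hσ] at this
  obtain ⟨p, hp, hpm⟩ := WfDvdMonoid.exists_irreducible_factor hmu hm0
  obtain ⟨k, m', hm', hmk⟩ := WfDvdMonoid.max_power_factor hm0 hp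
  have hk0 : k ≠ 0 := by
    rintro rfl
    rw [pow_zero, one_mul] at hmk
    exact hm' (hmk ▸ hpm)
  have hnk : ∀ r, ¬ m ∣ r → ∃ v : V, r • v ≠ 0 := by
    intro r hr
    rw [← hm] at hr
    push Not at hr
    exact hr
  by_cases hps : Associated p (σ p)
  · by_cases ha : ∃ v : V, p ^ k • v ≠ 0
    · refine HasSkewReversal.of_isCoprime hB IH (p ^ k) m' ?_ ?_ ?_ ha ?_
      · exact (hp.coprime_iff_not_dvd.2 hm').pow_left
      · rw [← hmk]; exact (hm m).2 dvd_rfl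
      · rw [map_pow]; exact pow_dvd_pow_of_dvd hps.dvd k
      · apply hnk
        intro h
        exact hm' (hpm.trans h)
    · push Not at ha
      obtain ⟨v0, hv0⟩ := hnk (p ^ (k - 1)) (by
        intro h
        have : p ^ k ∣ p ^ (k - 1) := (Dvd.intro _ hmk.symm).trans h
        rw [pow_dvd_pow_iff hp.ne_zero hp.not_isUnit] at this
        omega)
      exact HasSkewReversal.of_associated hσ h2 hB IH p hp hps k ha v0 hv0
  · have hq : Irreducible (σ p) := (MulEquiv.irreducible_iff σ).2 hp
    have hnd : ¬ p ∣ σ p := fun h => hps (hp.associated_of_dvd hq h)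
    have hnd' : ¬ σ p ∣ p := fun h => hps (hq.associated_of_dvd hp h).symm
    have hd : σ p ^ k ∣ m' := by
      have h1 : σ p ^ k ∣ p ^ k * m' := by
        rw [← hmk, ← map_pow]
        exact (map_dvd σ (Dvd.intro _ hmk.symm)).trans hσm
      exact ((hq.coprime_iff_not_dvd.2 hnd').pow).dvd_of_dvd_mul_left h1
    obtain ⟨n, rfl⟩ := hd
    have hpn : ¬ p ∣ n := fun h => hm' (h.mul_left _)
    have hqn : ¬ σ p ∣ n := by
      rintro ⟨e, rfl⟩
      apply hm'
      have h1 : p ^ (k + 1) ∣ p ^ k * (σ p ^ k * (σ p * e)) := by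
        rw [← hmk]
        refine dvd_trans ?_ hσm
        rw [hmk]
        simp only [map_mul, map_pow, hσ]
        exact ⟨σ p ^ k * σ e, by ring⟩
      rw [pow_succ] at h1
      exact (mul_dvd_mul_iff_left (pow_ne_zero k hp.ne_zero)).1 h1
    by_cases ha : ∃ v : V, (p ^ k * σ p ^ k) • v ≠ 0
    · refine HasSkewReversal.of_isCoprime hB IH (p ^ k * σ p ^ k) n ?_ ?_ ?_ ha ?_
      · exact ((hp.coprime_iff_not_dvd.2 hpn).pow_left).mul_left
          ((hq.coprime_iff_not_dvd.2 hqn).pow_left)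
      · rw [mul_assoc, ← hmk]; exact (hm m).2 dvd_rfl
      · rw [map_mul, map_pow, map_pow, hσ, mul_comm]
      · apply hnk
        intro h
        exact hpn (hpm.trans h)
    · push Not at ha
      obtain ⟨y, hy⟩ := hnk (p ^ (k - 1) * σ p ^ k) (by
        intro h
        have h1 : p ^ k ∣ p ^ (k - 1) * σ p ^ k := (Dvd.intro _ hmk.symm).trans h
        have h3 : p ^ k ∣ p ^ (k - 1) :=
          ((hp.coprime_iff_not_dvd.2 hnd).pow).dvd_of_dvd_mul_right h1
        rw [pow_dvd_pow_iff hp.ne_zero hp.not_isUnit] at h3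
        omega)
      exact HasSkewReversal.of_not_associated hσ hB IH p hp hps k ha y hy

theorem IsAdjointForm.hasSkewReversal {F R : Type*} [Field F] [CommRing R] [Algebra F R]
    [IsDomain R] [IsPrincipalIdealRing R] {σ : R ≃ₐ[F] R} (hσ : ∀ r, σ (σ r) = r)
    (h2 : (2 : F) ≠ 0) : ∀ (n : ℕ) (V : Type u) [AddCommGroup V] [Module F V] [Module R V]
    [IsScalarTower F R V] [Module.Finite F V] (B : LinearMap.BilinForm F V),
    Module.finrank F V = n → IsAdjointForm σ B → HasSkewReversal σ B := by
  intro n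
  induction n using Nat.strong_induction_on with
  | _ n ih =>
    intro V _ _ _ _ _ B hn hB
    refine HasSkewReversal.of_smaller hσ h2 hB fun W hW hBW => ?_
    have hlt : Module.finrank F W < n := by
      rw [← hn]
      have := Submodule.finrank_lt (s := W.restrictScalars F) (by
        intro h
        apply hW
        rw [Submodule.eq_top_iff'] at h ⊢
        exact h)
      exact this
    haveI : Module.Finite F W := inferInstanceAs (Module.Finite F (W.restrictScalars F))
    exact ih _ hlt W _ rfl hBW
end

section

open LaurentPolynomial

theorem IsLocalization.isPrincipalIdealRing {R S : Type*} [CommRing R] [CommRing S] [Algebra R S]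
    (M : Submonoid R) [IsLocalization M S] [IsPrincipalIdealRing R] : IsPrincipalIdealRing S := by
  refine ⟨fun J => ?_⟩
  obtain ⟨a, ha⟩ := IsPrincipalIdealRing.principal (J.under R)
  refine ⟨algebraMap R S a, ?_⟩
  rw [← IsLocalization.map_under M S J, ha]
  change Ideal.map _ (Ideal.span {a}) = Ideal.span _
  rw [Ideal.map_span, Set.image_singleton]

/-- Every isometry of a nondegenerate alternating form in characteristic not two is inverted by
a skew-isometric involution. -/
theorem exists_skew_involution_inverting {F : Type*} [Field F] (h2 : (2 : F) ≠ 0) {V : Type*}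
    [AddCommGroup V] [Module F V] [Module.Finite F V] (B : LinearMap.BilinForm F V)
    (hA : ∀ v, B v v = 0) (hB : ∀ v, (∀ w, B v w = 0) → v = 0) (g : V ≃ₗ[F] V)
    (hg : ∀ v w, B (g v) (g w) = B v w) :
    ∃ t : V ≃ₗ[F] V, t * t = 1 ∧ (∀ v w, B (t v) (t w) = -B v w) ∧ t * g * t⁻¹ = g⁻¹ := by
  let φ : F[T;T⁻¹] →ₐ[F] Module.End F V := AddMonoidAlgebra.lift F (Module.End F V) ℤ
    ((Units.coeHom _).comp (zpowersHom (Module.End F V)ˣ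
      (LinearMap.GeneralLinearGroup.ofLinearEquiv g)))
  letI : Module F[T;T⁻¹] V := Module.compHom V φ.toRingHom
  have hsmul : ∀ (r : F[T;T⁻¹]) (v : V), r • v = φ r v := fun r v => rfl
  haveI : IsScalarTower F F[T;T⁻¹] V := ⟨fun a r v => by
    rw [hsmul, hsmul, map_smul]; rfl⟩
  haveI : IsPrincipalIdealRing F[T;T⁻¹] :=
    IsLocalization.isPrincipalIdealRing (Submonoid.powers (Polynomial.X : Polynomial F))
  have hT1 : ∀ v : V, (T 1 : F[T;T⁻¹]) • v = g v := by
    intro v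
    rw [hsmul]
    simp only [φ, LaurentPolynomial.T, AddMonoidAlgebra.lift_single]
    simp
  have hTn1 : ∀ v : V, (T (-1) : F[T;T⁻¹]) • v = g⁻¹ v := by
    intro v
    apply g.injective
    rw [← hT1, smul_smul, ← T_add]
    change _ = g (g.symm v)
    simp
  have hadj : ∀ (r : F[T;T⁻¹]) v w, B (r • v) w = B v (invert r • w) := by
    have key : ∀ n : ℤ, ∀ v w, B ((T n : F[T;T⁻¹]) • v) w = B v ((T (-n) : F[T;T⁻¹]) • w) := by
      have h1 : ∀ v w, B ((T 1 : F[T;T⁻¹]) • v) w = B v ((T (-1) : F[T;T⁻¹]) • w) := by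
        intro v w
        rw [hT1, hTn1, ← hg v]
        change _ = B (g v) (g (g.symm w))
        simp
      have hn : ∀ v w, B ((T (-1) : F[T;T⁻¹]) • v) w = B v ((T 1 : F[T;T⁻¹]) • w) := by
        intro v w
        rw [hT1, hTn1, ← hg (g⁻¹ v)]
        change B (g (g.symm v)) _ = _
        simp
      intro n
      induction n with
      | zero => intro v w; simp
      | succ n ih =>
        intro v w
        rw [T_add, mul_smul, ih, h1, smul_smul, ← T_add]
        congr 3; ring
      | pred n ih =>
        intro v w
        rw [sub_eq_add_neg, T_add, mul_smul, ih, hn, smul_smul, ← T_add]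
        congr 3; ring
    intro r
    induction r using LaurentPolynomial.induction_on' with
    | add p q hp hq => intro v w; simp [add_smul, hp, hq]
    | C_mul_T n a =>
      intro v w
      have hC : ∀ v : V, (C a : F[T;T⁻¹]) • v = a • v := by
        intro v
        rw [LaurentPolynomial.C_eq_algebraMap, algebraMap_smul]
      rw [mul_smul, hC, map_mul, invert_C, invert_T, mul_smul, hC, (B v).map_smul, B.map_smul,
        LinearMap.smul_apply, key]
  have htors : ∃ m : F[T;T⁻¹], m ≠ 0 ∧ ∀ v : V, m • v = 0 := by
    refine ⟨Polynomial.toLaurent (minpoly F (g : Module.End F V)), ?_, fun v => ?_⟩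
    · intro h
      exact minpoly.ne_zero (Algebra.IsIntegral.isIntegral (R := F) (g : Module.End F V))
        (Polynomial.toLaurent_injective (by simpa using h))
    · have hφ : φ.comp Polynomial.toLaurentAlg = Polynomial.aeval (g : Module.End F V) := by
        apply Polynomial.algHom_ext
        ext v
        simp only [AlgHom.comp_apply, Polynomial.toLaurentAlg_apply, Polynomial.toLaurent_X,
          Polynomial.aeval_X]
        exact hT1 v
      have := congrArg (fun f => f (minpoly F (g : Module.End F V)) v) hφ
      simp only [AlgHom.comp_apply, Polynomial.toLaurentAlg_apply, minpoly.aeval] at this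
      rw [hsmul, this]; rfl
  obtain ⟨t, t1, t2, t3⟩ := IsAdjointForm.hasSkewReversal (σ := (invert : F[T;T⁻¹] ≃ₐ[F] F[T;T⁻¹]))
    involutive_invert h2 _ V B rfl ⟨hA, hB, hadj, htors⟩
  let te : V ≃ₗ[F] V := LinearEquiv.ofLinearMap t t (LinearMap.ext t1) (LinearMap.ext t1)
  refine ⟨te, LinearEquiv.ext t1, t2, ?_⟩
  rw [mul_inv_eq_iff_eq_mul]
  ext v
  change t (g v) = g⁻¹ (t v)
  rw [← hT1, t3, ← hTn1, invert_T]
end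

section

open scoped Classical
variable {F V W₁ W₂ : Type*} [Field F] [AddCommGroup V] [Module F V] [AddCommGroup W₁] [Module F W₁]
  [AddCommGroup W₂] [Module F W₂]

/-- The isometries commuting with `x`. -/
def isometryCentralizer (B : LinearMap.BilinForm F V) (x : V ≃ₗ[F] V) : Subgroup (V ≃ₗ[F] V) where
  carrier := {g | (∀ v w, B (g v) (g w) = B v w) ∧ g * x = x * g}
  one_mem' := ⟨fun _ _ => rfl, by simp⟩
  mul_mem' := fun {g h} hg hh => ⟨fun v w => by
    rw [LinearEquiv.mul_apply, LinearEquiv.mul_apply, hg.1, hh.1], by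
    rw [mul_assoc, hh.2, ← mul_assoc, hg.2, mul_assoc]⟩
  inv_mem' := fun {g} hg => ⟨fun v w => by
    rw [← hg.1]; exact congrArg₂ (fun a b => B a b) (g.apply_symm_apply v) (g.apply_symm_apply w), by
    rw [inv_mul_eq_iff_eq_mul, ← mul_assoc, hg.2, mul_assoc, mul_inv_cancel, mul_one]⟩

/-- The skew-isometries inverting `x`. -/
def skewInverters (B : LinearMap.BilinForm F V) (x : V ≃ₗ[F] V) : Set (V ≃ₗ[F] V) :=
  {t | (∀ v w, B (t v) (t w) = -B v w) ∧ t * x * t⁻¹ = x⁻¹}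

/-- Block diagonal automorphisms. -/
def blockHom (e : (W₁ × W₂) ≃ₗ[F] V) : (W₁ ≃ₗ[F] W₁) × (W₂ ≃ₗ[F] W₂) →* (V ≃ₗ[F] V) where
  toFun p := e.symm.trans ((p.1.prodCongr p.2).trans e)
  map_one' := by ext v; simp
  map_mul' p q := by ext v; simp

theorem blockHom_apply (e : (W₁ × W₂) ≃ₗ[F] V) (a : W₁ ≃ₗ[F] W₁) (b : W₂ ≃ₗ[F] W₂) (u : W₁)
    (v : W₂) : blockHom e (a, b) (e (u, v)) = e (a u, b v) := by
  simp [blockHom]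

theorem ext_of_prod {e : (W₁ × W₂) ≃ₗ[F] V} {g h : V ≃ₗ[F] V}
    (H : ∀ u v, g (e (u, v)) = h (e (u, v))) : g = h := by
  ext v
  obtain ⟨⟨a, b⟩, rfl⟩ := e.surjective v
  exact H a b

theorem blockHom_injective (e : (W₁ × W₂) ≃ₗ[F] V) : Function.Injective (blockHom e) := by
  rintro ⟨a, b⟩ ⟨c, d⟩ h
  have h1 : ∀ u v, (a u, b v) = (c u, d v) := fun u v => by
    apply e.injective
    rw [← blockHom_apply, ← blockHom_apply, h]
  refine Prod.ext (LinearEquiv.ext fun u => ?_) (LinearEquiv.ext fun v => ?_)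
  · exact congrArg Prod.fst (h1 u 0)
  · exact congrArg Prod.snd (h1 0 v)

theorem blockHom_mem_isometryCentralizer {B : LinearMap.BilinForm F V}
    {B₁ : LinearMap.BilinForm F W₁} {B₂ : LinearMap.BilinForm F W₂} (e : (W₁ × W₂) ≃ₗ[F] V)
    (hB : ∀ u v u' v', B (e (u, v)) (e (u', v')) = B₁ u u' + B₂ v v')
    (x₁ a : W₁ ≃ₗ[F] W₁) (x₂ b : W₂ ≃ₗ[F] W₂) :
    blockHom e (a, b) ∈ isometryCentralizer B (blockHom e (x₁, x₂)) ↔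
      a ∈ isometryCentralizer B₁ x₁ ∧ b ∈ isometryCentralizer B₂ x₂ := by
  have h2 : blockHom e (a, b) * blockHom e (x₁, x₂) = blockHom e (x₁, x₂) * blockHom e (a, b) ↔
      a * x₁ = x₁ * a ∧ b * x₂ = x₂ * b := by
    rw [← map_mul, ← map_mul, (blockHom_injective e).eq_iff, Prod.mk_mul_mk, Prod.mk_mul_mk,
      Prod.mk.injEq]
  constructor
  · rintro ⟨h, h'⟩
    rw [h2] at h'
    refine ⟨⟨fun u u' => ?_, h'.1⟩, ⟨fun v v' => ?_, h'.2⟩⟩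
    · have := h (e (u, 0)) (e (u', 0))
      simpa [blockHom_apply, hB] using this
    · have := h (e (0, v)) (e (0, v'))
      simpa [blockHom_apply, hB] using this
  · rintro ⟨⟨h1, h1'⟩, ⟨h3, h3'⟩⟩
    refine ⟨fun v w => ?_, h2.2 ⟨h1', h3'⟩⟩
    obtain ⟨⟨u, v⟩, rfl⟩ := e.surjective v
    obtain ⟨⟨u', v'⟩, rfl⟩ := e.surjective w
    rw [blockHom_apply, blockHom_apply, hB, hB, h1, h3]

theorem blockHom_mem_skewInverters {B : LinearMap.BilinForm F V}
    {B₁ : LinearMap.BilinForm F W₁} {B₂ : LinearMap.BilinForm F W₂} (e : (W₁ × W₂) ≃ₗ[F] V)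
    (hB : ∀ u v u' v', B (e (u, v)) (e (u', v')) = B₁ u u' + B₂ v v')
    (x₁ a : W₁ ≃ₗ[F] W₁) (x₂ b : W₂ ≃ₗ[F] W₂) (ha : a ∈ skewInverters B₁ x₁)
    (hb : b ∈ skewInverters B₂ x₂) : blockHom e (a, b) ∈ skewInverters B (blockHom e (x₁, x₂)) := by
  refine ⟨fun v w => ?_, ?_⟩
  · obtain ⟨⟨u, v⟩, rfl⟩ := e.surjective v
    obtain ⟨⟨u', v'⟩, rfl⟩ := e.surjective w
    rw [blockHom_apply, blockHom_apply, hB, hB, ha.1, hb.1, neg_add]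
  · rw [← map_inv, ← map_inv, ← map_mul, ← map_mul]
    exact congrArg _ (Prod.ext ha.2 hb.2)

theorem mem_range_blockHom (h2 : (2 : F) ≠ 0) (e : (W₁ × W₂) ≃ₗ[F] V) (s : V ≃ₗ[F] V)
    (hs : ∀ u v, s (e (u, v)) = e (u, -v)) (g : V ≃ₗ[F] V) (hg : g * s = s * g) :
    g ∈ (blockHom e).range := by
  have key1 : ∀ g : V ≃ₗ[F] V, g * s = s * g → ∀ u, (e.symm (g (e (u, 0)))).2 = 0 := by
    intro g hg u
    have h := congrArg (fun f : V ≃ₗ[F] V => f (e (u, 0))) hg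
    simp only [LinearEquiv.mul_apply, hs, neg_zero] at h
    obtain ⟨⟨p, r⟩, hp⟩ := e.surjective (g (e (u, 0)))
    rw [← hp, hs] at h
    have h' := congrArg Prod.snd (e.injective h)
    simp only at h'
    rw [← hp, e.symm_apply_apply]
    have h3 : (2 : F) • r = 0 := by rw [two_smul]; nth_rewrite 1 [h']; simp
    exact (smul_eq_zero.1 h3).resolve_left h2
  have key2 : ∀ g : V ≃ₗ[F] V, g * s = s * g → ∀ v, (e.symm (g (e (0, v)))).1 = 0 := by
    intro g hg u
    have h := congrArg (fun f : V ≃ₗ[F] V => f (e (0, u))) hg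
    simp only [LinearEquiv.mul_apply, hs] at h
    obtain ⟨⟨p, r⟩, hp⟩ := e.surjective (g (e (0, u)))
    have hn : ((0 : W₁), -u) = -(0, u) := by simp
    rw [hn, map_neg, map_neg, ← hp, hs, ← map_neg] at h
    have h' := congrArg Prod.fst (e.injective h)
    simp only [Prod.fst_neg] at h'
    rw [← hp, e.symm_apply_apply]
    have h3 : (2 : F) • p = 0 := by rw [two_smul]; nth_rewrite 1 [← h']; simp
    exact (smul_eq_zero.1 h3).resolve_left h2
  have hg' : g⁻¹ * s = s * g⁻¹ := by
    rw [inv_mul_eq_iff_eq_mul, ← mul_assoc, hg, mul_assoc, mul_inv_cancel, mul_one]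
  let A : (V ≃ₗ[F] V) → W₁ →ₗ[F] W₁ := fun g =>
    LinearMap.fst F W₁ W₂ ∘ₗ e.symm.toLinearMap ∘ₗ g.toLinearMap ∘ₗ e.toLinearMap ∘ₗ
      LinearMap.inl F W₁ W₂
  let D : (V ≃ₗ[F] V) → W₂ →ₗ[F] W₂ := fun g =>
    LinearMap.snd F W₁ W₂ ∘ₗ e.symm.toLinearMap ∘ₗ g.toLinearMap ∘ₗ e.toLinearMap ∘ₗ
      LinearMap.inr F W₁ W₂
  have hA : ∀ g : V ≃ₗ[F] V, g * s = s * g → ∀ u, g (e (u, 0)) = e (A g u, 0) := by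
    intro g hg u
    rw [← e.symm_apply_eq]
    exact Prod.ext rfl (key1 g hg u)
  have hD : ∀ g : V ≃ₗ[F] V, g * s = s * g → ∀ v, g (e (0, v)) = e (0, D g v) := by
    intro g hg u
    rw [← e.symm_apply_eq]
    exact Prod.ext (key2 g hg u) rfl
  have hAA : ∀ g h : V ≃ₗ[F] V, g * s = s * g → h * s = s * h → g * h = 1 → A g ∘ₗ A h = LinearMap.id := by
    intro g h hg hh hgh
    ext u
    have h1 : e (A g (A h u), 0) = e (u, 0) := by
      rw [← hA g hg, ← hA h hh, ← LinearEquiv.mul_apply, hgh]; rfl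
    exact congrArg Prod.fst (e.injective h1)
  have hDD : ∀ g h : V ≃ₗ[F] V, g * s = s * g → h * s = s * h → g * h = 1 → D g ∘ₗ D h = LinearMap.id := by
    intro g h hg hh hgh
    ext u
    have h1 : e (0, D g (D h u)) = e (0, u) := by
      rw [← hD g hg, ← hD h hh, ← LinearEquiv.mul_apply, hgh]; rfl
    exact congrArg Prod.snd (e.injective h1)
  refine ⟨(LinearEquiv.ofLinearMap (A g) (A g⁻¹) (hAA _ _ hg hg' (mul_inv_cancel g))
      (hAA _ _ hg' hg (inv_mul_cancel g)),
    LinearEquiv.ofLinearMap (D g) (D g⁻¹) (hDD _ _ hg hg' (mul_inv_cancel g))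
      (hDD _ _ hg' hg (inv_mul_cancel g))), ?_⟩
  apply ext_of_prod (e := e)
  intro u v
  rw [blockHom_apply]
  have : ((u, v) : W₁ × W₂) = (u, 0) + (0, v) := by simp
  rw [this, map_add, map_add, hA g hg, hD g hg, ← map_add]
  simp
end

section

open scoped Classical
universe u

theorem exists_max_two_subgroup {Γ : Type*} [Group Γ] [Finite Γ] (C : Subgroup Γ) :
    ∃ P : Subgroup Γ, P ≤ C ∧ IsPGroup 2 P ∧
      ∀ Q : Subgroup Γ, Q ≤ C → IsPGroup 2 Q → Nat.card Q ≤ Nat.card P := by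
  have : Nonempty {Q : Subgroup Γ // Q ≤ C ∧ IsPGroup 2 Q} := ⟨⟨⊥, bot_le, IsPGroup.of_bot⟩⟩
  obtain ⟨⟨P, h1, h2⟩, h⟩ := Finite.exists_max
    (fun Q : {Q : Subgroup Γ // Q ≤ C ∧ IsPGroup 2 Q} => Nat.card Q.1)
  exact ⟨P, h1, h2, fun Q hQ hQ2 => h ⟨Q, hQ, hQ2⟩⟩

variable {F : Type*} [Field F]

/-- The inductive hypothesis on spaces of smaller dimension. -/
def HasPosTwistBelow (F : Type*) [Field F] (n : ℕ) : Prop :=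
  ∀ (W : Type u) [AddCommGroup W] [Module F W] [Finite W] [Fintype (W ≃ₗ[F] W)]
    (B : LinearMap.BilinForm F W) (x : W ≃ₗ[F] W), Module.finrank F W < n →
    (∀ v, B v v = 0) → (∀ v, (∀ w, B v w = 0) → v = 0) →
    (∀ v w, B (x v) (x w) = B v w) → Odd (orderOf x) →
    HasPosTwist (isometryCentralizer B x) (skewInverters B x)

theorem exists_zpow_eq_of_coprime {G : Type*} [Group G] (x a : G) (h : x * a = a * x)
    (hc : (orderOf x).Coprime (orderOf a)) : (∃ k : ℕ, (x * a) ^ k = x) ∧ ∃ k : ℕ, (x * a) ^ k = a := by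
  have hcomm : Commute x a := h
  refine ⟨⟨Nat.chineseRemainder hc 1 0, ?_⟩, ⟨Nat.chineseRemainder hc 0 1, ?_⟩⟩
  · rw [hcomm.mul_pow, pow_eq_pow_iff_modEq.2 (Nat.chineseRemainder hc 1 0).2.1,
      pow_eq_pow_iff_modEq.2 (Nat.chineseRemainder hc 1 0).2.2, pow_one, pow_zero, mul_one]
  · rw [hcomm.mul_pow, pow_eq_pow_iff_modEq.2 (Nat.chineseRemainder hc 0 1).2.1,
      pow_eq_pow_iff_modEq.2 (Nat.chineseRemainder hc 0 1).2.2, pow_one, pow_zero, one_mul]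

theorem conj_pow_inv_of_conj {G : Type*} [Group G] {t y : G} (h : t * y * t⁻¹ = y⁻¹) {x : G} {k : ℕ}
    (hk : y ^ k = x) : t * x * t⁻¹ = x⁻¹ := by
  rw [← hk, ← conj_pow, h, inv_pow]

variable {V : Type u} [AddCommGroup V] [Module F V] [Finite V] [Fintype (V ≃ₗ[F] V)]

/-- The case of a maximal `2`-subgroup with a cyclic normal subgroup of index at most two. -/
theorem hasPosTwist_of_zpowers (h2 : (2 : F) ≠ 0) (B : LinearMap.BilinForm F V)
    (hA : ∀ v, B v v = 0) (hB : ∀ v, (∀ w, B v w = 0) → v = 0) (x : V ≃ₗ[F] V)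
    (hx : ∀ v w, B (x v) (x w) = B v w) (hodd : Odd (orderOf x))
    (P : Subgroup (V ≃ₗ[F] V)) (hPC : P ≤ isometryCentralizer B x) (hP2 : IsPGroup 2 P)
    (hPmax : ∀ Q : Subgroup (V ≃ₗ[F] V), Q ≤ isometryCentralizer B x → IsPGroup 2 Q →
      Nat.card Q ≤ Nat.card P)
    (a : P) (hn : (Subgroup.zpowers a).Normal) (hi : (Subgroup.zpowers a).index ≤ 2) :
    HasPosTwist (isometryCentralizer B x) (skewInverters B x) := by
  haveI : Module.Finite F V := Module.Finite.of_finite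
  have haC := hPC a.2
  have hord : (orderOf x).Coprime (orderOf (a : V ≃ₗ[F] V)) := by
    obtain ⟨k, hk⟩ := (IsPGroup.iff_orderOf.1 hP2) a
    rw [← Subgroup.orderOf_coe] at hk
    rw [hk]
    exact (Nat.coprime_two_right.2 hodd).pow_right k
  obtain ⟨⟨k, hk⟩, ⟨l, hl⟩⟩ := exists_zpow_eq_of_coprime x (a : V ≃ₗ[F] V) haC.2.symm hord
  obtain ⟨t, t1, t2, t3⟩ := exists_skew_involution_inverting h2 B hA hB (x * a)
    (fun v w => by rw [LinearEquiv.mul_apply, LinearEquiv.mul_apply, hx, haC.1])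
  have htx := conj_pow_inv_of_conj t3 hk
  have hinv : t⁻¹ = t := inv_eq_of_mul_eq_one_left t1
  refine HasPosTwist.of_cyclic P hPC hP2 hPmax a a.2 ?_ ?_ t ⟨t2, htx⟩ t1
    (conj_pow_inv_of_conj t3 hl) ?_
  · intro p hp g hg
    obtain ⟨m, rfl⟩ := hg
    obtain ⟨j, hj⟩ := hn.conj_mem (a ^ m) ⟨m, rfl⟩ ⟨p, hp⟩
    exact ⟨j, congrArg Subtype.val hj⟩
  · have := (Subgroup.zpowers a).card_mul_index
    rw [← this, Nat.card_zpowers, Nat.card_zpowers, Subgroup.orderOf_coe, mul_comm]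
    exact Nat.mul_le_mul_right _ hi
  · intro g hg
    refine ⟨fun v w => ?_, ?_⟩
    · rw [hinv]
      change B (t (g (t v))) (t (g (t w))) = _
      rw [t2, hg.1, t2, neg_neg]
    · have hx' : x = t * x⁻¹ * t⁻¹ := by rw [← conj_inv, htx, inv_inv]
      have hgx : g * x⁻¹ = x⁻¹ * g := (Commute.inv_right (show Commute g x from hg.2))
      have h1 : t * g * t⁻¹ * (t * x⁻¹ * t⁻¹) = t * x⁻¹ * t⁻¹ * (t * g * t⁻¹) := by
        rw [conj_mul, conj_mul, hgx]
      rwa [← hx'] at h1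

/-- The splitting of `V` into the eigenspaces of an isometric involution. -/
theorem exists_eigen_equiv (h2 : (2 : F) ≠ 0) (B : LinearMap.BilinForm F V)
    (hB : ∀ v, (∀ w, B v w = 0) → v = 0) (s : V ≃ₗ[F] V) (hs : s * s = 1)
    (hsB : ∀ v w, B (s v) (s w) = B v w) (W₁ W₂ : Submodule F V) (hW₁ : ∀ v, v ∈ W₁ ↔ s v = v)
    (hW₂ : ∀ v, v ∈ W₂ ↔ s v = -v) :
    ∃ e : (W₁ × W₂) ≃ₗ[F] V, (∀ u v, e (u, v) = u + v) ∧ (∀ u v, s (e (u, v)) = e (u, -v)) ∧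
      (∀ u v u' v', B (e (u, v)) (e (u', v')) = B u u' + B v v') ∧
      (∀ v : W₁, (∀ w : W₁, B v w = 0) → v = 0) ∧ (∀ v : W₂, (∀ w : W₂, B v w = 0) → v = 0) := by
  have hss : ∀ v, s (s v) = v := fun v => congrArg (fun f : V ≃ₗ[F] V => f v) hs
  have hcompl : IsCompl W₁ W₂ := by
    constructor
    · rw [Submodule.disjoint_def]
      intro v hv hv'
      rw [hW₁] at hv
      rw [hW₂, hv] at hv'
      have h3 : (2 : F) • v = 0 := by rw [two_smul]; nth_rewrite 1 [hv']; simp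
      exact (smul_eq_zero.1 h3).resolve_left h2
    · rw [codisjoint_iff, eq_top_iff]
      intro v _
      rw [Submodule.mem_sup]
      refine ⟨(2 : F)⁻¹ • (v + s v), (hW₁ _).2 ?_, (2 : F)⁻¹ • (v - s v), (hW₂ _).2 ?_, ?_⟩
      · rw [map_smul, map_add, hss, add_comm]
      · rw [map_smul, map_sub, hss, ← smul_neg, neg_sub]
      · rw [← smul_add, add_add_sub_cancel, ← two_smul F v, smul_smul, inv_mul_cancel₀ h2, one_smul]
  have horth : ∀ u ∈ W₁, ∀ v ∈ W₂, B u v = 0 ∧ B v u = 0 := by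
    intro u hu v hv
    have h3 := hsB u v
    have h4 := hsB v u
    rw [(hW₁ u).1 hu, (hW₂ v).1 hv, map_neg] at h3
    rw [(hW₁ u).1 hu, (hW₂ v).1 hv, map_neg, LinearMap.neg_apply] at h4
    have h5 : (2 : F) * B u v = 0 := by linear_combination -h3
    have h6 : (2 : F) * B v u = 0 := by linear_combination -h4
    exact ⟨(mul_eq_zero.1 h5).resolve_left h2, (mul_eq_zero.1 h6).resolve_left h2⟩
  have hsup : ∀ w : V, ∃ u : W₁, ∃ v : W₂, (u : V) + v = w := by
    intro w
    obtain ⟨u, hu, v, hv, h⟩ := Submodule.mem_sup.1 (hcompl.sup_eq_top ▸ Submodule.mem_top (x := w))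
    exact ⟨⟨u, hu⟩, ⟨v, hv⟩, h⟩
  have he : ∀ u v, W₁.prodEquivOfIsCompl W₂ hcompl (u, v) = (u : V) + v :=
    fun u v => Submodule.coe_prodEquivOfIsCompl' _ _ hcompl (u, v)
  refine ⟨Submodule.prodEquivOfIsCompl W₁ W₂ hcompl, he, fun u v => ?_, fun u v u' v' => ?_, ?_, ?_⟩
  · rw [he, he, map_add, (hW₁ _).1 u.2, (hW₂ _).1 v.2]; rfl
  · rw [he, he, map_add, map_add, LinearMap.add_apply, LinearMap.add_apply,
      (horth u u.2 v' v'.2).1, (horth u' u'.2 v v.2).2, add_zero, zero_add]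
  · intro v hv
    refine Subtype.ext (hB _ fun w => ?_)
    obtain ⟨u', v', rfl⟩ := hsup w
    rw [map_add, hv, (horth v v.2 v' v'.2).1, add_zero]
  · intro v hv
    refine Subtype.ext (hB _ fun w => ?_)
    obtain ⟨u', v', rfl⟩ := hsup w
    rw [map_add, hv, (horth u' u'.2 v v.2).2, add_zero]

theorem odd_orderOf_of_blockHom {W₁ W₂ : Type*} [AddCommGroup W₁] [Module F W₁]
    [AddCommGroup W₂] [Module F W₂] (e : (W₁ × W₂) ≃ₗ[F] V) (x₁ : W₁ ≃ₗ[F] W₁) (x₂ : W₂ ≃ₗ[F] W₂)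
    (h : Odd (orderOf (blockHom e (x₁, x₂)))) : Odd (orderOf x₁) ∧ Odd (orderOf x₂) := by
  rw [orderOf_injective (blockHom e) (blockHom_injective e)] at h
  constructor
  · exact h.of_dvd_nat (orderOf_fst_dvd_orderOf (x := (x₁, x₂)))
  · exact h.of_dvd_nat (orderOf_snd_dvd_orderOf (x := (x₁, x₂)))

theorem restrict_isometry {W₁ W₂ : Type*} [AddCommGroup W₁] [Module F W₁]
    [AddCommGroup W₂] [Module F W₂] {B : LinearMap.BilinForm F V}
    {B₁ : LinearMap.BilinForm F W₁} {B₂ : LinearMap.BilinForm F W₂} (e : (W₁ × W₂) ≃ₗ[F] V)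
    (hB : ∀ u v u' v', B (e (u, v)) (e (u', v')) = B₁ u u' + B₂ v v')
    (x₁ : W₁ ≃ₗ[F] W₁) (x₂ : W₂ ≃ₗ[F] W₂)
    (hx : ∀ v w, B (blockHom e (x₁, x₂) v) (blockHom e (x₁, x₂) w) = B v w) :
    (∀ v w, B₁ (x₁ v) (x₁ w) = B₁ v w) ∧ (∀ v w, B₂ (x₂ v) (x₂ w) = B₂ v w) := by
  have := (blockHom_mem_isometryCentralizer e hB x₁ x₁ x₂ x₂).1 ⟨hx, rfl⟩
  exact ⟨this.1.1, this.2.1⟩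

/-- The case of a non-scalar involution commuting with a maximal `2`-subgroup. -/
theorem hasPosTwist_of_central_involution (h2 : (2 : F) ≠ 0)
    (IH : HasPosTwistBelow.{u} F (Module.finrank F V)) (B : LinearMap.BilinForm F V)
    (hA : ∀ v, B v v = 0) (hB : ∀ v, (∀ w, B v w = 0) → v = 0) (x : V ≃ₗ[F] V)
    (hx : ∀ v w, B (x v) (x w) = B v w) (hodd : Odd (orderOf x))
    (P : Subgroup (V ≃ₗ[F] V)) (hPC : P ≤ isometryCentralizer B x) (hP2 : IsPGroup 2 P)
    (hPmax : ∀ Q : Subgroup (V ≃ₗ[F] V), Q ≤ isometryCentralizer B x → IsPGroup 2 Q →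
      Nat.card Q ≤ Nat.card P)
    (s : V ≃ₗ[F] V) (hsP : s ∈ P) (hs : s * s = 1) (hs1 : s ≠ 1) (hs2 : s ≠ LinearEquiv.neg F)
    (hc : ∀ g ∈ P, g * s = s * g) :
    HasPosTwist (isometryCentralizer B x) (skewInverters B x) := by
  haveI : Module.Finite F V := Module.Finite.of_finite
  have hsC := hPC hsP
  let W₁ : Submodule F V := LinearMap.eqLocus s.toLinearMap LinearMap.id
  let W₂ : Submodule F V := LinearMap.eqLocus s.toLinearMap (-LinearMap.id)
  obtain ⟨e, he, hse, hBe, hB1, hB2⟩ := exists_eigen_equiv h2 B hB s hs hsC.1 W₁ W₂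
    (fun _ => Iff.rfl) (fun _ => Iff.rfl)
  obtain ⟨⟨x₁, x₂⟩, rfl⟩ := mem_range_blockHom h2 e s hse x hsC.2.symm
  have hBe' : ∀ u v u' v', B (e (u, v)) (e (u', v')) =
      B.restrict W₁ u u' + B.restrict W₂ v v' := hBe
  have ho := odd_orderOf_of_blockHom e x₁ x₂ hodd
  have hi := restrict_isometry e hBe' x₁ x₂ hx
  haveI : Finite W₁ := Finite.of_injective _ Subtype.val_injective
  haveI : Finite (W₁ ≃ₗ[F] W₁) := DFunLike.finite _
  letI : Fintype (W₁ ≃ₗ[F] W₁) := Fintype.ofFinite _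
  haveI : Finite W₂ := Finite.of_injective _ Subtype.val_injective
  haveI : Finite (W₂ ≃ₗ[F] W₂) := DFunLike.finite _
  letI : Fintype (W₂ ≃ₗ[F] W₂) := Fintype.ofFinite _
  have hd1 : Module.finrank F W₁ < Module.finrank F V := by
    refine Submodule.finrank_lt fun h => hs1 (LinearEquiv.ext fun v => ?_)
    exact (h ▸ Submodule.mem_top : v ∈ W₁)
  have hd2 : Module.finrank F W₂ < Module.finrank F V := by
    refine Submodule.finrank_lt fun h => hs2 (LinearEquiv.ext fun v => ?_)
    exact (h ▸ Submodule.mem_top : v ∈ W₂)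
  exact (IH W₁ (B.restrict W₁) x₁ hd1 (fun v => hA v) hB1 hi.1 ho.1).prod
    (IH W₂ (B.restrict W₂) x₂ hd2 (fun v => hA v) hB2 hi.2 ho.2) (blockHom e)
    (blockHom_injective e) (fun a b => blockHom_mem_isometryCentralizer e hBe' x₁ a x₂ b)
    (fun a ha b hb => blockHom_mem_skewInverters e hBe' x₁ a x₂ b ha hb) P hPC hP2 hPmax
    (fun g hg => mem_range_blockHom h2 e s hse g (hc g hg))

/-- The case of a non-central involution in a maximal `2`-subgroup, central modulo `-1`. -/
theorem hasPosTwist_of_swap (h2 : (2 : F) ≠ 0)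
    (IH : HasPosTwistBelow.{u} F (Module.finrank F V)) (B : LinearMap.BilinForm F V)
    (hA : ∀ v, B v v = 0) (hB : ∀ v, (∀ w, B v w = 0) → v = 0) (x : V ≃ₗ[F] V)
    (hx : ∀ v w, B (x v) (x w) = B v w) (hodd : Odd (orderOf x))
    (P : Subgroup (V ≃ₗ[F] V)) (hPC : P ≤ isometryCentralizer B x) (hP2 : IsPGroup 2 P)
    (hPmax : ∀ Q : Subgroup (V ≃ₗ[F] V), Q ≤ isometryCentralizer B x → IsPGroup 2 Q →
      Nat.card Q ≤ Nat.card P)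
    (s : V ≃ₗ[F] V) (hsP : s ∈ P) (hs : s * s = 1) (hs1 : s ≠ 1) (hs2 : s ≠ LinearEquiv.neg F)
    (hc : ∀ g ∈ P, g * s = s * g ∨ g * s = LinearEquiv.neg F * s * g)
    (w : V ≃ₗ[F] V) (hwP : w ∈ P) (hw : w * s = LinearEquiv.neg F * s * w) :
    HasPosTwist (isometryCentralizer B x) (skewInverters B x) := by
  haveI : Module.Finite F V := Module.Finite.of_finite
  have hsC := hPC hsP
  have hwC := hPC hwP
  have hws : ∀ v, w (s v) = -s (w v) := fun v => congrArg (fun f : V ≃ₗ[F] V => f v) hw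
  let W₁ : Submodule F V := LinearMap.eqLocus s.toLinearMap LinearMap.id
  let W₂ : Submodule F V := LinearMap.eqLocus s.toLinearMap (-LinearMap.id)
  obtain ⟨e₀, he₀, hse₀, hBe₀, hB1, hB2⟩ := exists_eigen_equiv h2 B hB s hs hsC.1 W₁ W₂
    (fun _ => Iff.rfl) (fun _ => Iff.rfl)
  have hmap : W₁.map w.toLinearMap = W₂ := by
    ext v
    constructor
    · rintro ⟨u, hu, rfl⟩
      have hu' : s u = u := hu
      change s (w u) = -(w u)
      have := hws u
      rw [hu'] at this
      exact (neg_eq_iff_eq_neg.2 this).symm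
    · intro hv
      have hv' : s v = -v := hv
      refine ⟨w.symm v, ?_, w.apply_symm_apply v⟩
      change s (w.symm v) = w.symm v
      apply w.injective
      rw [hws, w.apply_symm_apply, hv', neg_neg]
  let f : W₁ ≃ₗ[F] W₂ := (w.submoduleMap W₁).trans (LinearEquiv.ofEq _ _ hmap)
  have hf : ∀ u, (f u : V) = w u := fun u => rfl
  let e : (W₁ × W₁) ≃ₗ[F] V := ((LinearEquiv.refl F W₁).prodCongr f).trans e₀
  have he : ∀ u v, e (u, v) = e₀ (u, f v) := fun u v => rfl
  have hse : ∀ u v, s (e (u, v)) = e (u, -v) := by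
    intro u v
    rw [he, hse₀, he, map_neg]
  obtain ⟨⟨x₁, x₂⟩, rfl⟩ := mem_range_blockHom h2 e s hse x hsC.2.symm
  have hBe : ∀ u v u' v', B (e (u, v)) (e (u', v')) =
      B.restrict W₁ u u' + B.restrict W₁ v v' := by
    intro u v u' v'
    rw [he, he, hBe₀, hf, hf, hwC.1]; rfl
  have hwe : ∀ u, w (e (u, 0)) = e (0, u) := by
    intro u
    rw [he, he, he₀, he₀, hf, hf, ZeroMemClass.coe_zero, map_zero, add_zero, zero_add]
  have hx12 : x₂ = x₁ := by
    ext1 v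
    have := congrArg (fun g : V ≃ₗ[F] V => g (e (v, 0))) hwC.2
    simp only [LinearEquiv.mul_apply] at this
    rw [blockHom_apply, hwe, map_zero, hwe, blockHom_apply] at this
    exact (congrArg Prod.snd (e.injective this)).symm
  subst hx12
  have ho := odd_orderOf_of_blockHom e x₂ x₂ hodd
  have hi := restrict_isometry e hBe x₂ x₂ hx
  haveI : Finite W₁ := Finite.of_injective _ Subtype.val_injective
  haveI : Finite (W₁ ≃ₗ[F] W₁) := DFunLike.finite _
  letI : Fintype (W₁ ≃ₗ[F] W₁) := Fintype.ofFinite _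
  have hd1 : Module.finrank F W₁ < Module.finrank F V := by
    refine Submodule.finrank_lt fun h => hs1 (LinearEquiv.ext fun v => ?_)
    exact (h ▸ Submodule.mem_top : v ∈ W₁)
  let σ : V ≃ₗ[F] V := e.symm.trans ((LinearEquiv.prodComm F W₁ W₁).trans e)
  have hσ : ∀ u v, σ (e (u, v)) = e (v, u) := fun u v => by simp [σ]
  have hσs : σ * s * σ = LinearEquiv.neg F * s := by
    apply ext_of_prod (e := e)
    intro u v
    simp only [LinearEquiv.mul_apply, hσ, hse, LinearEquiv.neg_apply]
    rw [← map_neg]; simp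
  have hσσ : σ * σ = 1 := by
    apply ext_of_prod (e := e)
    intro u v
    simp only [LinearEquiv.mul_apply, hσ]; rfl
  have hneg : ∀ g : V ≃ₗ[F] V, LinearEquiv.neg F * g = g * LinearEquiv.neg F := fun g => by
    ext v; simp
  have hnn : (LinearEquiv.neg F : V ≃ₗ[F] V) * LinearEquiv.neg F = 1 := by ext v; simp
  refine (IH W₁ (B.restrict W₁) x₂ hd1 (fun v => hA v) hB1 hi.1 ho.1).swap (blockHom e)
    (blockHom_injective e) (fun a b => blockHom_mem_isometryCentralizer e hBe x₂ a x₂ b)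
    (fun a ha => blockHom_mem_skewInverters e hBe x₂ a x₂ a ha ha) σ hσσ ⟨fun v w => ?_, ?_⟩ ?_ ?_
    P hPC hP2 hPmax ?_
  · obtain ⟨⟨u, v⟩, rfl⟩ := e.surjective v
    obtain ⟨⟨u', v'⟩, rfl⟩ := e.surjective w
    rw [hσ, hσ, hBe, hBe, add_comm]
  · apply ext_of_prod (e := e)
    intro u v
    simp only [LinearEquiv.mul_apply, hσ, blockHom_apply]
  · rintro ⟨⟨a, b⟩, hab⟩
    apply hs2
    apply ext_of_prod (e := e)
    have h0 : ∀ u : W₁, u = 0 := by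
      intro u
      have := hσ u 0
      rw [← hab, blockHom_apply, map_zero] at this
      exact (congrArg Prod.snd (e.injective this)).symm
    intro u v
    rw [h0 u, h0 v]
    change s (e 0) = -(e 0)
    simp
  · intro a b
    apply ext_of_prod (e := e)
    intro u v
    simp only [LinearEquiv.mul_apply, hσ, blockHom_apply]
  · intro g hg
    rcases hc g hg with h | h
    · exact Or.inl (mem_range_blockHom h2 e s hse g h)
    · right
      refine mem_range_blockHom h2 e s hse _ ?_
      have h3 : σ * s = LinearEquiv.neg F * s * σ := by
        rw [← hσs, mul_assoc, hσσ, mul_one]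
      calc g * σ * s = g * LinearEquiv.neg F * s * σ := by
            rw [mul_assoc, h3, ← mul_assoc, ← mul_assoc]
        _ = LinearEquiv.neg F * (g * s) * σ := by rw [← hneg, mul_assoc (LinearEquiv.neg F) g s]
        _ = s * (g * σ) := by
            rw [h, mul_assoc _ s g, ← mul_assoc _ _ (s * g), hnn, one_mul, mul_assoc]

end

section

open scoped Classical
universe u
variable {F : Type*} [Field F]

theorem mem_of_isPGroup_max {Γ : Type*} [Group Γ] [Finite Γ] {C P : Subgroup Γ} (hPC : P ≤ C)
    (hP2 : IsPGroup 2 P)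
    (hPmax : ∀ Q : Subgroup Γ, Q ≤ C → IsPGroup 2 Q → Nat.card Q ≤ Nat.card P) (z : Γ) (hzC : z ∈ C)
    (hz : ∀ g, g * z = z * g) (hz2 : z * z = 1) : z ∈ P := by
  have hZ2 : IsPGroup 2 (Subgroup.zpowers z) := by
    have ho : orderOf z ∣ 2 ^ 1 := orderOf_dvd_of_pow_eq_one (by rw [pow_one, pow_two, hz2])
    obtain ⟨k, -, hk⟩ := (Nat.dvd_prime_pow Nat.prime_two).1 ho
    exact IsPGroup.of_card (n := k) (by rw [Nat.card_zpowers, hk])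
  haveI : (Subgroup.zpowers z).Normal := by
    refine ⟨fun g hg h => ?_⟩
    obtain ⟨k, rfl⟩ := hg
    have : Commute h (z ^ k) := (show Commute h z from hz h).zpow_right k
    beta_reduce
    rw [this.eq, mul_assoc, mul_inv_cancel, mul_one]
    exact ⟨k, rfl⟩
  have hle := hPmax (P ⊔ Subgroup.zpowers z)
    (sup_le hPC ((Subgroup.zpowers_le).2 hzC)) (hP2.to_sup_of_normal_right hZ2)
  have := Subgroup.eq_of_le_of_card_ge le_sup_left hle
  rw [this]
  exact (le_sup_right : _ ≤ P ⊔ Subgroup.zpowers z) (Subgroup.mem_zpowers z)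

/-- In the symplectic similitude group, the centralizer of every isometry of odd order has a
maximal `2`-subgroup normalized by a skew-isometry inverting the given isometry, such that the
associated square family is positive semidefinite. -/
theorem hasPosTwist_isometryCentralizer (h2 : (2 : F) ≠ 0) (n : ℕ) :
    HasPosTwistBelow.{u} F n := by
  induction n with
  | zero => intro W _ _ _ _ B x h; exact absurd h (Nat.not_lt_zero _)
  | succ n ih =>
    intro V _ _ _ _ B x hn hA hB hx hodd
    rcases Nat.lt_succ_iff_lt_or_eq.1 hn with h | rfl
    · exact ih V B x h hA hB hx hodd
    haveI : Module.Finite F V := Module.Finite.of_finite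
    obtain ⟨P, hPC, hP2, hPmax⟩ := exists_max_two_subgroup (isometryCentralizer B x)
    rcases subsingleton_or_nontrivial V with hV | hV
    · haveI : Subsingleton (V ≃ₗ[F] V) := ⟨fun a b => LinearEquiv.ext fun v => Subsingleton.elim _ _⟩
      refine HasPosTwist.of_cyclic P hPC hP2 hPmax 1 P.one_mem ?_ ?_ 1 ?_ (one_mul 1)
        (Subsingleton.elim _ _) ?_
      · intro p _ g hg
        rwa [Subsingleton.elim (p * g * p⁻¹) g]
      · rw [Nat.card_zpowers, orderOf_one, Nat.card_unique]; norm_num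
      · refine ⟨fun v w => ?_, Subsingleton.elim _ _⟩
        rw [Subsingleton.elim v 0]; simp
      · intro g hg
        rwa [Subsingleton.elim (1 * g * 1⁻¹) g]
    have hneg : ∀ g : V ≃ₗ[F] V, g * LinearEquiv.neg F = LinearEquiv.neg F * g := fun g => by
      ext v; simp
    have hnn : (LinearEquiv.neg F : V ≃ₗ[F] V) * LinearEquiv.neg F = 1 := by ext v; simp
    have hnP : LinearEquiv.neg F ∈ P := mem_of_isPGroup_max hPC hP2 hPmax _
      ⟨fun v w => by simp, (hneg x).symm⟩ hneg hnn
    have hn1 : (⟨LinearEquiv.neg F, hnP⟩ : P) ≠ 1 := by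
      intro h
      obtain ⟨v, hv⟩ := exists_ne (0 : V)
      have h3 : -v = v := congrArg (fun g : P => (g : V ≃ₗ[F] V) v) h
      have h4 : (2 : F) • v = 0 := by rw [two_smul]; nth_rewrite 1 [← h3]; simp
      exact hv ((smul_eq_zero.1 h4).resolve_left h2)
    rcases IsPGroup.exists_involution_or_cyclic hP2 ⟨LinearEquiv.neg F, hnP⟩
      (fun g => Subtype.ext (hneg g)) (Subtype.ext hnn) hn1 with ⟨s, hs, hs1, hsz, hc⟩ | ⟨a, ha, hi⟩
    · have hs' : (s : V ≃ₗ[F] V) * s = 1 := congrArg Subtype.val hs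
      have hs1' : (s : V ≃ₗ[F] V) ≠ 1 := fun h => hs1 (Subtype.ext h)
      have hsz' : (s : V ≃ₗ[F] V) ≠ LinearEquiv.neg F := fun h => hsz (Subtype.ext h)
      have hc' : ∀ g ∈ P, g * (s : V ≃ₗ[F] V) = s * g ∨
          g * (s : V ≃ₗ[F] V) = LinearEquiv.neg F * (s : V ≃ₗ[F] V) * g := by
        intro g hg
        refine (hc ⟨g, hg⟩).imp (fun h => ?_) (fun h => ?_)
        · exact congrArg Subtype.val (mul_inv_eq_iff_eq_mul.1 h)
        · exact congrArg Subtype.val (mul_inv_eq_iff_eq_mul.1 h)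
      by_cases hcc : ∀ g ∈ P, g * (s : V ≃ₗ[F] V) = s * g
      · exact hasPosTwist_of_central_involution h2 ih B hA hB x hx hodd P hPC hP2 hPmax s s.2 hs'
          hs1' hsz' hcc
      · push Not at hcc
        obtain ⟨w, hwP, hw⟩ := hcc
        exact hasPosTwist_of_swap h2 ih B hA hB x hx hodd P hPC hP2 hPmax s s.2 hs'
          hs1' hsz' hc' w hwP ((hc' w hwP).resolve_left hw)
    · exact hasPosTwist_of_zpowers h2 B hA hB x hx hodd P hPC hP2 hPmax a ha hi

end

section

open scoped Classical

/-- A nonzero representation without proper nonzero invariant subspaces. -/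
def IsIrr {K V : Type*} [Group K] [AddCommGroup V] [Module ℂ V] (ρ : Representation ℂ K V) : Prop :=
  Nontrivial V ∧ ∀ U : Submodule ℂ V, (∀ k, ∀ v ∈ U, ρ k v ∈ U) → U = ⊥ ∨ U = ⊤

variable {K V : Type*} [Group K] [Fintype K] [AddCommGroup V] [Module ℂ V] [FiniteDimensional ℂ V]
  {ρ : Representation ℂ K V}

theorem IsIrr.exists_eq_smul (h : IsIrr ρ) (M : V →ₗ[ℂ] V) (hM : ∀ k v, M (ρ k v) = ρ k (M v)) :
    ∃ c : ℂ, ∀ v, M v = c • v := by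
  haveI := h.1
  obtain ⟨c, hc⟩ := Module.End.exists_eigenvalue M
  refine ⟨c, fun v => ?_⟩
  rcases h.2 (Module.End.eigenspace M c) (fun k v hv => by
    rw [Module.End.mem_eigenspace_iff] at hv ⊢
    rw [hM, hv, map_smul]) with h0 | h0
  · exact absurd h0 hc
  · exact Module.End.mem_eigenspace_iff.1 (h0 ▸ Submodule.mem_top)

theorem IsIrr.sum_mul (h : IsIrr ρ) (φ ψ : V →ₗ[ℂ] ℂ) (a b : V) :
    ∑ k, φ (ρ k a) * ψ (ρ k⁻¹ b) = (Fintype.card K / Module.finrank ℂ V : ℂ) * (φ b * ψ a) := by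
  haveI := h.1
  let P : V →ₗ[ℂ] V := ∑ k, (ρ k⁻¹) ∘ₗ (φ.smulRight b) ∘ₗ (ρ k)
  have hPv : ∀ v, P v = ∑ k, φ (ρ k v) • ρ k⁻¹ b := fun v => by
    simp [P]
  obtain ⟨c, hc⟩ := h.exists_eq_smul P (fun l v => by
    rw [hPv, hPv, map_sum, ← Equiv.sum_comp (Equiv.mulRight l⁻¹)]
    refine Finset.sum_congr rfl fun k _ => ?_
    rw [map_smul, Equiv.coe_mulRight, mul_inv_rev, inv_inv, map_mul ρ l, Module.End.mul_apply,
      ← Module.End.mul_apply (ρ (k * l⁻¹)), ← map_mul, inv_mul_cancel_right])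
  have htr : c * Module.finrank ℂ V = Fintype.card K * φ b := by
    have h1 : P = c • LinearMap.id := LinearMap.ext hc
    have h2 : LinearMap.trace ℂ V P = c * Module.finrank ℂ V := by
      rw [h1, map_smul, LinearMap.trace_id, smul_eq_mul]
    rw [← h2, map_sum, Finset.sum_congr rfl (g := fun _ => φ b), Finset.sum_const, Finset.card_univ,
      nsmul_eq_mul]
    intro k _
    rw [LinearMap.trace_comp_comm', LinearMap.comp_assoc]
    have : ρ k ∘ₗ ρ k⁻¹ = LinearMap.id := by
      rw [← Module.End.mul_eq_comp, ← map_mul, mul_inv_cancel, map_one]; rfl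
    rw [this, LinearMap.comp_id, LinearMap.trace_smulRight]
  have hd : (Module.finrank ℂ V : ℂ) ≠ 0 := Nat.cast_ne_zero.2 Module.finrank_pos.ne'
  have h3 : ∑ k, φ (ρ k a) * ψ (ρ k⁻¹ b) = ψ (P a) := by
    rw [hPv, map_sum]
    simp only [map_smul, smul_eq_mul]
  rw [h3, hc, map_smul, smul_eq_mul]
  field_simp
  linear_combination ψ a * htr

/-- A twisted form: `B (k v) (τ k w) = B v w` and `B w (z v) = s B v w`. -/
structure IsTwistedForm (ρ : Representation ℂ K V) (τ : K → K) (z : K) (s : ℂ)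
    (B : LinearMap.BilinForm ℂ V) : Prop where
  inv : ∀ k v w, B (ρ k v) (ρ (τ k) w) = B v w
  symm : ∀ v w, B w (ρ z v) = s * B v w

theorem IsIrr.sum_twisted (h : IsIrr ρ) {τ : K ≃ K} {z : K} (hτ : ∀ k, τ (τ k) * z = z * k) {s : ℂ}
    {B : LinearMap.BilinForm ℂ V} (hB : IsTwistedForm ρ τ z s B) (hnd : B.Nondegenerate) (w : V) :
    ∑ k, ρ (k * τ k * z) w = (s * (Fintype.card K / Module.finrank ℂ V : ℂ)) • w := by
  let e := Module.finBasis ℂ V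
  let f := B.dualBasis hnd e
  have hf : ∀ i j, B (f i) (e j) = if j = i then 1 else 0 := fun i j =>
    LinearMap.BilinForm.apply_dualBasis_left hnd e i j
  have hexp : ∀ q, q = ∑ j, B (f j) q • e j := by
    intro q
    apply e.repr.injective
    ext i
    have : ∀ i, B (f i) q = e.repr q i := by
      intro i
      conv_lhs => rw [← e.sum_repr q]
      rw [map_sum]
      simp [hf]
    rw [map_sum, Finsupp.finsetSum_apply]
    simp [this, Finsupp.single_apply]
  have key : ∀ p, B p (∑ k, ρ (k * τ k * z) w) =
      B p ((s * (Fintype.card K / Module.finrank ℂ V : ℂ)) • w) := by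
    intro p
    have h1 : ∀ k, B p (ρ (τ k * τ (τ k) * z) w) = s * B (ρ k w) (ρ k⁻¹ p) := by
      intro k
      rw [mul_assoc, hτ, map_mul, Module.End.mul_apply, map_mul, Module.End.mul_apply, ← hB.symm]
      conv_rhs => rw [← hB.inv k]
      rw [← Module.End.mul_apply (ρ k), ← map_mul, mul_inv_cancel, map_one, Module.End.one_apply]
    rw [map_sum, ← Equiv.sum_comp τ, Finset.sum_congr rfl fun k _ => h1 k, ← Finset.mul_sum, map_smul,
      smul_eq_mul, mul_assoc]
    congr 1
    have h2 : ∀ k, B (ρ k w) (ρ k⁻¹ p) = ∑ j, (B.flip (e j)) (ρ k w) * (B (f j)) (ρ k⁻¹ p) := by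
      intro k
      conv_lhs => rw [hexp (ρ k⁻¹ p)]
      rw [map_sum]
      refine Finset.sum_congr rfl fun j _ => ?_
      rw [map_smul, smul_eq_mul, mul_comm]; rfl
    rw [Finset.sum_congr rfl fun k _ => h2 k, Finset.sum_comm,
      Finset.sum_congr rfl fun j _ => h.sum_mul (B.flip (e j)) (B (f j)) w p, ← Finset.mul_sum]
    congr 1
    conv_rhs => rw [hexp w]
    rw [map_sum]
    refine Finset.sum_congr rfl fun j _ => ?_
    rw [map_smul, smul_eq_mul, mul_comm]; rfl
  have h3 : ∀ v, (∀ p, B p v = 0) → v = 0 := by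
    intro v hv
    rw [hexp v]
    exact Finset.sum_eq_zero fun j _ => by rw [hv, zero_smul]
  rw [← sub_eq_zero]
  apply h3
  intro p
  rw [map_sub, key, sub_self]

/-- Positivity of the family `k ↦ k τ(k) z` of a group. -/
def IsPosTwist (τ : K → K) (z : K) : Prop :=
  ∀ c : K → ℝ, 0 ≤ ∑ h, ∑ g, c g * c (g * (h * τ h * z))

theorem IsIrr.not_isTwistedForm_neg (h : IsIrr ρ) {τ : K ≃ K} {z : K}
    (hτ : ∀ k, τ (τ k) * z = z * k) (hpos : IsPosTwist τ z)
    {B : LinearMap.BilinForm ℂ V} (hB : IsTwistedForm ρ τ z (-1) B) : ¬ B.Nondegenerate := by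
  intro hnd
  haveI := h.1
  set L : ℝ := Fintype.card K / Module.finrank ℂ V with hL
  have hLpos : 0 < L := div_pos (Nat.cast_pos.2 Fintype.card_pos) (Nat.cast_pos.2 Module.finrank_pos)
  have hZ : ∀ w, ∑ k, ρ (k * τ k * z) w = ((-L : ℝ) : ℂ) • w := fun w => by
    rw [h.sum_twisted hτ hB hnd, hL]; push_cast; rw [neg_one_mul]
  obtain ⟨v, hv⟩ := exists_ne (0 : V)
  obtain ⟨φ, hφ⟩ : ∃ φ : V →ₗ[ℂ] ℂ, φ v ≠ 0 := by
    by_contra! hc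
    exact hv ((Module.forall_dual_apply_eq_zero_iff ℂ v).1 hc)
  have hc : ∀ g, ∑ k, φ (ρ (g * (k * τ k * z)) v) = ((-L : ℝ) : ℂ) * φ (ρ g v) := by
    intro g
    rw [← smul_eq_mul, ← map_smul, ← map_smul, ← hZ, map_sum, map_sum]
    simp only [map_mul, Module.End.mul_apply]
  have h1 : ∀ r : ℂ →ₗ[ℝ] ℝ, ∑ k, ∑ g, r (φ (ρ g v)) * r (φ (ρ (g * (k * τ k * z)) v)) =
      -L * ∑ g, (r (φ (ρ g v))) ^ 2 := by
    intro r
    rw [Finset.sum_comm, Finset.mul_sum]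
    refine Finset.sum_congr rfl fun g _ => ?_
    rw [← Finset.mul_sum, ← map_sum, hc, ← Complex.real_smul, map_smul, smul_eq_mul]
    ring
  have h2 : ∀ r : ℂ →ₗ[ℝ] ℝ, r (φ v) = 0 := by
    intro r
    have h3 := hpos fun g => r (φ (ρ g v))
    rw [h1] at h3
    have h4 : ∑ g, (r (φ (ρ g v))) ^ 2 ≤ 0 := by
      by_contra! h5
      nlinarith [mul_pos hLpos h5]
    have h5 : (r (φ (ρ 1 v))) ^ 2 ≤ ∑ g, (r (φ (ρ g v))) ^ 2 :=
      Finset.single_le_sum (f := fun g => (r (φ (ρ g v))) ^ 2) (fun g _ => sq_nonneg _)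
        (Finset.mem_univ 1)
    rw [map_one, Module.End.one_apply] at h5
    exact pow_eq_zero_iff two_ne_zero |>.1 (le_antisymm (h5.trans h4) (sq_nonneg _))
  exact hφ (Complex.ext (h2 Complex.reLm) (h2 Complex.imLm))

end

section

open scoped Classical

variable {K V : Type*} [Group K] [Fintype K] [AddCommGroup V] [Module ℂ V] [FiniteDimensional ℂ V]
  {ρ : Representation ℂ K V}

/-- The characters of finite-dimensional complex representations. -/
def IsRepChar (θ : K → ℂ) : Prop :=
  ∃ (n : ℕ) (σ : Representation ℂ K (Fin n → ℂ)), θ = σ.character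

theorem isRepChar_character (ρ : Representation ℂ K V) : IsRepChar ρ.character := by
  let e : V ≃ₗ[ℂ] (Fin (Module.finrank ℂ V) → ℂ) := (Module.finBasis ℂ V).equivFun
  let σ : Representation ℂ K (Fin (Module.finrank ℂ V) → ℂ) :=
    { toFun k := e.conj (ρ k)
      map_one' := by rw [map_one]; exact e.conj_id
      map_mul' k l := by rw [map_mul]; exact e.conj_comp _ _ }
  exact ⟨_, σ, funext fun k => (LinearMap.trace_conj' (ρ k) e).symm⟩

theorem IsRepChar.mul {θ η : K → ℂ} (h : IsRepChar θ) (h' : IsRepChar η) :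
    IsRepChar (fun k => θ k * η k) := by
  obtain ⟨n, σ, rfl⟩ := h
  obtain ⟨m, σ', rfl⟩ := h'
  have := isRepChar_character (σ.tprod σ')
  rwa [Representation.char_tensor] at this

theorem IsRepChar.pow {θ : K → ℂ} (h : IsRepChar θ) (e : ℕ) : IsRepChar (fun k => θ k ^ e) := by
  induction e with
  | zero =>
    have := isRepChar_character (Representation.trivial ℂ K ℂ)
    convert this using 1
    ext k
    simp [Representation.character]
  | succ e ih =>
    simp only [pow_succ]
    exact ih.mul h

theorem IsRepChar.comp {L : Type*} [Group L] [Fintype L] {θ : K → ℂ} (h : IsRepChar θ) (f : L →* K) :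
    IsRepChar (fun l => θ (f l)) := by
  obtain ⟨n, σ, rfl⟩ := h
  exact ⟨n, σ.comp f, rfl⟩

theorem IsRepChar.dual {θ : K → ℂ} (h : IsRepChar θ) : IsRepChar (fun k => θ k⁻¹) := by
  obtain ⟨n, σ, rfl⟩ := h
  have := isRepChar_character σ.dual
  convert this using 1
  ext k
  rw [Representation.char_dual]

theorem exists_isCompl_invariant (U : Submodule ℂ V) (hU : ∀ k, ∀ v ∈ U, ρ k v ∈ U) :
    ∃ Y : Submodule ℂ V, (∀ k, ∀ v ∈ Y, ρ k v ∈ Y) ∧ IsCompl U Y := by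
  haveI : NeZero (Nat.card K : ℂ) := ⟨Nat.cast_ne_zero.2 Nat.card_pos.ne'⟩
  haveI : ComplementedLattice (Subrepresentation ρ) :=
    (Representation.isSemisimpleRepresentation_iff_isSemisimpleModule_asModule ρ).2 inferInstance
  obtain ⟨Y, hY⟩ := exists_isCompl (⟨U, fun k v hv => hU k v hv⟩ : Subrepresentation ρ)
  refine ⟨Y.toSubmodule, fun k v hv => Y.apply_mem_toSubmodule k hv, ?_, ?_⟩
  · rw [disjoint_iff]
    exact congrArg Subrepresentation.toSubmodule (disjoint_iff.1 hY.1)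
  · rw [codisjoint_iff]
    exact congrArg Subrepresentation.toSubmodule (codisjoint_iff.1 hY.2)

theorem exists_minimal_invariant (U : Submodule ℂ V) (hU : ∀ k, ∀ v ∈ U, ρ k v ∈ U) (h0 : U ≠ ⊥) :
    ∃ W ≤ U, W ≠ ⊥ ∧ (∀ k, ∀ v ∈ W, ρ k v ∈ W) ∧
      ∀ X ≤ W, (∀ k, ∀ v ∈ X, ρ k v ∈ X) → X = ⊥ ∨ X = W := by
  let S : Set (Submodule ℂ V) := {W | W ≤ U ∧ W ≠ ⊥ ∧ ∀ k, ∀ v ∈ W, ρ k v ∈ W}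
  obtain ⟨W, ⟨hWU, hW0, hWi⟩, hmin⟩ := WellFounded.has_min
    (measure fun W : Submodule ℂ V => Module.finrank ℂ W).wf S ⟨U, le_rfl, h0, hU⟩
  refine ⟨W, hWU, hW0, hWi, fun X hX hXi => ?_⟩
  by_cases hX0 : X = ⊥
  · exact Or.inl hX0
  · have := hmin X ⟨hX.trans hWU, hX0, hXi⟩
    exact Or.inr (Submodule.eq_of_le_of_finrank_le hX (not_lt.1 this))

/-- The restriction of a representation to an invariant subspace. -/
def subRep (ρ : Representation ℂ K V) (U : Submodule ℂ V) (hU : ∀ k, ∀ v ∈ U, ρ k v ∈ U) :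
    Representation ℂ K U where
  toFun k := (ρ k).restrict (hU k)
  map_one' := by ext; simp
  map_mul' x y := by ext; simp

theorem subRep_apply (U : Submodule ℂ V) (hU : ∀ k, ∀ v ∈ U, ρ k v ∈ U) (k : K) (v : U) :
    (subRep ρ U hU k v : V) = ρ k v := rfl

theorem character_eq_add_of_isCompl {U Y : Submodule ℂ V} (hU : ∀ k, ∀ v ∈ U, ρ k v ∈ U)
    (hY : ∀ k, ∀ v ∈ Y, ρ k v ∈ Y) (h : IsCompl U Y) (k : K) :
    ρ.character k = (subRep ρ U hU).character k + (subRep ρ Y hY).character k := by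
  unfold Representation.character
  rw [← LinearMap.trace_prodMap', ← LinearMap.trace_conj' _ (U.prodEquivOfIsCompl Y h)]
  congr 1
  ext v
  obtain ⟨⟨a, b⟩, rfl⟩ := (U.prodEquivOfIsCompl Y h).surjective v
  simp [LinearEquiv.conj_apply, subRep_apply]

theorem irr_subRep {W : Submodule ℂ V} (hW0 : W ≠ ⊥) (hW : ∀ k, ∀ v ∈ W, ρ k v ∈ W)
    (hmin : ∀ X ≤ W, (∀ k, ∀ v ∈ X, ρ k v ∈ X) → X = ⊥ ∨ X = W) : IsIrr (subRep ρ W hW) := by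
  refine ⟨Submodule.nontrivial_iff_ne_bot.2 hW0, fun U hU => ?_⟩
  rcases hmin (U.map W.subtype) (Submodule.map_subtype_le W U) (by
    rintro k _ ⟨v, hv, rfl⟩
    exact ⟨_, hU k v hv, rfl⟩) with h | h
  · exact Or.inl (Submodule.map_injective_of_injective W.injective_subtype (h.trans (Submodule.map_bot _).symm))
  · right
    rw [eq_top_iff]
    intro v _
    have : (v : V) ∈ U.map W.subtype := by rw [h]; exact v.2
    obtain ⟨u, hu, huv⟩ := this
    rwa [← Subtype.ext huv]

variable {τ : K ≃ K} {z : K} {s : ℂ} {B : LinearMap.BilinForm ℂ V}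

theorem IsTwistedForm.inv' (hB : IsTwistedForm ρ τ z s B) (k : K) (v w : V) :
    B v (ρ (τ k) w) = B (ρ k⁻¹ v) w := by
  rw [← hB.inv k (ρ k⁻¹ v) w, ← Module.End.mul_apply, ← map_mul, mul_inv_cancel, map_one,
    Module.End.one_apply]

theorem IsTwistedForm.eq_zero_symm (hB : IsTwistedForm ρ τ z s B) {U W : Submodule ℂ V}
    (hU : ∀ k, ∀ v ∈ U, ρ k v ∈ U) (hs : s ≠ 0) (h : ∀ u ∈ U, ∀ w ∈ W, B w u = 0) :
    ∀ u ∈ U, ∀ w ∈ W, B u w = 0 := by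
  intro u hu w hw
  have := hB.symm u w
  rw [h _ (hU z u hu) w hw] at this
  exact (mul_eq_zero.1 this.symm).resolve_left hs

theorem IsTwistedForm.isotropic_of_minimal (hτ : ∀ k, τ (τ k) * z = z * k) (hpos : IsPosTwist τ z)
    (hB : IsTwistedForm ρ τ z (-1) B) {W : Submodule ℂ V} (hW0 : W ≠ ⊥)
    (hW : ∀ k, ∀ v ∈ W, ρ k v ∈ W)
    (hmin : ∀ X ≤ W, (∀ k, ∀ v ∈ X, ρ k v ∈ X) → X = ⊥ ∨ X = W) :
    ∀ v ∈ W, ∀ w ∈ W, B v w = 0 := by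
  let R : Submodule ℂ V :=
    { carrier := {v | v ∈ W ∧ ∀ w ∈ W, B v w = 0}
      zero_mem' := ⟨W.zero_mem, by simp⟩
      add_mem' := fun {a b} ha hb => ⟨W.add_mem ha.1 hb.1, fun w hw => by
        rw [map_add, LinearMap.add_apply, ha.2 w hw, hb.2 w hw, add_zero]⟩
      smul_mem' := fun c {a} ha => ⟨W.smul_mem c ha.1, fun w hw => by
        rw [map_smul, LinearMap.smul_apply, ha.2 w hw, smul_zero]⟩ }
  rcases hmin R (fun v hv => hv.1) (fun k v hv => ⟨hW k v hv.1, fun w hw => by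
    have := hB.inv' k⁻¹ v w
    rw [inv_inv] at this
    rw [← this]
    exact hv.2 _ (hW _ _ hw)⟩) with h | h
  · exfalso
    have hirr := irr_subRep hW0 hW hmin
    have hB' : IsTwistedForm (subRep ρ W hW) τ z (-1) (B.restrict W) :=
      ⟨fun k v w => hB.inv k v w, fun v w => hB.symm v w⟩
    refine hirr.not_isTwistedForm_neg hτ hpos hB' (LinearMap.BilinForm.Nondegenerate.ofSeparatingLeft ?_)
    intro v hv
    have : (v : V) ∈ R := ⟨v.2, fun w hw => hv ⟨w, hw⟩⟩
    rw [h, Submodule.mem_bot] at this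
    exact Subtype.ext this
  · intro v hv
    have : v ∈ R := h ▸ hv
    exact this.2

/-- In the absence of irreducible representations with a skew twisted form, the character of a
representation with a skew twisted form is a sum of a character and its twisted dual. -/
theorem IsTwistedForm.exists_isRepChar (hτ : ∀ k, τ (τ k) * z = z * k) (hpos : IsPosTwist τ z)
    (hB : IsTwistedForm ρ τ z (-1) B) (hnd : B.Nondegenerate) :
    ∃ θ : K → ℂ, IsRepChar θ ∧ ∀ k, ρ.character (τ k) = θ (τ k) + θ k⁻¹ := by
  let S : Set (Submodule ℂ V) := {U | (∀ k, ∀ v ∈ U, ρ k v ∈ U) ∧ ∀ v ∈ U, ∀ w ∈ U, B v w = 0}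
  obtain ⟨U, ⟨hU, hUiso⟩, hmax⟩ := WellFounded.has_min
    (measure fun W : Submodule ℂ V => Module.finrank ℂ V - Module.finrank ℂ W).wf S
    ⟨⊥, by simp [S]⟩
  obtain ⟨Y, hY, hUY⟩ := exists_isCompl_invariant U hU
  -- The orthogonal of `U`, intersected with `Y`.
  let X : Submodule ℂ V :=
    { carrier := {v | v ∈ Y ∧ ∀ u ∈ U, B u v = 0}
      zero_mem' := ⟨Y.zero_mem, by simp⟩
      add_mem' := fun {a b} ha hb => ⟨Y.add_mem ha.1 hb.1, fun w hw => by
        rw [map_add, ha.2 w hw, hb.2 w hw, add_zero]⟩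
      smul_mem' := fun c {a} ha => ⟨Y.smul_mem c ha.1, fun w hw => by
        rw [map_smul, ha.2 w hw, smul_zero]⟩ }
  have hXi : ∀ k, ∀ v ∈ X, ρ k v ∈ X := by
    intro k v hv
    refine ⟨hY k v hv.1, fun u hu => ?_⟩
    obtain ⟨l, rfl⟩ := τ.surjective k
    rw [hB.inv']
    exact hv.2 _ (hU _ _ hu)
  have hX : X = ⊥ := by
    by_contra hX0
    obtain ⟨W, hWX, hW0, hWi, hWmin⟩ := exists_minimal_invariant X hXi hX0
    have hWiso := hB.isotropic_of_minimal hτ hpos hW0 hWi hWmin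
    have hUW : ∀ u ∈ U, ∀ w ∈ W, B u w = 0 := fun u hu w hw => (hWX hw).2 u hu
    have hWU := hB.eq_zero_symm hWi (by norm_num) (fun w hw u hu => hUW u hu w hw)
    have hdisj : Disjoint U W := hUY.1.mono_right fun w hw => (hWX hw).1
    refine hmax (U ⊔ W) ⟨?_, ?_⟩ ?_
    · intro k v hv
      obtain ⟨a, ha, b, hb, rfl⟩ := Submodule.mem_sup.1 hv
      rw [map_add]
      exact Submodule.add_mem_sup (hU k a ha) (hWi k b hb)
    · intro v hv w hw
      obtain ⟨a, ha, b, hb, rfl⟩ := Submodule.mem_sup.1 hv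
      obtain ⟨c, hc, d, hd, rfl⟩ := Submodule.mem_sup.1 hw
      rw [map_add, map_add, LinearMap.add_apply, LinearMap.add_apply, hUiso a ha c hc,
        hUW a ha d hd, hWU b hb c hc, hWiso b hb d hd]
      simp
    · have h1 := Submodule.finrank_sup_add_finrank_inf_eq U W
      rw [hdisj.eq_bot, finrank_bot] at h1
      have h2 : 0 < Module.finrank ℂ W := Module.finrank_pos_iff.2 (Submodule.nontrivial_iff_ne_bot.2 hW0)
      have h3 := Submodule.finrank_le (U ⊔ W)
      change Module.finrank ℂ V - Module.finrank ℂ ↥(U ⊔ W) < Module.finrank ℂ V - Module.finrank ℂ U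
      omega
  let f : Y →ₗ[ℂ] Module.Dual ℂ U := (LinearMap.lcomp ℂ ℂ U.subtype) ∘ₗ B.flip ∘ₗ Y.subtype
  have hf : ∀ y u, f y u = B u y := fun _ _ => rfl
  have hfinj : Function.Injective f := by
    rw [← LinearMap.ker_eq_bot, eq_bot_iff]
    intro y hy
    have : (y : V) ∈ X := ⟨y.2, fun u hu => LinearMap.congr_fun (LinearMap.mem_ker.1 hy) ⟨u, hu⟩⟩
    rw [hX, Submodule.mem_bot] at this
    exact Subtype.ext this
  have hfsurj : Function.Surjective f := by
    have h1 : Function.Injective B.flip := by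
      rw [injective_iff_map_eq_zero]
      exact fun v hv => hnd.2 v fun w => LinearMap.congr_fun hv w
    have h2 : Function.Surjective B.flip :=
      (LinearMap.injective_iff_surjective_of_finrank_eq_finrank Subspace.dual_finrank_eq.symm).1 h1
    intro φ
    obtain ⟨φ', hφ'⟩ := LinearMap.exists_extend φ
    obtain ⟨v, hv⟩ := h2 φ'
    obtain ⟨a, ha, y, hy, rfl⟩ := Submodule.mem_sup.1 (hUY.sup_eq_top ▸ Submodule.mem_top (x := v))
    refine ⟨⟨y, hy⟩, ?_⟩
    ext u
    rw [hf, ← hφ', ← hv]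
    change B u y = B u (a + y)
    rw [map_add, hUiso u u.2 a ha, zero_add]
  refine ⟨(subRep ρ U hU).character, isRepChar_character _, fun k => ?_⟩
  rw [character_eq_add_of_isCompl hU hY hUY, ← Representation.char_dual]
  congr 1
  unfold Representation.character
  rw [← LinearMap.trace_conj' _ (LinearEquiv.ofBijective f ⟨hfinj, hfsurj⟩)]
  congr 1
  ext φ u
  obtain ⟨y, rfl⟩ := (LinearEquiv.ofBijective f ⟨hfinj, hfsurj⟩).surjective φ
  rw [LinearEquiv.conj_apply_apply, LinearEquiv.symm_apply_apply]
  exact hB.inv' k u y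

end

section

open scoped Classical

theorem isIntegral_of_pow_succ_eq {μ : ℂ} {m : ℕ} (hm : 0 < m) (h : μ ^ (m + 1) = μ) : IsIntegral ℤ μ := by
  refine ⟨Polynomial.X ^ (m + 1) - Polynomial.X, ?_, by simp [h]⟩
  apply Polynomial.monic_X_pow_sub
  rw [Polynomial.degree_X]
  exact_mod_cast Nat.succ_lt_succ hm

variable {V : Type*} [AddCommGroup V] [Module ℂ V] [FiniteDimensional ℂ V]

theorem isIntegral_trace_of_pow_succ_eq (N : Module.End ℂ V) {m : ℕ} (hm : 0 < m)
    (h : N ^ (m + 1) = N) : IsIntegral ℤ (LinearMap.trace ℂ V N) := by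
  rw [Module.End.trace_eq_sum_roots_charpoly_of_splits (IsAlgClosed.splits _)]
  refine IsIntegral.multiset_sum fun μ hμ => ?_
  have h1 := (Module.End.hasEigenvalue_iff_isRoot_charpoly N μ).2 (Polynomial.isRoot_of_mem_roots hμ)
  obtain ⟨v, hv⟩ := h1.exists_hasEigenvector
  refine isIntegral_of_pow_succ_eq hm ?_
  have h2 : ∀ k : ℕ, (N ^ k) v = μ ^ k • v := fun k => by
    induction k with
    | zero => simp
    | succ k ih => rw [pow_succ', Module.End.mul_apply, ih, map_smul, hv.apply_eq_smul, smul_smul, pow_succ]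
  have h3 := h2 (m + 1)
  rw [h, hv.apply_eq_smul] at h3
  exact (smul_left_injective ℂ hv.2 h3).symm

/-- Averages of characters over a coset of a subgroup by a central element are integral. -/
theorem IsRepChar.isIntegral_average {K T : Type*} [Group K] [Fintype K] [Group T] [Fintype T]
    {θ : K → ℂ} (h : IsRepChar θ) (f : T →* K) (x : K) (hx : ∀ u, x * f u = f u * x) :
    IsIntegral ℤ ((Fintype.card T : ℂ)⁻¹ * ∑ u, θ (x * f u)) := by
  obtain ⟨n, σ, rfl⟩ := h
  set P : Module.End ℂ (Fin n → ℂ) := (Fintype.card T : ℂ)⁻¹ • ∑ u, σ (f u) with hP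
  have hcard : (Fintype.card T : ℂ) ≠ 0 := Nat.cast_ne_zero.2 Fintype.card_ne_zero
  have hmul : ∀ v, σ (f v) * P = P := fun v => by
    rw [hP, mul_smul_comm, Finset.mul_sum]
    congr 1
    rw [← Equiv.sum_comp (Equiv.mulLeft v) fun u => σ (f u)]
    exact Finset.sum_congr rfl fun u _ => by rw [Equiv.coe_mulLeft, map_mul, map_mul]
  have hPP : IsIdempotentElem P := by
    change P * P = P
    conv_lhs => rw [hP]
    rw [smul_mul_assoc, Finset.sum_mul, Finset.sum_congr rfl fun u _ => hmul u, Finset.sum_const,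
      Finset.card_univ, ← Nat.cast_smul_eq_nsmul ℂ, smul_smul, inv_mul_cancel₀ hcard, one_smul]
  have hcomm : Commute (σ x) P := by
    change σ x * P = P * σ x
    rw [hP, mul_smul_comm, smul_mul_assoc, Finset.mul_sum, Finset.sum_mul]
    congr 1
    exact Finset.sum_congr rfl fun u _ => by rw [← map_mul, hx, map_mul]
  have htr : (Fintype.card T : ℂ)⁻¹ * ∑ u, σ.character (x * f u) = LinearMap.trace ℂ _ (σ x * P) := by
    rw [hP, mul_smul_comm, map_smul, smul_eq_mul, Finset.mul_sum (a := σ x), map_sum]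
    congr 1
    exact Finset.sum_congr rfl fun u _ => by rw [← map_mul]; rfl
  rw [htr]
  refine isIntegral_trace_of_pow_succ_eq _ (orderOf_pos x) ?_
  rw [hcomm.mul_pow, hPP.pow_succ_eq, pow_succ, ← map_pow, pow_orderOf_eq_one, map_one, one_mul]

/-- The number of fixed points is a character. -/
theorem isRepChar_card_fixed {K X : Type*} [Group K] [Fintype K] [Fintype X] [MulAction K X] :
    IsRepChar (fun k : K => (Fintype.card {y : X // k • y = y} : ℂ)) := by
  let σ : Representation ℂ K (X → ℂ) :=
    { toFun k := LinearMap.funLeft ℂ ℂ (fun y => k⁻¹ • y)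
      map_one' := by ext; simp [LinearMap.funLeft_apply]
      map_mul' k l := by ext; simp [LinearMap.funLeft_apply, mul_smul] }
  convert isRepChar_character σ using 1
  ext k
  unfold Representation.character
  rw [LinearMap.trace_eq_matrix_trace ℂ (Pi.basisFun ℂ X), Matrix.trace, Fintype.card_subtype,
    Finset.card_filter, Nat.cast_sum]
  refine Finset.sum_congr rfl fun y _ => ?_
  rw [Matrix.diag_apply, LinearMap.toMatrix_apply]
  simp only [Pi.basisFun_apply, Pi.basisFun_repr]
  change _ = (Pi.single y (1 : ℂ) : X → ℂ) (k⁻¹ • y)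
  rw [Pi.single_apply, inv_smul_eq_iff]
  split_ifs with h1 h2 h2
  · simp
  · exact absurd h1.symm h2
  · exact absurd h2.symm h1
  · simp

end

section

open scoped Classical

variable {C : Type*} [Group C] [Fintype C] (T : Subgroup C)

/-- The number of fixed points of an element on the cosets of a subgroup. -/
noncomputable def fixedCosets (y : C) : ℕ := Fintype.card {c : C ⧸ T // y • c = c}

theorem smul_mk_eq_iff (y c : C) : y • (c : C ⧸ T) = c ↔ c⁻¹ * y * c ∈ T := by
  rw [MulAction.Quotient.smul_coe, eq_comm, QuotientGroup.eq, smul_eq_mul, mul_assoc]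

/-- Elements of `2`-power order. -/
def IsTwoElement (y : C) : Prop := ∃ k : ℕ, y ^ 2 ^ k = 1

theorem IsTwoElement.odd_fixedCosets (hodd : Odd T.index) {y : C} (hy : IsTwoElement y) :
    Odd (fixedCosets T y) := by
  have hp : IsPGroup 2 (Subgroup.zpowers y) := by
    rintro ⟨_, i, rfl⟩
    obtain ⟨k, hk⟩ := hy
    refine ⟨k, Subtype.ext ?_⟩
    change (y ^ i) ^ 2 ^ k = 1
    rw [← zpow_natCast, zpow_comm, zpow_natCast, hk, one_zpow]
  have h1 := hp.card_modEq_card_fixedPoints (C ⧸ T)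
  have h2 : Nat.card (MulAction.fixedPoints (Subgroup.zpowers y) (C ⧸ T)) = fixedCosets T y := by
    rw [Nat.card_eq_fintype_card, fixedCosets]
    refine Fintype.card_congr (Equiv.subtypeEquivRight fun c => ?_)
    constructor
    · intro hc
      exact hc ⟨y, Subgroup.mem_zpowers y⟩
    · rintro hc ⟨z, hz⟩
      have : Subgroup.zpowers y ≤ MulAction.stabilizer C c := by
        rw [Subgroup.zpowers_le]
        exact hc
      exact this hz
  rw [h2] at h1
  rw [Nat.odd_iff] at hodd ⊢
  rw [← hodd]
  exact h1.symm

theorem isTwoElement_of_fixedCosets_ne_zero (hT : IsPGroup 2 T) {y : C} (hy : fixedCosets T y ≠ 0) :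
    IsTwoElement y := by
  obtain ⟨⟨c, hc⟩⟩ := Fintype.card_pos_iff.1 (Nat.pos_of_ne_zero hy)
  obtain ⟨c, rfl⟩ := QuotientGroup.mk_surjective c
  rw [smul_mk_eq_iff] at hc
  obtain ⟨k, hk⟩ := hT ⟨_, hc⟩
  have hk' : (c⁻¹ * y * c) ^ 2 ^ k = 1 := congrArg Subtype.val hk
  refine ⟨k, ?_⟩
  have := conj_pow (i := 2 ^ k) (a := c⁻¹) (b := y)
  rw [inv_inv] at this
  rw [this] at hk'
  have h2 : c * (c⁻¹ * y ^ 2 ^ k * c) * c⁻¹ = c * 1 * c⁻¹ := by rw [hk']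
  simpa [mul_assoc] using h2

theorem fixedCosets_conj (y c : C) : fixedCosets T (c * y * c⁻¹) = fixedCosets T y := by
  refine Fintype.card_congr ((MulAction.toPerm c⁻¹).subtypeEquiv fun q => ?_)
  rw [MulAction.toPerm_apply, mul_smul, mul_smul, smul_eq_iff_eq_inv_smul]

theorem sum_fixedCosets_mul (a : C → ℂ) (ha : ∀ y c, a (c * y * c⁻¹) = a y) :
    ∑ y, (fixedCosets T y : ℂ) * a y = T.index * ∑ u : T, a u := by
  have h1 : ∀ y, (fixedCosets T y : ℂ) * a y = ∑ q : C ⧸ T, if y • q = q then a y else 0 := by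
    intro y
    rw [fixedCosets, Fintype.card_subtype, Finset.card_filter, Nat.cast_sum, Finset.sum_mul]
    exact Finset.sum_congr rfl fun q _ => by split_ifs <;> simp
  rw [Finset.sum_congr rfl fun y _ => h1 y, Finset.sum_comm,
    Finset.sum_congr rfl (g := fun _ => ∑ u : T, a u), Finset.sum_const, Finset.card_univ, nsmul_eq_mul,
    ← Nat.card_eq_fintype_card]
  · rfl
  · intro q _
    obtain ⟨c, rfl⟩ := QuotientGroup.mk_surjective q
    rw [← Equiv.sum_comp (MulAut.conj c).toEquiv]
    simp only [smul_mk_eq_iff]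
    rw [← Finset.sum_subtype (Finset.univ.filter (fun y => y ∈ T)) (fun x => by simp) a, Finset.sum_filter]
    refine Finset.sum_congr rfl fun y _ => ?_
    have : (MulAut.conj c).toEquiv y = c * y * c⁻¹ := rfl
    rw [this, ha]
    congr 2
    group

theorem isIntegral_sum_twoElements (hT : IsPGroup 2 T) (hodd : Odd T.index) (a : C → ℂ)
    (ha : ∀ y c, a (c * y * c⁻¹) = a y) (hint : ∀ y, IsIntegral ℤ (a y))
    (h : ∀ e : ℕ, IsIntegral ℤ ((2 * Nat.card T : ℂ)⁻¹ * ∑ u : T, (fixedCosets T u : ℂ) ^ e * a u)) :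
    IsIntegral ℤ ((2 * Nat.card T : ℂ)⁻¹ * ∑ y ∈ Finset.univ.filter (fun y : C => IsTwoElement y), a y) := by
  set D : ℕ := 2 * Nat.card T with hD
  have hDpos : 0 < D := Nat.mul_pos two_pos Nat.card_pos
  have hDc : (2 * Nat.card T : ℂ) = D := by rw [hD]; push_cast; rfl
  have hD0 : (D : ℂ) ≠ 0 := Nat.cast_ne_zero.2 hDpos.ne'
  obtain ⟨t, ht⟩ := IsPGroup.iff_card.1 hT
  obtain ⟨e, he⟩ : ∃ e, D.totient = e + 1 := ⟨_, (Nat.succ_pred_eq_of_pos (Nat.totient_pos.2 hDpos)).symm⟩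
  have hm : ∀ y : C, ∃ m : ℤ, IsTwoElement y → ((fixedCosets T y : ℂ) ^ (e + 1)) = 1 + D * m := by
    intro y
    by_cases hy : IsTwoElement y
    · have h1 : (fixedCosets T y).Coprime D := by
        rw [hD, ht, ← pow_succ']
        exact (Nat.Coprime.pow_right _ (Nat.coprime_two_right.2 (hy.odd_fixedCosets T hodd)))
      have h2 := Nat.ModEq.pow_totient h1
      rw [he] at h2
      obtain ⟨m, hm⟩ := (Nat.modEq_iff_dvd.1 h2.symm)
      refine ⟨m, fun _ => ?_⟩
      have h3 : ((fixedCosets T y ^ (e + 1) : ℕ) : ℤ) = 1 + D * m := by push_cast at hm ⊢; linarith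
      exact_mod_cast congrArg (Int.cast (R := ℂ)) h3
    · exact ⟨0, fun h => absurd h hy⟩
  choose m hm using hm
  have key : ∑ y ∈ Finset.univ.filter (fun y : C => IsTwoElement y), a y =
      T.index * ∑ u : T, (fixedCosets T u : ℂ) ^ e * a u -
        D * ∑ y ∈ Finset.univ.filter (fun y : C => IsTwoElement y), m y * a y := by
    rw [← sum_fixedCosets_mul T (fun y => (fixedCosets T y : ℂ) ^ e * a y) (fun y c => by
      rw [fixedCosets_conj, ha]), Finset.mul_sum, Finset.sum_filter, Finset.sum_filter,
      ← Finset.sum_sub_distrib]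
    refine Finset.sum_congr rfl fun y _ => ?_
    split_ifs with hy
    · rw [← mul_assoc, ← pow_succ', hm y hy]
      ring
    · have : fixedCosets T y = 0 := by
        by_contra h0
        exact hy (isTwoElement_of_fixedCosets_ne_zero T hT h0)
      simp [this]
  rw [hDc] at h ⊢
  have : (D : ℂ)⁻¹ * ∑ y ∈ Finset.univ.filter (fun y : C => IsTwoElement y), a y =
      T.index * ((D : ℂ)⁻¹ * ∑ u : T, (fixedCosets T u : ℂ) ^ e * a u) -
        ∑ y ∈ Finset.univ.filter (fun y : C => IsTwoElement y), m y * a y := by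
    rw [key]
    field_simp
  rw [this]
  refine ((isIntegral_natCast _).mul (h e)).sub (IsIntegral.sum _ fun y _ => ?_)
  exact (isIntegral_intCast _).mul (hint y)

end

section

open scoped Classical

/-- A `2`-subgroup `T` of odd index in the centralizer of `x`, with an element `g` inverting `x`,
normalizing `T`, with `g² z ∈ T`, such that the family `h g h g z` for `h ∈ T` is positive. -/
structure IsPosInverter {G : Type*} [Group G] [Fintype G] (z x : G) (T : Subgroup G) (g : G) : Prop where
  comm : ∀ u ∈ T, x * u = u * x
  isPGroup : IsPGroup 2 T
  odd_index : Odd (T.subgroupOf (Subgroup.centralizer {x})).index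
  inv : g * x * g⁻¹ = x⁻¹
  conj_mem : ∀ u ∈ T, g * u * g⁻¹ ∈ T
  sq_mem : g * g * z ∈ T
  pos : ∀ c : G → ℝ, 0 ≤ ∑ h : T, ∑ k : G, c k * c (k * (h * g * (h * g) * z))

namespace IsPosInverter

variable {G : Type*} [Group G] [Fintype G] {z x : G} {T : Subgroup G} {g : G}

theorem mem (h : IsPosInverter z x T g) {u : G} (hu : u ∈ T) : u * g * (u * g) * z ∈ T := by
  have : u * g * (u * g) * z = u * (g * u * g⁻¹) * (g * g * z) := by group
  rw [this]
  exact T.mul_mem (T.mul_mem hu (h.conj_mem u hu)) h.sq_mem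

theorem pos_subgroup (h : IsPosInverter z x T g) (c : T → ℝ) :
    0 ≤ ∑ u : T, ∑ v : T, c v * c (v * ⟨u * g * (u * g) * z, h.mem u.2⟩) := by
  refine (h.pos fun k => if hk : k ∈ T then c ⟨k, hk⟩ else 0).trans_eq ?_
  refine Finset.sum_congr rfl fun u _ => ?_
  rw [← Finset.sum_subset (Finset.filter_subset (fun k => k ∈ T) Finset.univ)
    (fun k _ hk => by
      have hk : k ∉ T := fun h => hk (Finset.mem_filter.2 ⟨Finset.mem_univ _, h⟩)
      rw [dif_neg hk, zero_mul]),
    Finset.sum_subtype (Finset.univ.filter (fun k => k ∈ T)) (p := fun k => k ∈ T) (fun k => by simp)]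
  refine Finset.sum_congr rfl fun v _ => ?_
  rw [dif_pos v.2, dif_pos (T.mul_mem v.2 (h.mem u.2))]
  rfl

theorem conj_bijective (h : IsPosInverter z x T g) :
    Function.Bijective (fun u : T => (⟨g * u * g⁻¹, h.conj_mem u u.2⟩ : T)) := by
  apply Finite.injective_iff_bijective.1
  intro u v huv
  have : g * u * g⁻¹ = g * v * g⁻¹ := congrArg Subtype.val huv
  exact Subtype.ext (by simpa using this)

/-- Conjugation by `g` on `⟨x⟩ × T`. -/
noncomputable def twist (h : IsPosInverter z x T g) : Subgroup.zpowers x × T ≃ Subgroup.zpowers x × T :=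
  (Equiv.inv _).prodCongr (Equiv.ofBijective _ h.conj_bijective)

/-- Multiplication `⟨x⟩ × T → G`. -/
def mulHom (h : IsPosInverter z x T g) : Subgroup.zpowers x × T →* G :=
  MonoidHom.noncommCoprod (Subgroup.zpowers x).subtype T.subtype (by
    rintro ⟨_, i, rfl⟩ ⟨u, hu⟩
    exact (show Commute x u from h.comm u hu).zpow_left i)

theorem mulHom_apply (h : IsPosInverter z x T g) (k) : h.mulHom k = k.1 * k.2 := rfl

theorem mulHom_twist (h : IsPosInverter z x T g) (k) : h.mulHom (h.twist k) = g * h.mulHom k * g⁻¹ := by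
  obtain ⟨⟨_, i, rfl⟩, u⟩ := k
  rw [mulHom_apply, mulHom_apply]
  change (x ^ i)⁻¹ * (g * u * g⁻¹) = g * (x ^ i * u) * g⁻¹
  have : g * x ^ i * g⁻¹ = (x ^ i)⁻¹ := by rw [← conj_zpow, h.inv, inv_zpow]
  rw [← this]
  group

/-- The element `g² z` of `T`, in `⟨x⟩ × T`. -/
def square (h : IsPosInverter z x T g) : Subgroup.zpowers x × T := (1, ⟨g * g * z, h.sq_mem⟩)

theorem twist_twist (h : IsPosInverter z x T g) (hz : ∀ k, z * k = k * z) (k) :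
    h.twist (h.twist k) * h.square = h.square * k := by
  obtain ⟨a, u⟩ := k
  refine Prod.ext ?_ (Subtype.ext ?_)
  · change a⁻¹⁻¹ * 1 = 1 * a
    simp
  · change g * (g * u * g⁻¹) * g⁻¹ * (g * g * z) = g * g * z * u
    rw [mul_assoc (g * g) z, hz]
    group

theorem isPosTwist (h : IsPosInverter z x T g) : IsPosTwist h.twist h.square := by
  intro c
  have h1 : ∀ a : Subgroup.zpowers x, ∀ u : T,
      (a, u) * h.twist (a, u) * h.square = (1, ⟨u * g * (u * g) * z, h.mem u.2⟩) := by
    intro a u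
    refine Prod.ext ?_ (Subtype.ext ?_)
    · change a * a⁻¹ * 1 = 1
      simp
    · change u * (g * u * g⁻¹) * (g * g * z) = u * g * (u * g) * z
      group
  rw [Fintype.sum_prod_type]
  refine Finset.sum_nonneg fun a _ => ?_
  simp only [h1, Fintype.sum_prod_type, Prod.mk_mul_mk, mul_one]
  rw [Finset.sum_comm]
  exact Finset.sum_nonneg fun b _ => h.pos_subgroup fun u => c (b, u)

variable {V : Type*} [AddCommGroup V] [Module ℂ V] [FiniteDimensional ℂ V] {ρ : Representation ℂ G V}

theorem exists_isRepChar (h : IsPosInverter z x T g) (hz : ∀ k, z * k = k * z)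
    {B : LinearMap.BilinForm ℂ V} (hB : IsTwistedForm ρ id z (-1) B) (hnd : B.Nondegenerate) :
    ∃ ψ : Subgroup.zpowers x × T → ℂ, IsRepChar ψ ∧
      ∀ k, ρ.character (h.mulHom k) = ψ k + ψ (h.twist k)⁻¹ := by
  have hinv : ∀ k v w, B (ρ k v) w = B v (ρ k⁻¹ w) := fun k v w => by
    have := hB.inv k v (ρ k⁻¹ w)
    rwa [id, ← Module.End.mul_apply, ← map_mul, mul_inv_cancel, map_one, Module.End.one_apply] at this
  have hB' : IsTwistedForm (ρ.comp h.mulHom) h.twist h.square (-1) (B.compRight (ρ g⁻¹)) := by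
    refine ⟨fun k v w => ?_, fun v w => ?_⟩
    · change B (ρ (h.mulHom k) v) (ρ g⁻¹ (ρ (h.mulHom (h.twist k)) w)) = B v (ρ g⁻¹ w)
      rw [hinv, h.mulHom_twist, ← Module.End.mul_apply, ← map_mul, ← Module.End.mul_apply, ← map_mul]
      congr 3
      group
    · change B w (ρ g⁻¹ (ρ (1 * (g * g * z)) v)) = -1 * B v (ρ g⁻¹ w)
      have h1 : ρ g⁻¹ (ρ (1 * (g * g * z)) v) = ρ z (ρ g v) := by
        rw [← Module.End.mul_apply, ← map_mul, ← Module.End.mul_apply, ← map_mul, hz]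
        congr 2
        group
      rw [h1, hB.symm, hinv]
  have hnd' : (B.compRight (ρ g⁻¹)).Nondegenerate := by
    refine LinearMap.BilinForm.Nondegenerate.ofSeparatingLeft fun v hv => hnd.1 v fun w => ?_
    have := hv (ρ g w)
    change B v (ρ g⁻¹ (ρ g w)) = 0 at this
    rwa [← Module.End.mul_apply, ← map_mul, inv_mul_cancel, map_one, Module.End.one_apply] at this
  obtain ⟨θ, hθ, h2⟩ := hB'.exists_isRepChar (h.twist_twist hz) h.isPosTwist hnd'
  refine ⟨fun k => θ k⁻¹, hθ.dual, fun k => ?_⟩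
  have h3 : ρ.character (h.mulHom k) = ρ.character (h.mulHom (h.twist k)) := by
    rw [mulHom_twist, Representation.char_conj]
  beta_reduce
  rw [h3, inv_inv, add_comm]
  exact h2 k

end IsPosInverter
end

section

open scoped Classical

theorem fixedCosets_inv {C : Type*} [Group C] [Fintype C] (T : Subgroup C) (y : C) :
    fixedCosets T y⁻¹ = fixedCosets T y := by
  refine Fintype.card_congr (Equiv.subtypeEquivRight fun q => ?_)
  rw [inv_smul_eq_iff, eq_comm]

theorem fixedCosets_mulEquiv {C : Type*} [Group C] [Fintype C] (T : Subgroup C) (φ : C ≃* C)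
    (hφ : ∀ c, φ c ∈ T ↔ c ∈ T) (y : C) : fixedCosets T (φ y) = fixedCosets T y := by
  let e : C ⧸ T ≃ C ⧸ T := Quotient.congr φ.toEquiv fun a b => by
    change QuotientGroup.leftRel T a b ↔ QuotientGroup.leftRel T (φ a) (φ b)
    rw [QuotientGroup.leftRel_apply, QuotientGroup.leftRel_apply, ← hφ, map_mul, map_inv]
  have he : ∀ c : C, e (c : C ⧸ T) = ((φ c : C) : C ⧸ T) := fun c => rfl
  symm
  refine Fintype.card_congr (e.subtypeEquiv fun q => ?_)
  obtain ⟨c, rfl⟩ := QuotientGroup.mk_surjective q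
  rw [he, smul_mk_eq_iff, smul_mk_eq_iff, ← hφ]
  simp

theorem conj_comm_of_conj_eq_inv {G : Type*} [Group G] {x g c : G} (hg : g * x * g⁻¹ = x⁻¹)
    (hc : c * x = x * c) : g * c * g⁻¹ * x = x * (g * c * g⁻¹) := by
  have h1 : g * x⁻¹ * g⁻¹ = x := by rw [← conj_inv, hg, inv_inv]
  have hc' : c * x⁻¹ = x⁻¹ * c := ((show Commute c x from hc).inv_right).eq
  calc g * c * g⁻¹ * x = g * c * g⁻¹ * (g * x⁻¹ * g⁻¹) := by rw [h1]
    _ = g * (c * x⁻¹) * g⁻¹ := by group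
    _ = g * (x⁻¹ * c) * g⁻¹ := by rw [hc']
    _ = (g * x⁻¹ * g⁻¹) * (g * c * g⁻¹) := by group
    _ = x * (g * c * g⁻¹) := by rw [h1]

theorem isRepChar_fixedCosets {C : Type*} [Group C] [Fintype C] (T : Subgroup C) :
    IsRepChar fun c : C => (fixedCosets T c : ℂ) := by
  have h := isRepChar_card_fixed (K := C) (X := C ⧸ T)
  unfold fixedCosets
  convert h using 4

namespace IsPosInverter

variable {G : Type*} [Group G] [Fintype G] {z x : G} {T : Subgroup G} {g : G}

theorem le_centralizer (h : IsPosInverter z x T g) : T ≤ Subgroup.centralizer {x} := fun u hu =>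
  Subgroup.mem_centralizer_singleton_iff.2 (h.comm u hu).symm

theorem inv' (h : IsPosInverter z x T g) : g⁻¹ * x * g = x⁻¹ := by
  have := congrArg (fun y => g⁻¹ * y⁻¹ * g) h.inv
  simp only [inv_inv] at this
  rw [← this]
  group

/-- Conjugation by `g` on the centralizer of `x`. -/
def conjCentralizer (h : IsPosInverter z x T g) :
    Subgroup.centralizer {x} ≃* Subgroup.centralizer {x} where
  toFun c := ⟨g * c * g⁻¹, Subgroup.mem_centralizer_singleton_iff.2
    (conj_comm_of_conj_eq_inv h.inv (Subgroup.mem_centralizer_singleton_iff.1 c.2))⟩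
  invFun c := ⟨g⁻¹ * c * g, Subgroup.mem_centralizer_singleton_iff.2 (by
    have := conj_comm_of_conj_eq_inv (g := g⁻¹) (by rw [inv_inv]; exact h.inv')
      (Subgroup.mem_centralizer_singleton_iff.1 c.2)
    rwa [inv_inv] at this)⟩
  left_inv c := Subtype.ext (by simp [mul_assoc])
  right_inv c := Subtype.ext (by simp [mul_assoc])
  map_mul' c d := Subtype.ext (by simp [mul_assoc])

theorem conj_mem_iff (h : IsPosInverter z x T g) (u : G) : g * u * g⁻¹ ∈ T ↔ u ∈ T := by
  refine ⟨fun hu => ?_, h.conj_mem u⟩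
  obtain ⟨v, hv⟩ := h.conj_bijective.2 ⟨_, hu⟩
  have : g * v * g⁻¹ = g * u * g⁻¹ := congrArg Subtype.val hv
  have h2 : (v : G) = u := by simpa using this
  exact h2 ▸ v.2

variable {V : Type*} [AddCommGroup V] [Module ℂ V] [FiniteDimensional ℂ V] {ρ : Representation ℂ G V}

/-- Characters are integral. -/
theorem _root_.isIntegral_character (ρ : Representation ℂ G V) (k : G) :
    IsIntegral ℤ (ρ.character k) := by
  refine isIntegral_trace_of_pow_succ_eq _ (orderOf_pos k) ?_
  rw [pow_succ, ← map_pow, pow_orderOf_eq_one, map_one, one_mul]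

theorem isIntegral_sum_sq (h : IsPosInverter z x T g) (hz : ∀ k, z * k = k * z)
    (hreal : ∀ k, ρ.character k⁻¹ = ρ.character k)
    {B : LinearMap.BilinForm ℂ V} (hB : IsTwistedForm ρ id z (-1) B) (hnd : B.Nondegenerate) :
    IsIntegral ℤ ((2 * Nat.card T : ℂ)⁻¹ *
      ∑ y ∈ Finset.univ.filter (fun y : Subgroup.centralizer {x} => IsTwoElement y),
        ρ.character (x * y) ^ 2) := by
  obtain ⟨ψ, hψ, hχ⟩ := h.exists_isRepChar hz hB hnd
  set C := Subgroup.centralizer {x} with hC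
  set T' := T.subgroupOf C with hT'
  let ι : T →* C := Subgroup.inclusion h.le_centralizer
  let E : T' ≃* T := Subgroup.subgroupOfEquivOfLe h.le_centralizer
  have hcard : Nat.card T = Nat.card T' := (Nat.card_congr E.toEquiv).symm
  let p : T → ℂ := fun u => fixedCosets T' (ι u)
  let κ : T → T := fun u => ⟨g * u⁻¹ * g⁻¹, h.conj_mem _ (T.inv_mem u.2)⟩
  have hκ : Function.Bijective κ := h.conj_bijective.comp (Equiv.inv T).bijective
  let X : Subgroup.zpowers x := ⟨x, Subgroup.mem_zpowers x⟩
  have hpκ : ∀ u, p (κ u) = p u := by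
    intro u
    have h1 : ι (κ u) = h.conjCentralizer (ι u)⁻¹ := Subtype.ext rfl
    change (fixedCosets T' (ι (κ u)) : ℂ) = fixedCosets T' (ι u)
    rw [h1, fixedCosets_mulEquiv T' _ fun c => ?_, fixedCosets_inv]
    exact h.conj_mem_iff c
  have hχu : ∀ u : T, ρ.character (x * u) = ψ (X, u) + ψ (X, κ u) := by
    intro u
    have h1 : (h.twist (X, u))⁻¹ = (X, κ u) := by
      refine Prod.ext (inv_inv X) (Subtype.ext ?_)
      change (g * u * g⁻¹)⁻¹ = g * (u : G)⁻¹ * g⁻¹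
      group
    rw [← h1]
    exact hχ (X, u)
  have hχκ : ∀ u : T, ρ.character (x * κ u) = ρ.character (x * u) := by
    intro u
    have h1 : x * (κ u : G) = g * (x * u)⁻¹ * g⁻¹ := by
      change x * (g * (u : G)⁻¹ * g⁻¹) = _
      rw [h.comm u u.2, mul_inv_rev]
      have : g * x⁻¹ * g⁻¹ = x := by rw [← conj_inv, h.inv, inv_inv]
      nth_rewrite 1 [← this]
      group
    rw [h1, Representation.char_conj, hreal]
  refine hcard ▸ isIntegral_sum_twoElements T' (h.isPGroup.of_equiv E.symm) h.odd_index
    (fun y => ρ.character (x * y) ^ 2) (fun y c => ?_) (fun y => (isIntegral_character ρ _).pow 2)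
    (fun e => ?_)
  · have h1 : x * (c * y * c⁻¹ : C) = c * (x * y) * (c : G)⁻¹ := by
      have hc := Subgroup.mem_centralizer_singleton_iff.1 c.2
      push_cast
      rw [← mul_assoc, ← mul_assoc, ← hc]
      group
    rw [h1, Representation.char_conj]
  · rw [← hcard]
    have h1 : ∑ u : T', (fixedCosets T' (u : C) : ℂ) ^ e * ρ.character (x * (u : C)) ^ 2 =
        ∑ u : T, p u ^ e * ρ.character (x * u) ^ 2 :=
      Fintype.sum_equiv E.toEquiv _ _ fun u => rfl
    have h2 : ∑ u : T, p u ^ e * ρ.character (x * u) ^ 2 =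
        2 * ∑ u : T, p u ^ e * (ψ (X, u) * ρ.character (x * u)) := by
      have h3 : ∑ u : T, p u ^ e * (ψ (X, κ u) * ρ.character (x * u)) =
          ∑ u : T, p u ^ e * (ψ (X, u) * ρ.character (x * u)) :=
        Fintype.sum_bijective κ hκ _ _ fun u => by rw [hpκ, hχκ]
      rw [two_mul]
      nth_rewrite 1 [← h3]
      rw [← Finset.sum_add_distrib]
      refine Finset.sum_congr rfl fun u _ => ?_
      have := hχu u
      linear_combination p u ^ e * ρ.character (x * u) * this
    rw [h1, h2]
    have hΘ : IsRepChar fun k : Subgroup.zpowers x × T =>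
        p k.2 ^ e * (ψ k * ρ.character (h.mulHom k)) :=
      (((isRepChar_fixedCosets T').comp (ι.comp (MonoidHom.snd (Subgroup.zpowers x) T))).pow e).mul
        (hψ.mul ((isRepChar_character ρ).comp h.mulHom))
    have h4 := hΘ.isIntegral_average (MonoidHom.inr (Subgroup.zpowers x) T) (X, 1) (fun u => by
      refine Prod.ext ?_ ?_ <;> simp)
    convert h4 using 1
    rw [mul_inv, mul_assoc, Nat.card_eq_fintype_card, mul_left_comm, inv_mul_cancel_left₀ two_ne_zero]
    congr 1
    refine Finset.sum_congr rfl fun u _ => ?_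
    have h5 : ((X, 1) * MonoidHom.inr (Subgroup.zpowers x) T u : Subgroup.zpowers x × T) = (X, u) :=
      Prod.ext (mul_one X) (one_mul u)
    rw [h5]
    rfl

end IsPosInverter
end

section

open scoped Classical

variable {G : Type*} [Group G] [Fintype G]

theorem IsIrr.sum_character_sq {V : Type*} [AddCommGroup V] [Module ℂ V] [FiniteDimensional ℂ V]
    {ρ : Representation ℂ G V} (h : IsIrr ρ) :
    ∑ g, ρ.character g * ρ.character g⁻¹ = Fintype.card G := by
  haveI := h.1
  let b := Module.finBasis ℂ V
  have hχ : ∀ g, ρ.character g = ∑ i, b.coord i (ρ g (b i)) := by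
    intro g
    unfold Representation.character
    rw [LinearMap.trace_eq_matrix_trace ℂ b, Matrix.trace]
    refine Finset.sum_congr rfl fun i _ => ?_
    rw [Matrix.diag_apply, LinearMap.toMatrix_apply]
    rfl
  have hd : (Module.finrank ℂ V : ℂ) ≠ 0 := Nat.cast_ne_zero.2 Module.finrank_pos.ne'
  have h1 : ∀ i j, ∑ g, b.coord i (ρ g (b i)) * b.coord j (ρ g⁻¹ (b j)) =
      (Fintype.card G / Module.finrank ℂ V : ℂ) * if i = j then 1 else 0 := by
    intro i j
    rw [h.sum_mul (b.coord i) (b.coord j)]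
    congr 1
    by_cases hij : i = j
    · subst hij
      simp
    · simp [hij, Finsupp.single_apply]
  simp only [hχ, Finset.sum_mul_sum]
  rw [Finset.sum_comm]
  simp only [Finset.sum_comm (s := Finset.univ (α := G)), h1]
  simp only [mul_ite, mul_one, mul_zero, Finset.sum_ite_eq, Finset.mem_univ, if_true, Finset.sum_const,
    Finset.card_univ, Fintype.card_fin, nsmul_eq_mul]
  field_simp

theorem sum_centralizer_twoElement (x : G) (F : G → ℂ) :
    ∑ y ∈ Finset.univ.filter (fun y : Subgroup.centralizer {x} => IsTwoElement y), F y =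
      ∑ y ∈ Finset.univ.filter (fun y : G => IsTwoElement y ∧ y * x = x * y), F y := by
  refine Finset.sum_bij (fun y _ => (y : G)) ?_ ?_ ?_ ?_
  · intro y hy
    simp only [Finset.mem_filter, Finset.mem_univ, true_and] at hy ⊢
    obtain ⟨k, hk⟩ := hy
    exact ⟨⟨k, congrArg Subtype.val hk⟩, Subgroup.mem_centralizer_singleton_iff.1 y.2⟩
  · exact fun _ _ _ _ h => Subtype.ext h
  · intro y hy
    simp only [Finset.mem_filter, Finset.mem_univ, true_and] at hy
    obtain ⟨⟨k, hk⟩, hc⟩ := hy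
    refine ⟨⟨y, Subgroup.mem_centralizer_singleton_iff.2 hc⟩, ?_, rfl⟩
    simp only [Finset.mem_filter, Finset.mem_univ, true_and]
    exact ⟨k, Subtype.ext hk⟩
  · exact fun _ _ => rfl

/-- Summation over a group through the decomposition of its elements into commuting parts of odd
order and of `2`-power order. -/
theorem sum_eq_sum_odd_twoElement (F : G → ℂ) :
    ∑ g, F g = ∑ x ∈ Finset.univ.filter (fun x : G => Odd (orderOf x)),
      ∑ y ∈ Finset.univ.filter (fun y : Subgroup.centralizer {x} => IsTwoElement y), F (x * y) := by
  simp only [fun x => sum_centralizer_twoElement x fun y => F (x * y)]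
  obtain ⟨k, m, hm, hG⟩ := Nat.exists_eq_two_pow_mul_odd (n := Nat.card G) Nat.card_pos.ne'
  have hcop : Nat.Coprime m (2 ^ k) := (Nat.coprime_two_right.2 hm).pow_right k
  obtain ⟨E, hE1, hE2⟩ := Nat.chineseRemainder hcop 1 0
  obtain ⟨E', hE1', hE2'⟩ := Nat.chineseRemainder hcop 0 1
  have hpow : ∀ (g : G) (a b d : ℕ), g ^ d = 1 → a ≡ b [MOD d] → g ^ a = g ^ b := by
    intro g a b d hd hab
    exact pow_eq_pow_iff_modEq.2 (hab.of_dvd (orderOf_dvd_of_pow_eq_one hd))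
  have hgG : ∀ g : G, (g ^ m) ^ 2 ^ k = 1 := fun g => by
    rw [← pow_mul, mul_comm, ← hG, pow_card_eq_one']
  have hgG' : ∀ g : G, (g ^ 2 ^ k) ^ m = 1 := fun g => by
    rw [← pow_mul, ← hG, pow_card_eq_one']
  have hsum : ∀ g : G, g ^ E * g ^ E' = g := by
    intro g
    rw [← pow_add]
    have h1 : E + E' ≡ 1 [MOD m * 2 ^ k] :=
      (Nat.modEq_and_modEq_iff_modEq_mul hcop).1 ⟨by simpa using hE1.add hE1', by simpa using hE2.add hE2'⟩
    have := hpow g _ _ (m * 2 ^ k) (by rw [pow_mul, hgG]) h1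
    rwa [pow_one] at this
  have hodd : ∀ x : G, Odd (orderOf x) ↔ x ^ m = 1 := by
    intro x
    constructor
    · intro hx
      have h1 : orderOf x ∣ 2 ^ k * m := hG ▸ orderOf_dvd_natCard x
      exact orderOf_dvd_iff_pow_eq_one.1
        (((Nat.coprime_two_right.2 hx).pow_right k).dvd_of_dvd_mul_left h1)
    · intro hx
      exact hm.of_dvd_nat (orderOf_dvd_of_pow_eq_one hx)
  have htwo : ∀ y : G, IsTwoElement y ↔ y ^ 2 ^ k = 1 := by
    intro y
    constructor
    · rintro ⟨l, hl⟩
      have h1 : orderOf y ∣ 2 ^ k * m := hG ▸ orderOf_dvd_natCard y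
      have h2 : Nat.Coprime (orderOf y) m :=
        Nat.Coprime.coprime_dvd_left (orderOf_dvd_of_pow_eq_one hl)
          ((Nat.coprime_two_left.2 hm).pow_left l)
      exact orderOf_dvd_iff_pow_eq_one.1 (h2.dvd_of_dvd_mul_right h1)
    · exact fun h => ⟨k, h⟩
  rw [Finset.sum_sigma']
  symm
  refine Finset.sum_bij' (fun p _ => p.1 * p.2) (fun g _ => ⟨g ^ E, g ^ E'⟩) ?_ ?_ ?_ ?_ ?_
  · intros; exact Finset.mem_univ _
  · intro g _
    simp only [Finset.mem_sigma, Finset.mem_filter, Finset.mem_univ, true_and]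
    refine ⟨?_, ?_, ?_⟩
    · rw [hodd, ← pow_mul, mul_comm, pow_mul]
      have := hpow (g ^ m) E 0 (2 ^ k) (hgG g) hE2
      rwa [pow_zero] at this
    · rw [htwo, ← pow_mul, mul_comm, pow_mul]
      have := hpow (g ^ 2 ^ k) E' 0 m (hgG' g) hE1'
      rwa [pow_zero] at this
    · rw [← pow_add, ← pow_add, add_comm]
  · rintro ⟨x, y⟩ hp
    simp only [Finset.mem_sigma, Finset.mem_filter, Finset.mem_univ, true_and] at hp
    obtain ⟨hx, hy, hc⟩ := hp
    rw [hodd] at hx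
    rw [htwo] at hy
    have hc : Commute x y := hc.symm
    have h1 := hpow x E 1 m hx hE1
    have h2 := hpow x E' 0 m hx hE1'
    have h3 := hpow y E 0 (2 ^ k) hy hE2
    have h4 := hpow y E' 1 (2 ^ k) hy hE2'
    have e1 : (x * y) ^ E = x := by rw [hc.mul_pow, h1, h3]; simp
    have e2 : (x * y) ^ E' = y := by rw [hc.mul_pow, h2, h4]; simp
    simp only [e1, e2]
  · intro g _
    exact hsum g
  · intros; rfl

theorem not_isIntegral_half {m : ℕ} (hm : Odd m) : ¬ IsIntegral ℤ ((m : ℂ) / 2) := by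
  intro h
  have h1 : ((m : ℂ) / 2) = algebraMap ℚ ℂ ((m : ℚ) / 2) := by simp
  rw [h1] at h
  have h2 := (isIntegral_algebraMap_iff (algebraMap ℚ ℂ).injective).1 h
  obtain ⟨a, ha⟩ := IsIntegrallyClosed.isIntegral_iff.1 h2
  have h3 : (2 * a : ℚ) = m := by
    rw [← Int.cast_id (n := a)] at ha
    simp at ha
    rw [ha]; ring
  obtain ⟨b, rfl⟩ := hm
  have h4 : 2 * a = 2 * b + 1 := by exact_mod_cast h3
  omega

end

section

open scoped Classical

variable {G : Type*} [Group G] [Fintype G]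

theorem card_conj_mul_card_centralizer (x : G) :
    (Finset.univ.filter fun y : G => ConjClasses.mk y = ConjClasses.mk x).card *
      Nat.card (Subgroup.centralizer {x}) = Nat.card G := by
  rw [Subgroup.nat_card_centralizer_nat_card_stabilizer, Nat.card_eq_fintype_card,
    Nat.card_eq_fintype_card]
  refine Eq.trans ?_ (MulAction.card_orbit_mul_card_stabilizer_eq_card_group (ConjAct G) x)
  congr 1
  rw [← Set.toFinset_card]
  congr 1
  ext y
  rw [Set.mem_toFinset, ConjAct.orbit_eq_carrier_conjClasses, ConjClasses.mem_carrier_iff_mk_eq,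
    Finset.mem_filter]
  simp

theorem IsIrr.not_isTwistedForm_neg_of_isPosInverter
    {V : Type*} [AddCommGroup V] [Module ℂ V] [FiniteDimensional ℂ V]
    {ρ : Representation ℂ G V} (h : IsIrr ρ) {z : G} (hz : ∀ k, z * k = k * z)
    (hreal : ∀ k, ρ.character k⁻¹ = ρ.character k)
    (hpos : ∀ x : G, Odd (orderOf x) → ∃ T g, IsPosInverter z x T g)
    {B : LinearMap.BilinForm ℂ V} (hB : IsTwistedForm ρ id z (-1) B) (hnd : B.Nondegenerate) : False := by
  obtain ⟨k, m, hm, hG⟩ := Nat.exists_eq_two_pow_mul_odd (n := Nat.card G) Nat.card_pos.ne'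
  have hG0 : (Nat.card G : ℂ) ≠ 0 := Nat.cast_ne_zero.2 Nat.card_pos.ne'
  let S : G → ℂ := fun x =>
    ∑ y ∈ Finset.univ.filter (fun y : Subgroup.centralizer {x} => IsTwoElement y),
      ρ.character (x * y) ^ 2
  have hS : ∀ x c, S (c * x * c⁻¹) = S x := by
    intro x c
    simp only [S]
    rw [sum_centralizer_twoElement x fun y => ρ.character (x * y) ^ 2,
      sum_centralizer_twoElement _ fun y => ρ.character (c * x * c⁻¹ * y) ^ 2]
    symm
    refine Finset.sum_equiv (MulAut.conj c).toEquiv (fun y => ?_) (fun y _ => ?_)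
    · rw [Finset.mem_filter, Finset.mem_filter]
      simp only [Finset.mem_univ, true_and]
      have e1 : ∀ k : ℕ, (MulAut.conj c y) ^ 2 ^ k = 1 ↔ y ^ 2 ^ k = 1 := fun k => by
        rw [← map_pow, MulEquiv.map_eq_one_iff]
      have e2 : MulAut.conj c y * MulAut.conj c x = MulAut.conj c x * MulAut.conj c y ↔ y * x = x * y := by
        rw [← map_mul, ← map_mul, (MulAut.conj c).injective.eq_iff]
      exact and_congr (exists_congr fun k => (e1 k).symm) e2.symm
    · have : c * x * c⁻¹ * (MulAut.conj c).toEquiv y = c * (x * y) * c⁻¹ := by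
        change c * x * c⁻¹ * (c * y * c⁻¹) = _
        group
      rw [this, Representation.char_conj]
  have hsum : ∑ x ∈ Finset.univ.filter (fun x : G => Odd (orderOf x)), S x = Nat.card G := by
    rw [← sum_eq_sum_odd_twoElement (fun g => ρ.character g ^ 2), Nat.card_eq_fintype_card,
      ← h.sum_character_sq]
    exact Finset.sum_congr rfl fun g _ => by rw [hreal, sq]
  have hcl : ∀ c : ConjClasses G, IsIntegral ℤ ((m : ℂ) / (2 * Nat.card G) *
      ∑ x ∈ (Finset.univ.filter (fun x : G => Odd (orderOf x))).filter (fun x => ConjClasses.mk x = c), S x) := by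
    intro c
    by_cases hc : ∃ x, Odd (orderOf x) ∧ ConjClasses.mk x = c
    · obtain ⟨x, hx, rfl⟩ := hc
      have hconj : ∀ y, ConjClasses.mk y = ConjClasses.mk x → Odd (orderOf y) ∧ S y = S x := by
        intro y hy
        obtain ⟨c, rfl⟩ := isConj_iff.1 (ConjClasses.mk_eq_mk_iff_isConj.1 hy.symm)
        refine ⟨?_, hS _ _⟩
        rwa [← MulAut.conj_apply, MulEquiv.orderOf_eq]
      have hfil : (Finset.univ.filter (fun x : G => Odd (orderOf x))).filter
          (fun y => ConjClasses.mk y = ConjClasses.mk x) =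
          Finset.univ.filter fun y => ConjClasses.mk y = ConjClasses.mk x := by
        ext y
        simp only [Finset.mem_filter, Finset.mem_univ, true_and]
        exact ⟨fun h => h.2, fun h => ⟨(hconj y h).1, h⟩⟩
      rw [hfil, Finset.sum_congr rfl (g := fun _ => S x) fun y hy =>
        (hconj y (Finset.mem_filter.1 hy).2).2, Finset.sum_const, nsmul_eq_mul]
      obtain ⟨T, g, hTg⟩ := hpos x hx
      have h1 := hTg.isIntegral_sum_sq hz hreal hB hnd
      have h2 := card_conj_mul_card_centralizer x
      set N := (Finset.univ.filter fun y : G => ConjClasses.mk y = ConjClasses.mk x).card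
      have h3 := Subgroup.card_mul_index (T.subgroupOf (Subgroup.centralizer {x}))
      rw [Nat.card_congr (Subgroup.subgroupOfEquivOfLe hTg.le_centralizer).toEquiv] at h3
      set i := (T.subgroupOf (Subgroup.centralizer {x})).index with hi
      obtain ⟨j, hj⟩ : i ∣ m := by
        have h4 : i ∣ 2 ^ k * m := by
          rw [← hG, ← h2, ← h3]
          exact ⟨N * Nat.card T, by ring⟩
        exact ((Nat.coprime_two_right.2 hTg.odd_index).pow_right k).dvd_of_dvd_mul_left h4
      have h5 : (m : ℂ) / (2 * Nat.card G) * (N * S x) = j * ((2 * Nat.card T : ℂ)⁻¹ * S x) := by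
        have hT0 : (Nat.card T : ℂ) ≠ 0 := Nat.cast_ne_zero.2 Nat.card_pos.ne'
        have h6 : (Nat.card G : ℂ) = N * (Nat.card T * i) := by
          rw [← h2, ← h3]; push_cast; ring
        have hN : (N : ℂ) ≠ 0 := by
          intro h0; rw [h6, h0, zero_mul] at hG0; exact hG0 rfl
        have hi0 : (i : ℂ) ≠ 0 := by
          intro h0; rw [h6, h0] at hG0; simp at hG0
        rw [h6, hj]
        push_cast
        field_simp
      rw [h5]
      exact (isIntegral_natCast j).mul h1
    · rw [Finset.sum_eq_zero, mul_zero]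
      · exact isIntegral_zero
      · intro y hy
        simp only [Finset.mem_filter, Finset.mem_univ, true_and] at hy
        exact absurd ⟨y, hy⟩ hc
  refine not_isIntegral_half hm ?_
  have h2 : (m : ℂ) / 2 = ∑ c : ConjClasses G, (m : ℂ) / (2 * Nat.card G) *
      ∑ x ∈ (Finset.univ.filter (fun x : G => Odd (orderOf x))).filter (fun x => ConjClasses.mk x = c), S x := by
    rw [← Finset.mul_sum, Finset.sum_fiberwise, hsum]
    field_simp
  rw [h2]
  exact IsIntegral.sum _ fun c _ => hcl c

end

section

open scoped Classical

variable {G : Type*} [Group G] [Fintype G]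

theorem character_eq_sum_coord {V ι : Type*} [Fintype ι] [AddCommGroup V] [Module ℂ V]
    (ρ : Representation ℂ G V) (b : Module.Basis ι ℂ V) (g : G) :
    ρ.character g = ∑ i, b.coord i (ρ g (b i)) := by
  unfold Representation.character
  rw [LinearMap.trace_eq_matrix_trace ℂ b, Matrix.trace]
  refine Finset.sum_congr rfl fun i _ => ?_
  rw [Matrix.diag_apply, LinearMap.toMatrix_apply]
  rfl

variable {V : Type*} [AddCommGroup V] [Module ℂ V] [FiniteDimensional ℂ V] {ρ : Representation ℂ G V}

theorem IsIrr.exists_invariant_form (h : IsIrr ρ) (hreal : ∀ k, ρ.character k⁻¹ = ρ.character k) :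
    ∃ B : LinearMap.BilinForm ℂ V, B.Nondegenerate ∧ ∀ k v w, B (ρ k v) (ρ k w) = B v w := by
  let b := Module.finBasis ℂ V
  let F : (V →ₗ[ℂ] ℂ) → (V →ₗ[ℂ] ℂ) → LinearMap.BilinForm ℂ V := fun φ ψ =>
    ∑ g : G, LinearMap.BilinForm.linMulLin (φ ∘ₗ ρ g) (ψ ∘ₗ ρ g)
  have hF : ∀ φ ψ v w, F φ ψ v w = ∑ g : G, φ (ρ g v) * ψ (ρ g w) := fun φ ψ v w => by
    simp [F]
  have hne : ∃ i j, F (b.coord i) (b.coord j) (b i) (b j) ≠ 0 := by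
    by_contra! hcon
    have h1 := h.sum_character_sq
    have h2 : ∑ g, ρ.character g * ρ.character g⁻¹ = 0 := by
      simp only [hreal, character_eq_sum_coord ρ b, Finset.sum_mul_sum]
      rw [Finset.sum_comm]
      refine Finset.sum_eq_zero fun i _ => ?_
      rw [Finset.sum_comm]
      exact Finset.sum_eq_zero fun j _ => (hF _ _ _ _).symm.trans (hcon i j)
    rw [h2] at h1
    exact Nat.cast_ne_zero.2 Fintype.card_ne_zero h1.symm
  obtain ⟨i, j, hij⟩ := hne
  have hinv : ∀ k v w, F (b.coord i) (b.coord j) (ρ k v) (ρ k w) = F (b.coord i) (b.coord j) v w := by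
    intro k v w
    rw [hF, hF, ← Equiv.sum_comp (Equiv.mulRight k) fun g => b.coord i (ρ g v) * b.coord j (ρ g w)]
    refine Finset.sum_congr rfl fun g _ => ?_
    rw [Equiv.coe_mulRight, map_mul]
    rfl
  refine ⟨F (b.coord i) (b.coord j), LinearMap.BilinForm.Nondegenerate.ofSeparatingLeft ?_, hinv⟩
  rcases h.2 (LinearMap.ker (F (b.coord i) (b.coord j))) (fun k v hv => by
    rw [LinearMap.mem_ker] at hv ⊢
    ext w
    have := hinv k v (ρ k⁻¹ w)
    rw [← Module.End.mul_apply, ← map_mul, mul_inv_cancel, map_one, Module.End.one_apply] at this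
    rw [this, hv, LinearMap.zero_apply, LinearMap.zero_apply]) with h0 | h0
  · intro v hv
    have : v ∈ LinearMap.ker (F (b.coord i) (b.coord j)) := LinearMap.mem_ker.2 (LinearMap.ext hv)
    rwa [h0, Submodule.mem_bot] at this
  · exfalso
    have : b i ∈ LinearMap.ker (F (b.coord i) (b.coord j)) := h0 ▸ Submodule.mem_top
    rw [LinearMap.mem_ker] at this
    exact hij (by rw [this, LinearMap.zero_apply])

/-- If all odd-order elements of a finite group whose elements are conjugate to their inverses have
positive inverters, then Frobenius–Schur indicators are values of central characters. -/
theorem IsIrr.exists_sum_character_mul_self (h : IsIrr ρ) {z : G} (hz : ∀ k, z * k = k * z)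
    (hzz : z * z = 1) (hconj : ∀ g : G, ∃ k, k * g * k⁻¹ = g⁻¹)
    (hpos : ∀ x : G, Odd (orderOf x) → ∃ T g, IsPosInverter z x T g) :
    ∃ c : ℂ, (c = 1 ∨ c = -1) ∧ (∀ g, ρ.character (g * z) = c * ρ.character g) ∧
      ∑ g, ρ.character (g * g) = c * Fintype.card G := by
  haveI := h.1
  have hreal : ∀ k, ρ.character k⁻¹ = ρ.character k := fun k => by
    obtain ⟨l, hl⟩ := hconj k
    rw [← hl, Representation.char_conj]
  obtain ⟨B, hnd, hinv⟩ := h.exists_invariant_form hreal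
  obtain ⟨v0, hv0⟩ := exists_ne (0 : V)
  obtain ⟨w0, hw0⟩ : ∃ w0, B v0 w0 ≠ 0 := by
    by_contra! hc
    exact hv0 (hnd.1 v0 hc)
  obtain ⟨c, hc⟩ := h.exists_eq_smul (ρ z) fun k v => by
    rw [← Module.End.mul_apply, ← map_mul, hz, map_mul]; rfl
  have hc2 : c = 1 ∨ c = -1 := by
    have h1 : ρ z (ρ z v0) = v0 := by
      rw [← Module.End.mul_apply, ← map_mul, hzz, map_one]; rfl
    rw [hc, hc, smul_smul, ← sub_eq_zero, ← one_smul ℂ v0, smul_smul, ← sub_smul, smul_eq_zero] at h1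
    exact mul_self_eq_one_iff.1 (by linear_combination h1.resolve_right hv0)
  let M : V →ₗ[ℂ] V := (B.toDual hnd).symm.toLinearMap ∘ₗ B.flip
  have hM : ∀ v w, B (M v) w = B w v := by
    intro v w
    rw [← LinearMap.BilinForm.toDual_def hnd]
    change (B.toDual hnd) ((B.toDual hnd).symm (B.flip v)) w = B w v
    rw [LinearEquiv.apply_symm_apply]
    rfl
  obtain ⟨d, hd⟩ := h.exists_eq_smul M fun k v => by
    rw [← sub_eq_zero]
    apply hnd.1
    intro w
    have e : w = ρ k (ρ k⁻¹ w) := by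
      rw [← Module.End.mul_apply, ← map_mul, mul_inv_cancel, map_one]; rfl
    rw [map_sub, LinearMap.sub_apply, hM]
    conv_lhs => rw [e]
    rw [hinv, hinv, hM, sub_self]
  have hBd : ∀ v w, B w v = d * B v w := fun v w => by
    rw [← hM, hd, map_smul, LinearMap.smul_apply, smul_eq_mul]
  have hd2 : d = 1 ∨ d = -1 := by
    have h1 := hBd v0 w0
    rw [hBd w0 v0] at h1
    have h2 := hBd w0 v0
    rw [hBd v0 w0] at h2
    exact mul_self_eq_one_iff.1 (mul_right_cancel₀ hw0 (by linear_combination -h2))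
  have hB : IsTwistedForm ρ id z (c * d) B := by
    refine ⟨hinv, fun v w => ?_⟩
    rw [hc, map_smul, smul_eq_mul, hBd, mul_assoc]
  have hs : c * d = 1 := by
    have hcd : c * d = 1 ∨ c * d = -1 := by
      rcases hc2 with rfl | rfl <;> rcases hd2 with rfl | rfl <;> norm_num
    refine hcd.resolve_right fun hcd => ?_
    rw [hcd] at hB
    exact h.not_isTwistedForm_neg_of_isPosInverter hz hreal hpos hB hnd
  rw [hs] at hB
  have hcc : c * c = 1 := mul_self_eq_one_iff.2 hc2
  have hχz : ∀ g, ρ.character (g * z) = c * ρ.character g := by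
    intro g
    have hg : ρ (g * z) = c • ρ g := by
      ext v
      rw [map_mul, Module.End.mul_apply, hc, map_smul]
      rfl
    unfold Representation.character
    rw [hg, map_smul, smul_eq_mul]
  refine ⟨c, hc2, hχz, ?_⟩
  have h1 := fun w => h.sum_twisted (τ := Equiv.refl G) (fun k => (hz k).symm) hB hnd w
  have h2 : ∑ g, ρ.character (g * g * z) = Fintype.card G := by
    have h3 : ∑ g, ρ (g * g * z) =
        (1 * (Fintype.card G / Module.finrank ℂ V : ℂ)) • (LinearMap.id : V →ₗ[ℂ] V) := by
      ext w
      rw [LinearMap.sum_apply]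
      exact h1 w
    have h4 := congrArg (LinearMap.trace ℂ V) h3
    rw [map_sum, map_smul, LinearMap.trace_id, smul_eq_mul, one_mul, div_mul_cancel₀ _
      (Nat.cast_ne_zero.2 Module.finrank_pos.ne')] at h4
    exact h4
  simp only [hχz] at h2
  rw [← Finset.mul_sum] at h2
  rw [← h2, ← mul_assoc, hcc, one_mul]

end

section

open scoped Classical

theorem Nat.card_mul_eq_card_mul_of_rel {α β : Type*} [Finite α] [Finite β] (r : α → β → Prop)
    {m n : ℕ} (h1 : ∀ a, Nat.card {b // r a b} = m) (h2 : ∀ b, Nat.card {a // r a b} = n) :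
    Nat.card α * m = Nat.card β * n := by
  have := Fintype.ofFinite α
  have := Fintype.ofFinite β
  have key := Finset.card_mul_eq_card_mul (s := (Finset.univ : Finset α))
    (t := (Finset.univ : Finset β)) r (m := m) (n := n)
    (fun a _ => by
      rw [← h1 a, Nat.card_eq_fintype_card, Fintype.card_subtype]
      rfl)
    (fun b _ => by
      rw [← h2 b, Nat.card_eq_fintype_card, Fintype.card_subtype]
      rfl)
  simpa [Finset.card_univ, Nat.card_eq_fintype_card] using key

variable {F : Type*} [Field F] [Finite F]

theorem LinearMap.natCard_fiber_one {U : Type*} [AddCommGroup U] [Module F U] [Module.Finite F U]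
    {φ : U →ₗ[F] F} (hφ : φ ≠ 0) :
    Nat.card {v // φ v = 1} = Nat.card F ^ (Module.finrank F U - 1) := by
  obtain ⟨v, hv⟩ : ∃ v, φ v ≠ 0 := by
    by_contra! h
    exact hφ (LinearMap.ext h)
  have h0 : φ ((φ v)⁻¹ • v) = 1 := by
    rw [map_smul, smul_eq_mul, inv_mul_cancel₀ hv]
  have e : {v // φ v = 1} ≃ LinearMap.ker φ :=
    { toFun := fun w => ⟨w.1 - (φ v)⁻¹ • v, by
        rw [LinearMap.mem_ker, map_sub, w.2, h0, sub_self]⟩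
      invFun := fun w => ⟨w.1 + (φ v)⁻¹ • v, by
        rw [map_add, LinearMap.mem_ker.1 w.2, h0, zero_add]⟩
      left_inv := fun w => Subtype.ext (sub_add_cancel _ _)
      right_inv := fun w => Subtype.ext (add_sub_cancel_right _ _) }
  rw [Nat.card_congr e, Module.natCard_eq_pow_finrank (K := F),
    ← Module.Dual.finrank_ker_add_one_of_ne_zero hφ, Nat.add_sub_cancel]

theorem LinearMap.natCard_pairs_one {U W : Type*} [AddCommGroup U] [Module F U] [Module.Finite F U]
    [AddCommGroup W] [Module F W] [Module.Finite F W] (P : U →ₗ[F] W →ₗ[F] F)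
    (hP : ∀ u, (∀ w, P u w = 0) → u = 0) :
    Nat.card {p : U × W // P p.1 p.2 = 1} =
      (Nat.card F ^ Module.finrank F U - 1) * Nat.card F ^ (Module.finrank F W - 1) := by
  have : Finite U := Module.finite_of_finite F
  have : Finite W := Module.finite_of_finite F
  have := Fintype.ofFinite U
  have e : {p : U × W // P p.1 p.2 = 1} ≃ Σ u : {u : U // u ≠ 0}, {w // P u w = 1} :=
    { toFun := fun p => ⟨⟨p.1.1, fun h => by
        have := p.2
        rw [h, map_zero, LinearMap.zero_apply] at this
        exact zero_ne_one this⟩, ⟨p.1.2, p.2⟩⟩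
      invFun := fun s => ⟨(s.1.1, s.2.1), s.2.2⟩
      left_inv := fun _ => rfl
      right_inv := fun _ => rfl }
  rw [Nat.card_congr e, Nat.card_sigma, Finset.sum_congr rfl fun u _ => LinearMap.natCard_fiber_one
    (φ := P u.1) fun h => u.2 (hP _ fun w => by rw [h, LinearMap.zero_apply]), Finset.sum_const,
    smul_eq_mul, Finset.card_univ, ← Module.natCard_eq_pow_finrank (K := F) (V := U),
    Nat.card_eq_fintype_card (α := U), Fintype.card_subtype_compl, Fintype.card_subtype_eq]

/-- The isometries of a bilinear form whose square is the scalar `s`. -/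
def isometrySqrt {F V : Type*} [Field F] [AddCommGroup V] [Module F V]
    (B : LinearMap.BilinForm F V) (s : F) : Set (V →ₗ[F] V) :=
  {h | (∀ v w, B (h v) (h w) = B v w) ∧ ∀ v, h (h v) = s • v}

/-- The vectors orthogonal to two given ones. -/
def pairOrthogonal {F V : Type*} [Field F] [AddCommGroup V] [Module F V]
    (B : LinearMap.BilinForm F V) (x y : V) : Submodule F V :=
  LinearMap.ker (B x) ⊓ LinearMap.ker (B y)

end
section
open scoped Classical
variable {F : Type*} [Field F] {V : Type*} [AddCommGroup V] [Module F V]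
  {B : LinearMap.BilinForm F V} {x y : V}

theorem mem_pairOrthogonal {w : V} : w ∈ pairOrthogonal B x y ↔ B x w = 0 ∧ B y w = 0 := by
  rw [pairOrthogonal, Submodule.mem_inf, LinearMap.mem_ker, LinearMap.mem_ker]

/-- The splitting of a space with an alternating form by a hyperbolic pair. -/
noncomputable def hyperbolicSplitting (B : LinearMap.BilinForm F V) (hA : ∀ v, B v v = 0)
    (hxy : B x y = 1) : ((F × F) × pairOrthogonal B x y) ≃ₗ[F] V :=
  have hyx : B y x = -1 := by
    have h := hA (x + y)
    simp only [map_add, LinearMap.add_apply, hA, hxy] at h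
    linear_combination h
  { toFun := fun p => p.1.1 • x + p.1.2 • y + (p.2 : V)
    map_add' := fun p p' => by
      simp only [Prod.fst_add, Prod.snd_add, add_smul, Submodule.coe_add]
      abel
    map_smul' := fun a p => by
      simp only [Prod.smul_fst, Prod.smul_snd, smul_eq_mul, mul_smul, smul_add, Submodule.coe_smul,
        RingHom.id_apply]
    invFun := fun v => ((-B y v, B x v), ⟨v - ((-B y v) • x + B x v • y), by
      rw [mem_pairOrthogonal]
      simp only [map_sub, map_add, map_smul, hA, hxy, hyx, smul_eq_mul]
      constructor <;> ring⟩)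
    left_inv := fun p => by
      obtain ⟨⟨a, b⟩, w, hw⟩ := p
      rw [mem_pairOrthogonal] at hw
      have h1 : B x (a • x + b • y + w) = b := by
        simp only [map_add, map_smul, hA, hxy, hw.1, smul_eq_mul]
        ring
      have h2 : -B y (a • x + b • y + w) = a := by
        simp only [map_add, map_smul, hA, hyx, hw.2, smul_eq_mul]
        ring
      simp only [h1, h2, add_sub_cancel_left]
    right_inv := fun v => add_sub_cancel _ _ }

theorem hyperbolicSplitting_apply (hA : ∀ v, B v v = 0) (hxy : B x y = 1)
    (p : (F × F) × pairOrthogonal B x y) :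
    hyperbolicSplitting B hA hxy p = p.1.1 • x + p.1.2 • y + (p.2 : V) := rfl

theorem neg_eq_of_alternating (hA : ∀ v, B v v = 0) (v w : V) : B v w = -B w v := by
  have h := hA (v + w)
  simp only [map_add, LinearMap.add_apply, hA] at h
  linear_combination h

theorem nondegenerate_pairOrthogonal (hA : ∀ v, B v v = 0) (hB : ∀ v, (∀ w, B v w = 0) → v = 0)
    (hxy : B x y = 1) (v : pairOrthogonal B x y)
    (hv : ∀ w, B.restrict (pairOrthogonal B x y) v w = 0) : v = 0 := by
  obtain ⟨v, hm⟩ := v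
  rw [mem_pairOrthogonal] at hm
  refine Subtype.ext (hB _ fun w => ?_)
  obtain ⟨⟨⟨a, b⟩, w⟩, rfl⟩ := (hyperbolicSplitting B hA hxy).surjective w
  have h := hv w
  rw [LinearMap.BilinForm.restrict_apply] at h
  simp only [LinearMap.domRestrict_apply] at h
  rw [hyperbolicSplitting_apply, map_add, map_add, map_smul, map_smul, neg_eq_of_alternating hA v x,
    neg_eq_of_alternating hA v y, hm.1, hm.2, h]
  simp

theorem finrank_pairOrthogonal [Module.Finite F V] (hA : ∀ v, B v v = 0) (hxy : B x y = 1) :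
    Module.finrank F V = Module.finrank F (pairOrthogonal B x y) + 2 := by
  rw [← (hyperbolicSplitting B hA hxy).finrank_eq, Module.finrank_prod, Module.finrank_prod,
    Module.finrank_self, add_comm]

theorem exists_hyperbolic_pair [Nontrivial V] (hB : ∀ v, (∀ w, B v w = 0) → v = 0) :
    ∃ x y, B x y = 1 := by
  obtain ⟨x, hx⟩ := exists_ne (0 : V)
  obtain ⟨y, hy⟩ : ∃ y, B x y ≠ 0 := by
    by_contra! h
    exact hx (hB x h)
  exact ⟨x, (B x y)⁻¹ • y, by rw [map_smul, smul_eq_mul, inv_mul_cancel₀ hy]⟩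

theorem even_finrank_of_alternating (n : ℕ) : ∀ {V : Type*} [AddCommGroup V] [Module F V]
    [Module.Finite F V] (B : LinearMap.BilinForm F V) (_ : ∀ v, B v v = 0)
    (_ : ∀ v, (∀ w, B v w = 0) → v = 0), Module.finrank F V = n → Even n := by
  induction n using Nat.strong_induction_on with
  | _ n ih =>
    intro V _ _ _ B hA hB hn
    rcases subsingleton_or_nontrivial V with _ | _
    · rw [← hn, Module.finrank_zero_of_subsingleton]
      exact Even.zero
    · obtain ⟨x, y, hxy⟩ := exists_hyperbolic_pair hB
      have h := finrank_pairOrthogonal hA hxy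
      have := ih _ (by omega) (B.restrict (pairOrthogonal B x y)) (fun v => hA v)
        (nondegenerate_pairOrthogonal hA hB hxy) rfl
      rw [← hn, h]
      exact this.add even_two

end

section

open scoped Classical
variable {F : Type*} [Field F] {V : Type*} [AddCommGroup V] [Module F V]
  {B : LinearMap.BilinForm F V} {x y : V}

/-- The diagonal map with entries `c` and `d`. -/
noncomputable def diagPair (c d : F) : (F × F) →ₗ[F] (F × F) :=
  LinearMap.prodMap (c • LinearMap.id) (d • LinearMap.id)

/-- The extension of an endomorphism by `c`, `d` on a hyperbolic pair. -/
noncomputable def hyperbolicExtension (hA : ∀ v, B v v = 0) (hxy : B x y = 1) (c d : F)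
    (h : pairOrthogonal B x y →ₗ[F] pairOrthogonal B x y) : V →ₗ[F] V :=
  (hyperbolicSplitting B hA hxy).conj (LinearMap.prodMap (diagPair c d) h)

theorem hyperbolicExtension_apply (hA : ∀ v, B v v = 0) (hxy : B x y = 1) (c d : F)
    (h : pairOrthogonal B x y →ₗ[F] pairOrthogonal B x y) (p : (F × F) × pairOrthogonal B x y) :
    hyperbolicExtension hA hxy c d h (hyperbolicSplitting B hA hxy p) =
      hyperbolicSplitting B hA hxy ((c * p.1.1, d * p.1.2), h p.2) := by
  rw [hyperbolicExtension, LinearEquiv.conj_apply_apply, LinearEquiv.symm_apply_apply]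
  rfl

theorem hyperbolicExtension_injective (hA : ∀ v, B v v = 0) (hxy : B x y = 1) (c d : F) :
    Function.Injective (hyperbolicExtension hA hxy c d) := by
  intro h h' e
  ext w
  have h1 := hyperbolicExtension_apply hA hxy c d h (0, w)
  rw [e, hyperbolicExtension_apply] at h1
  have h2 := (hyperbolicSplitting B hA hxy).injective h1
  exact congrArg _ (Prod.ext_iff.1 h2).2.symm

theorem hyperbolicSplitting_inner (hA : ∀ v, B v v = 0) (hxy : B x y = 1)
    (p p' : (F × F) × pairOrthogonal B x y) :
    B (hyperbolicSplitting B hA hxy p) (hyperbolicSplitting B hA hxy p') =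
      p.1.1 * p'.1.2 - p.1.2 * p'.1.1 + B p.2 p'.2 := by
  obtain ⟨⟨a, b⟩, v, hv⟩ := p
  obtain ⟨⟨a', b'⟩, w, hw⟩ := p'
  rw [mem_pairOrthogonal] at hv hw
  simp only [hyperbolicSplitting_apply, map_add, map_smul, LinearMap.add_apply,
    LinearMap.smul_apply, smul_eq_mul, hA, hxy, hw.1, hw.2, neg_eq_of_alternating hA y x,
    neg_eq_of_alternating hA v x, neg_eq_of_alternating hA v y, hv.1, hv.2]
  ring

theorem hyperbolicExtension_mem_isometrySqrt_iff (hA : ∀ v, B v v = 0) (hxy : B x y = 1) {c d : F}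
    (hcd : c * d = 1) (hcd' : c * c = d * d)
    (h : pairOrthogonal B x y →ₗ[F] pairOrthogonal B x y) :
    hyperbolicExtension hA hxy c d h ∈ isometrySqrt B (c * c) ↔
      h ∈ isometrySqrt (B.restrict (pairOrthogonal B x y)) (c * c) := by
  let E := hyperbolicSplitting B hA hxy
  constructor
  · rintro ⟨h1, h2⟩
    refine ⟨fun v w => ?_, fun v => ?_⟩
    · have := h1 (E (0, v)) (E (0, w))
      rw [hyperbolicExtension_apply, hyperbolicExtension_apply, hyperbolicSplitting_inner,
        hyperbolicSplitting_inner] at this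
      simpa using this
    · have := h2 (E (0, v))
      rw [hyperbolicExtension_apply, hyperbolicExtension_apply, ← map_smul] at this
      exact (Prod.ext_iff.1 (E.injective this)).2
  · rintro ⟨h1, h2⟩
    refine ⟨fun v w => ?_, fun v => ?_⟩
    · obtain ⟨p, rfl⟩ := E.surjective v
      obtain ⟨p', rfl⟩ := E.surjective w
      rw [hyperbolicExtension_apply, hyperbolicExtension_apply, hyperbolicSplitting_inner,
        hyperbolicSplitting_inner]
      have : B (h p.2) (h p'.2) = B p.2 p'.2 := h1 p.2 p'.2
      simp only [this]
      linear_combination (p.1.1 * p'.1.2 - p.1.2 * p'.1.1) * hcd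
    · obtain ⟨p, rfl⟩ := E.surjective v
      rw [hyperbolicExtension_apply, hyperbolicExtension_apply, ← map_smul]
      congr 1
      refine Prod.ext (Prod.ext ?_ ?_) (h2 p.2)
      · simp only [Prod.smul_fst, smul_eq_mul, mul_assoc]
      · simp only [Prod.smul_fst, Prod.smul_snd, smul_eq_mul, ← mul_assoc, hcd']

theorem exists_hyperbolicExtension_eq (hA : ∀ v, B v v = 0) (hxy : B x y = 1) {c d : F}
    (hcd : c * d = 1) {h : V →ₗ[F] V} (hh : ∀ v w, B (h v) (h w) = B v w)
    (hx : h x = c • x) (hy : h y = d • y) : ∃ h', hyperbolicExtension hA hxy c d h' = h := by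
  have hm : ∀ v ∈ pairOrthogonal B x y, h v ∈ pairOrthogonal B x y := by
    intro v hv
    rw [mem_pairOrthogonal] at hv ⊢
    have h1 := hh x v
    have h2 := hh y v
    rw [hx, map_smul, LinearMap.smul_apply, smul_eq_mul, hv.1] at h1
    rw [hy, map_smul, LinearMap.smul_apply, smul_eq_mul, hv.2] at h2
    exact ⟨(mul_eq_zero.1 h1).resolve_left (left_ne_zero_of_mul_eq_one hcd),
      (mul_eq_zero.1 h2).resolve_left (right_ne_zero_of_mul_eq_one hcd)⟩
  refine ⟨h.restrict hm, LinearMap.ext fun v => ?_⟩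
  obtain ⟨p, rfl⟩ := (hyperbolicSplitting B hA hxy).surjective v
  rw [hyperbolicExtension_apply, hyperbolicSplitting_apply, hyperbolicSplitting_apply]
  simp only [map_add, map_smul, hx, hy, smul_smul, mul_comm, LinearMap.coe_restrict_apply]

theorem hyperbolicExtension_fst (hA : ∀ v, B v v = 0) (hxy : B x y = 1) (c d : F)
    (h : pairOrthogonal B x y →ₗ[F] pairOrthogonal B x y) :
    hyperbolicExtension hA hxy c d h x = c • x := by
  have := hyperbolicExtension_apply hA hxy c d h ((1, 0), 0)
  rw [hyperbolicSplitting_apply, hyperbolicSplitting_apply] at this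
  simpa using this

theorem hyperbolicExtension_snd (hA : ∀ v, B v v = 0) (hxy : B x y = 1) (c d : F)
    (h : pairOrthogonal B x y →ₗ[F] pairOrthogonal B x y) :
    hyperbolicExtension hA hxy c d h y = d • y := by
  have := hyperbolicExtension_apply hA hxy c d h ((0, 1), 0)
  rw [hyperbolicSplitting_apply, hyperbolicSplitting_apply] at this
  simpa using this

theorem finrank_eigenspace_hyperbolicExtension [Module.Finite F V] (hA : ∀ v, B v v = 0)
    (hxy : B x y = 1) (h : pairOrthogonal B x y →ₗ[F] pairOrthogonal B x y) :
    Module.finrank F (Module.End.eigenspace (hyperbolicExtension hA hxy 1 1 h) 1) =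
      Module.finrank F (Module.End.eigenspace h 1) + 2 := by
  let E := hyperbolicSplitting B hA hxy
  have e : ((F × F) × Module.End.eigenspace h 1) ≃ₗ[F]
      Module.End.eigenspace (hyperbolicExtension hA hxy 1 1 h) 1 :=
    LinearEquiv.ofBijective
      (LinearMap.codRestrict _ (E.toLinearMap ∘ₗ
        LinearMap.prodMap LinearMap.id (Submodule.subtype _)) fun p => by
        have hp := Module.End.mem_eigenspace_iff.1 p.2.2
        rw [one_smul] at hp
        rw [Module.End.mem_eigenspace_iff, one_smul]
        refine (hyperbolicExtension_apply hA hxy 1 1 h _).trans ?_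
        rw [one_mul, one_mul]
        exact congrArg E (Prod.ext rfl hp))
      ⟨fun p p' hp => by
        have h1 := E.injective (Subtype.ext_iff.1 hp)
        exact Prod.ext (Prod.ext_iff.1 h1).1 (Subtype.ext (Prod.ext_iff.1 h1).2), fun v => by
        obtain ⟨v, hv⟩ := v
        obtain ⟨p, rfl⟩ := E.surjective v
        rw [Module.End.mem_eigenspace_iff, one_smul, hyperbolicExtension_apply] at hv
        have h1 := (Prod.ext_iff.1 (E.injective hv)).2
        exact ⟨(p.1, ⟨p.2, by rw [Module.End.mem_eigenspace_iff, one_smul]; exact h1⟩), rfl⟩⟩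
  rw [← e.finrank_eq, Module.finrank_prod, Module.finrank_prod, Module.finrank_self, add_comm]

theorem natCard_isometrySqrt_extending (hA : ∀ v, B v v = 0) (hxy : B x y = 1) {c d : F}
    (hcd : c * d = 1) (hcd' : c * c = d * d) (P : (V →ₗ[F] V) → Prop) :
    Nat.card {h : {h // h ∈ isometrySqrt B (c * c) ∧ P h} // h.1 x = c • x ∧ h.1 y = d • y} =
      Nat.card {h // h ∈ isometrySqrt (B.restrict (pairOrthogonal B x y)) (c * c) ∧
        P (hyperbolicExtension hA hxy c d h)} := by
  symm
  refine Nat.card_eq_of_bijective (fun h => ⟨⟨hyperbolicExtension hA hxy c d h.1,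
    (hyperbolicExtension_mem_isometrySqrt_iff hA hxy hcd hcd' h.1).2 h.2.1, h.2.2⟩,
    hyperbolicExtension_fst hA hxy c d h.1, hyperbolicExtension_snd hA hxy c d h.1⟩)
    ⟨fun h h' e => ?_, fun h => ?_⟩
  · exact Subtype.ext (hyperbolicExtension_injective hA hxy c d
      (Subtype.ext_iff.1 (Subtype.ext_iff.1 e)))
  · obtain ⟨⟨h, h1, h2⟩, hx, hy⟩ := h
    obtain ⟨h', rfl⟩ := exists_hyperbolicExtension_eq hA hxy hcd h1.1 hx hy
    exact ⟨⟨h', (hyperbolicExtension_mem_isometrySqrt_iff hA hxy hcd hcd' h').1 h1, h2⟩, rfl⟩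

end

section

open scoped Classical
variable {F : Type*} [Field F] {V : Type*} [AddCommGroup V] [Module F V]
  {B : LinearMap.BilinForm F V} {h : V →ₗ[F] V} {c d : F}

theorem add_smul_apply_mem_eigenspace (hcd : c * d = 1) (hcd' : c * c = d * d)
    (hh : ∀ v, h (h v) = (c * c) • v) (w : V) : w + c • h w ∈ Module.End.eigenspace h d := by
  rw [Module.End.mem_eigenspace_iff, map_add, map_smul, hh, smul_smul, smul_add, smul_smul,
    show c * (c * c) = d by rw [hcd', ← mul_assoc, hcd, one_mul], mul_comm d c, hcd, one_smul,
    add_comm]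

theorem sub_smul_apply_mem_eigenspace (hcd : c * d = 1) (hcd' : c * c = d * d)
    (hh : ∀ v, h (h v) = (c * c) • v) (w : V) : w - c • h w ∈ Module.End.eigenspace h (-d) := by
  rw [Module.End.mem_eigenspace_iff, map_sub, map_smul, hh, smul_smul, smul_sub, smul_smul,
    show c * (c * c) = d by rw [hcd', ← mul_assoc, hcd, one_mul], neg_mul, mul_comm d c, hcd,
    neg_smul, neg_smul, one_smul]
  abel

theorem eq_zero_of_pairing_eigenspace (h2 : (2 : F) ≠ 0) (hB : ∀ v, (∀ w, B v w = 0) → v = 0)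
    (hcd : c * d = 1) (hcd' : c * c = d * d) (hh : h ∈ isometrySqrt B (c * c)) {v : V}
    (hv : v ∈ Module.End.eigenspace h c) (hvw : ∀ w ∈ Module.End.eigenspace h d, B v w = 0) :
    v = 0 := by
  refine hB v fun w => ?_
  have e1 := hvw _ (add_smul_apply_mem_eigenspace hcd hcd' hh.2 w)
  have h1 := sub_smul_apply_mem_eigenspace hcd hcd' hh.2 w
  have e2 := hh.1 v (w - c • h w)
  rw [Module.End.mem_eigenspace_iff.1 hv, Module.End.mem_eigenspace_iff.1 h1, map_smul,
    map_smul, LinearMap.smul_apply, smul_eq_mul, smul_eq_mul] at e2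
  rw [map_add] at e1
  rw [map_sub] at e2
  refine (mul_eq_zero.1 ?_).resolve_left (mul_ne_zero h2 h2)
  linear_combination 2 * e1 - e2 - (B v w - B v (c • h w)) * hcd

theorem finrank_eigenspace_le [Module.Finite F V] (h2 : (2 : F) ≠ 0)
    (hB : ∀ v, (∀ w, B v w = 0) → v = 0) (hcd : c * d = 1) (hcd' : c * c = d * d)
    (hh : h ∈ isometrySqrt B (c * c)) :
    Module.finrank F (Module.End.eigenspace h c) ≤ Module.finrank F (Module.End.eigenspace h d) := by
  rw [← Subspace.dual_finrank_eq (V := Module.End.eigenspace h d)]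
  refine LinearMap.finrank_le_finrank_of_injective
    (f := LinearMap.domRestrict₁₂ B (Module.End.eigenspace h c) (Module.End.eigenspace h d)) ?_
  refine (injective_iff_map_eq_zero _).2 fun v hv => Subtype.ext ?_
  refine eq_zero_of_pairing_eigenspace h2 hB hcd hcd' hh v.2 fun w hw => ?_
  exact LinearMap.congr_fun hv ⟨w, hw⟩

theorem finrank_eigenspace_eq [Module.Finite F V] (h2 : (2 : F) ≠ 0)
    (hB : ∀ v, (∀ w, B v w = 0) → v = 0) (hcd : c * d = 1) (hcd' : c * c = d * d)
    (hh : h ∈ isometrySqrt B (c * c)) :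
    Module.finrank F (Module.End.eigenspace h c) = Module.finrank F (Module.End.eigenspace h d) :=
  (finrank_eigenspace_le h2 hB hcd hcd' hh).antisymm
    (finrank_eigenspace_le h2 hB ((mul_comm _ _).trans hcd) hcd'.symm (hcd' ▸ hh))

theorem two_mul_finrank_eigenspace [Module.Finite F V] (h2 : (2 : F) ≠ 0)
    (hB : ∀ v, (∀ w, B v w = 0) → v = 0) (hc : c * c = -1)
    (hh : h ∈ isometrySqrt B (c * c)) :
    2 * Module.finrank F (Module.End.eigenspace h c) = Module.finrank F V := by
  have hcd : c * -c = 1 := by rw [mul_neg, hc, neg_neg]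
  have hcd' : c * c = -c * -c := (neg_mul_neg c c).symm
  have hc0 : c ≠ 0 := left_ne_zero_of_mul_eq_one hcd
  have hcomp : IsCompl (Module.End.eigenspace h c) (Module.End.eigenspace h (-c)) := by
    constructor
    · rw [Submodule.disjoint_def]
      intro v hv hv'
      rw [Module.End.mem_eigenspace_iff] at hv hv'
      have : (2 * c) • v = 0 := by
        have h5 : c • v = -(c • v) := by rw [← neg_smul, ← hv', hv]
        rw [two_mul, add_smul]
        nth_rewrite 1 [h5]
        exact neg_add_cancel _
      exact (smul_eq_zero.1 this).resolve_left (mul_ne_zero h2 hc0)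
    · rw [codisjoint_iff, eq_top_iff]
      intro w _
      have h1 := add_smul_apply_mem_eigenspace hcd hcd' hh.2 w
      have h3 := sub_smul_apply_mem_eigenspace hcd hcd' hh.2 w
      rw [neg_neg] at h3
      have h4 : (2 : F) • w ∈ Module.End.eigenspace h c ⊔ Module.End.eigenspace h (-c) := by
        rw [show (2 : F) • w = (w - c • h w) + (w + c • h w) by rw [two_smul]; abel]
        exact Submodule.add_mem_sup h3 h1
      have := Submodule.smul_mem _ (2 : F)⁻¹ h4
      rwa [smul_smul, inv_mul_cancel₀ h2, one_smul] at this
  rw [← Submodule.finrank_add_eq_of_isCompl hcomp, ← finrank_eigenspace_eq h2 hB hcd hcd' hh,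
    two_mul]

variable [Finite F]

theorem natCard_hyperbolic_pairs_eigenspace [Module.Finite F V] (h2 : (2 : F) ≠ 0)
    (hB : ∀ v, (∀ w, B v w = 0) → v = 0) (hcd : c * d = 1) (hcd' : c * c = d * d)
    (hh : h ∈ isometrySqrt B (c * c)) :
    Nat.card {p : {p : V × V // B p.1 p.2 = 1} // h p.1.1 = c • p.1.1 ∧ h p.1.2 = d • p.1.2} =
      (Nat.card F ^ Module.finrank F (Module.End.eigenspace h c) - 1) *
        Nat.card F ^ (Module.finrank F (Module.End.eigenspace h c) - 1) := by
  conv_rhs =>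
    arg 2
    rw [finrank_eigenspace_eq h2 hB hcd hcd' hh]
  rw [← LinearMap.natCard_pairs_one
    (LinearMap.domRestrict₁₂ B (Module.End.eigenspace h c) (Module.End.eigenspace h d))
    fun v hv => Subtype.ext (eq_zero_of_pairing_eigenspace h2 hB hcd hcd' hh v.2
      fun w hw => hv ⟨w, hw⟩)]
  exact Nat.card_congr
    { toFun := fun p => ⟨(⟨p.1.1.1, Module.End.mem_eigenspace_iff.2 p.2.1⟩,
        ⟨p.1.1.2, Module.End.mem_eigenspace_iff.2 p.2.2⟩), p.1.2⟩
      invFun := fun p => ⟨⟨(p.1.1, p.1.2), p.2⟩, Module.End.mem_eigenspace_iff.1 p.1.1.2,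
        Module.End.mem_eigenspace_iff.1 p.1.2.2⟩
      left_inv := fun _ => rfl
      right_inv := fun _ => rfl }

theorem natCard_isometrySqrt_mul [Module.Finite F V] (h2 : (2 : F) ≠ 0)
    (hA : ∀ v, B v v = 0)
    (hB : ∀ v, (∀ w, B v w = 0) → v = 0) (hcd : c * d = 1) (hcd' : c * c = d * d)
    (P : (V →ₗ[F] V) → Prop) {D m : ℕ}
    (hP : ∀ h ∈ isometrySqrt B (c * c), P h → Module.finrank F (Module.End.eigenspace h c) = D)
    (hm : ∀ x y (hxy : B x y = 1),
      Nat.card {h // h ∈ isometrySqrt (B.restrict (pairOrthogonal B x y)) (c * c) ∧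
        P (hyperbolicExtension hA hxy c d h)} = m) :
    Nat.card {h // h ∈ isometrySqrt B (c * c) ∧ P h} *
        ((Nat.card F ^ D - 1) * Nat.card F ^ (D - 1)) =
      (Nat.card F ^ Module.finrank F V - 1) * Nat.card F ^ (Module.finrank F V - 1) * m := by
  have : Finite V := Module.finite_of_finite F
  have : Finite (V →ₗ[F] V) := DFunLike.finite _
  rw [← LinearMap.natCard_pairs_one B hB]
  refine Nat.card_mul_eq_card_mul_of_rel
    (fun (h : {h // h ∈ isometrySqrt B (c * c) ∧ P h}) (p : {p : V × V // B p.1 p.2 = 1}) =>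
      h.1 p.1.1 = c • p.1.1 ∧ h.1 p.1.2 = d • p.1.2) (fun h => ?_) fun p => ?_
  · rw [natCard_hyperbolic_pairs_eigenspace h2 hB hcd hcd' h.2.1, hP h.1 h.2.1 h.2.2]
  · rw [← hm p.1.1 p.1.2 p.2, ← natCard_isometrySqrt_extending hA p.2 hcd hcd' P]

end

section

open scoped Classical

theorem gbinom_succ_succ (n k : ℕ) (q : ℝ) :
    gbinom (n + 1) (k + 1) q =
      gbinom n k q * ((q ^ (n + 1 - (k + 1) + (k + 1)) - 1) / (q ^ (k + 1) - 1)) := by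
  unfold gbinom
  rw [Finset.prod_Icc_succ_top (by omega)]
  simp only [Nat.add_sub_add_right]

theorem natCard_isometrySqrt_eigenspace_eq_zero {F V : Type*} [Field F] [AddCommGroup V]
    [Module F V] [Module.Finite F V] (h2 : (2 : F) ≠ 0) (B : LinearMap.BilinForm F V) :
    Nat.card {h // h ∈ isometrySqrt B (1 * 1) ∧
      Module.finrank F (Module.End.eigenspace h 1) = 0} = 1 := by
  have hneg : Module.End.eigenspace (-LinearMap.id : V →ₗ[F] V) 1 = ⊥ := by
    rw [eq_bot_iff]
    intro v hv
    rw [Module.End.mem_eigenspace_iff, one_smul, LinearMap.neg_apply, LinearMap.id_apply] at hv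
    have : (2 : F) • v = 0 := by
      rw [two_smul]
      nth_rewrite 1 [← hv]
      exact neg_add_cancel v
    exact (smul_eq_zero.1 this).resolve_left h2
  rw [Nat.card_eq_one_iff_unique]
  refine ⟨⟨fun g h => ?_⟩, ⟨⟨-LinearMap.id, ⟨fun v w => ?_, fun v => ?_⟩, ?_⟩⟩⟩
  · have key : ∀ h : {h // h ∈ isometrySqrt B (1 * 1) ∧
        Module.finrank F (Module.End.eigenspace h 1) = 0}, ∀ v, h.1 v = -v := by
      intro h v
      have h1 := add_smul_apply_mem_eigenspace (one_mul (1 : F)) rfl h.2.1.2 v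
      rw [Submodule.finrank_eq_zero.1 h.2.2, Submodule.mem_bot, one_smul] at h1
      exact eq_neg_of_add_eq_zero_right h1
    exact Subtype.ext (LinearMap.ext fun v => (key g v).trans (key h v).symm)
  · simp
  · simp
  · rw [hneg, finrank_bot]

universe u
variable {F : Type*} [Field F] [Finite F]

theorem natCard_isometrySqrt_one_eigenspace (h2 : (2 : F) ≠ 0) (n : ℕ) : ∀ (k : ℕ) (_ : k ≤ n)
    {V : Type u} [AddCommGroup V] [Module F V] [Module.Finite F V]
    (B : LinearMap.BilinForm F V) (_ : ∀ v, B v v = 0) (_ : ∀ v, (∀ w, B v w = 0) → v = 0)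
    (_ : Module.finrank F V = 2 * n),
    (Nat.card {h // h ∈ isometrySqrt B (1 * 1) ∧
      Module.finrank F (Module.End.eigenspace h 1) = 2 * k} : ℝ) =
      (Nat.card F : ℝ) ^ (2 * k * (n - k)) * gbinom n k ((Nat.card F : ℝ) ^ 2) := by
  have hq : (1 : ℝ) < Nat.card F := by exact_mod_cast Finite.one_lt_card
  induction n with
  | zero =>
    intro k hk V _ _ _ B hA hB hV
    obtain rfl : k = 0 := by omega
    rw [natCard_isometrySqrt_eigenspace_eq_zero h2 B]
    simp [gbinom]
  | succ n ih =>
    intro k hk V _ _ _ B hA hB hV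
    rcases k with _ | k
    · rw [natCard_isometrySqrt_eigenspace_eq_zero h2 B]
      simp [gbinom]
    · obtain ⟨m, hm⟩ : ∃ m : ℕ, (m : ℝ) = (Nat.card F : ℝ) ^ (2 * k * (n - k)) *
          gbinom n k ((Nat.card F : ℝ) ^ 2) := by
        have : Nontrivial V := by
          apply Module.nontrivial_of_finrank_pos (R := F)
          omega
        obtain ⟨x, y, hxy⟩ := exists_hyperbolic_pair hB
        have hd := finrank_pairOrthogonal hA hxy
        exact ⟨_, ih k (by omega) (B.restrict (pairOrthogonal B x y)) (fun v => hA v)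
          (nondegenerate_pairOrthogonal hA hB hxy) (by omega)⟩
      have key := natCard_isometrySqrt_mul h2 hA hB (one_mul (1 : F)) rfl
        (fun h => Module.finrank F (Module.End.eigenspace h 1) = 2 * (k + 1)) (m := m)
        (fun h _ hh => hh) fun x y hxy => by
        have hd := finrank_pairOrthogonal hA hxy
        have := ih k (by omega) (B.restrict (pairOrthogonal B x y)) (fun v => hA v)
          (nondegenerate_pairOrthogonal hA hB hxy) (by omega)
        rw [← hm, Nat.cast_inj] at this
        rw [← this]
        refine Nat.card_congr (Equiv.subtypeEquivRight fun h => and_congr_right fun _ => ?_)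
        rw [finrank_eigenspace_hyperbolicExtension]
        omega
      rw [gbinom_succ_succ, Nat.sub_add_cancel hk, Nat.add_sub_add_right]
      rw [hV] at key
      have hpos : ∀ j, 0 < j → 1 < (Nat.card F : ℝ) ^ j := fun j hj => one_lt_pow₀ hq hj.ne'
      have key' := congrArg (Nat.cast : ℕ → ℝ) key
      have h1 : ∀ j, 1 ≤ Nat.card F ^ j := fun j => Nat.one_le_pow _ _ Nat.card_pos
      push_cast [Nat.cast_sub (h1 _)] at key'
      rw [hm] at key'
      have hk1 := hpos (2 * (k + 1)) (by omega)
      rw [← pow_mul, ← pow_mul]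
      generalize hQ : (Nat.card F : ℝ) = Q at *
      have hne : Q ^ (2 * (k + 1)) - 1 ≠ 0 := by linarith
      have hne' : Q ^ (2 * (k + 1) - 1) ≠ 0 := by positivity
      refine mul_right_cancel₀ (mul_ne_zero hne hne') (key'.trans ?_)
      have e1 : 2 * (n + 1) - 1 + 2 * k * (n - k) = 2 * (k + 1) * (n - k) + (2 * (k + 1) - 1) := by
        obtain ⟨j, rfl⟩ := Nat.exists_eq_add_of_le (Nat.succ_le_succ_iff.1 hk)
        rw [Nat.add_sub_cancel_left]
        have : 2 * (k + 1) * j = 2 * k * j + 2 * j := by ring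
        omega
      have e2 := congrArg (fun j => Q ^ j) e1
      simp only [pow_add Q] at e2
      field_simp
      linear_combination (Q ^ (2 * (n + 1)) - 1) * gbinom n k (Q ^ 2) * e2

theorem natCard_isometrySqrt_neg_one (h2 : (2 : F) ≠ 0) {c : F} (hc : c * c = -1) (n : ℕ) :
    ∀ {V : Type u} [AddCommGroup V] [Module F V] [Module.Finite F V]
    (B : LinearMap.BilinForm F V) (_ : ∀ v, B v v = 0) (_ : ∀ v, (∀ w, B v w = 0) → v = 0)
    (_ : Module.finrank F V = 2 * n),
    (Nat.card {h // h ∈ isometrySqrt B (c * c) ∧ True} : ℝ) =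
      (Nat.card F : ℝ) ^ (n * (n + 1) / 2) * ∏ i ∈ Finset.Icc 1 n, ((Nat.card F : ℝ) ^ i + 1) := by
  have hq : (1 : ℝ) < Nat.card F := by exact_mod_cast Finite.one_lt_card
  have hcd : c * -c = 1 := by rw [mul_neg, hc, neg_neg]
  have hcd' : c * c = -c * -c := (neg_mul_neg c c).symm
  induction n with
  | zero =>
    intro V _ _ _ B hA hB hV
    have : Subsingleton V := Module.finrank_zero_iff.1 hV
    have h0 : (0 : V →ₗ[F] V) ∈ isometrySqrt B (c * c) := by
      refine ⟨fun v w => ?_, fun v => Subsingleton.elim _ _⟩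
      rw [Subsingleton.elim (0 : V →ₗ[F] V) LinearMap.id]
      rfl
    rw [Nat.card_eq_one_iff_unique.2 ⟨⟨fun g h => Subtype.ext (LinearMap.ext fun v =>
      Subsingleton.elim _ _)⟩, ⟨⟨0, h0, trivial⟩⟩⟩]
    simp
  | succ n ih =>
    intro V _ _ _ B hA hB hV
    obtain ⟨m, hm⟩ : ∃ m : ℕ, (m : ℝ) = (Nat.card F : ℝ) ^ (n * (n + 1) / 2) *
        ∏ i ∈ Finset.Icc 1 n, ((Nat.card F : ℝ) ^ i + 1) := by
      have : Nontrivial V := by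
        apply Module.nontrivial_of_finrank_pos (R := F)
        omega
      obtain ⟨x, y, hxy⟩ := exists_hyperbolic_pair hB
      have hd := finrank_pairOrthogonal hA hxy
      exact ⟨_, ih (B.restrict (pairOrthogonal B x y)) (fun v => hA v)
        (nondegenerate_pairOrthogonal hA hB hxy) (by omega)⟩
    have key := natCard_isometrySqrt_mul h2 hA hB hcd hcd'
      (fun h => True) (m := m) (D := n + 1)
      (fun h hh _ => by
        have := two_mul_finrank_eigenspace h2 hB hc hh
        omega) fun x y hxy => by
      have hd := finrank_pairOrthogonal hA hxy
      have := ih (B.restrict (pairOrthogonal B x y)) (fun v => hA v)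
        (nondegenerate_pairOrthogonal hA hB hxy) (by omega)
      rwa [← hm, Nat.cast_inj] at this
    rw [hV] at key
    have key' := congrArg (Nat.cast : ℕ → ℝ) key
    have h1 : ∀ j, 1 ≤ Nat.card F ^ j := fun j => Nat.one_le_pow _ _ Nat.card_pos
    push_cast [Nat.cast_sub (h1 _)] at key'
    rw [hm] at key'
    have hk1 : 1 < (Nat.card F : ℝ) ^ (n + 1) := one_lt_pow₀ hq (by omega)
    rw [Finset.prod_Icc_succ_top (by omega)]
    generalize hQ : (Nat.card F : ℝ) = Q at *
    have hne : Q ^ (n + 1) - 1 ≠ 0 := by linarith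
    have hne' : Q ^ (n + 1 - 1) ≠ 0 := by positivity
    refine mul_right_cancel₀ (mul_ne_zero hne hne') (key'.trans ?_)
    have e1 : (n + 1) * (n + 1 + 1) / 2 = n * (n + 1) / 2 + (n + 1) := by
      rw [← Nat.add_mul_div_left _ _ two_pos]
      congr 1
      ring
    rw [e1, show 2 * (n + 1) - 1 = (n + 1) + n by omega, two_mul, Nat.add_sub_cancel, pow_add Q,
      pow_add Q, pow_add Q]
    ring

end

section

open scoped Classical
universe u
variable {F : Type*} [Field F]

theorem even_finrank_eigenspace {V : Type*} [AddCommGroup V] [Module F V] [Module.Finite F V]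
    (h2 : (2 : F) ≠ 0) {B : LinearMap.BilinForm F V} (hA : ∀ v, B v v = 0)
    (hB : ∀ v, (∀ w, B v w = 0) → v = 0) {h : V →ₗ[F] V} (hh : h ∈ isometrySqrt B (1 * 1)) :
    Even (Module.finrank F (Module.End.eigenspace h 1)) := by
  refine even_finrank_of_alternating _ (B.restrict (Module.End.eigenspace h 1)) (fun v => hA v)
    (fun v hv => Subtype.ext ?_) rfl
  exact eq_zero_of_pairing_eigenspace h2 hB (one_mul 1) rfl hh v.2 fun w hw => hv ⟨w, hw⟩

theorem natCard_isometrySqrt_one [Finite F] (h2 : (2 : F) ≠ 0) {n : ℕ}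
    {V : Type u} [AddCommGroup V] [Module F V] [Module.Finite F V]
    (B : LinearMap.BilinForm F V) (hA : ∀ v, B v v = 0) (hB : ∀ v, (∀ w, B v w = 0) → v = 0)
    (hV : Module.finrank F V = 2 * n) :
    (Nat.card {h // h ∈ isometrySqrt B (1 * 1)} : ℝ) = ∑ k ∈ Finset.range (n + 1),
      (Nat.card F : ℝ) ^ (2 * k * (n - k)) * gbinom n k ((Nat.card F : ℝ) ^ 2) := by
  have : Finite V := Module.finite_of_finite F
  have : Finite (V →ₗ[F] V) := DFunLike.finite _
  have := Fintype.ofFinite (V →ₗ[F] V)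
  rw [Nat.card_eq_fintype_card, Fintype.card_subtype, Finset.card_eq_sum_card_fiberwise
    (f := fun h => Module.finrank F (Module.End.eigenspace h 1) / 2) (t := Finset.range (n + 1))
    fun h _ => ?_, Nat.cast_sum]
  · refine Finset.sum_congr rfl fun k hk => ?_
    rw [Finset.mem_range] at hk
    rw [← natCard_isometrySqrt_one_eigenspace h2 n k (by omega) B hA hB hV,
      Nat.card_eq_fintype_card, Fintype.card_subtype, Finset.filter_filter]
    congr 2
    refine Finset.filter_congr fun h _ => and_congr_right fun hh => ?_
    have := even_finrank_eigenspace h2 hA hB hh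
    obtain ⟨r, hr⟩ := this
    omega
  · have := Submodule.finrank_le (Module.End.eigenspace h 1)
    rw [Finset.coe_range, Set.mem_Iio]
    beta_reduce
    omega

end

section

open scoped Classical
open CategoryTheory

variable {G : Type} [Group G] [Fintype G]

theorem FDRep.exists_smul_of_simple (V : FDRep ℂ G) [Simple V] (f : V →ₗ[ℂ] V)
    (hf : ∀ g v, f (V.ρ g v) = V.ρ g (f v)) : ∃ c : ℂ, ∀ v, f v = c • v := by
  let φ : V ⟶ V := ⟨FGModuleCat.ofHom f, fun g => by
    ext v
    exact hf g v⟩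
  have h1 := finrank_endomorphism_simple_eq_one ℂ V
  obtain ⟨c, hc⟩ := (finrank_eq_one_iff_of_nonzero' (𝟙 V) (id_nonzero V)).1 h1 φ
  exact ⟨c, fun v => (congrArg (fun ψ : V ⟶ V => ψ.hom.hom.hom v) hc).symm⟩

theorem FDRep.isIrr_of_simple (V : FDRep ℂ G) [Simple V] : IsIrr V.ρ := by
  refine ⟨?_, fun U hU => ?_⟩
  · by_contra h
    rw [not_nontrivial_iff_subsingleton] at h
    have h1 := (FDRep.simple_iff_char_is_norm_one V).1 inferInstance
    have h2 : ∀ g, V.character g = 0 := fun g => by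
      rw [FDRep.character, Subsingleton.elim (V.ρ g) 0, map_zero]
    simp only [h2, mul_zero, Finset.sum_const_zero] at h1
    exact Nat.cast_ne_zero.2 Nat.card_pos.ne' h1.symm
  · obtain ⟨Y, hY, hUY⟩ := exists_isCompl_invariant U hU
    have hf : ∀ v, ∃ u ∈ U, ∃ y ∈ Y, u + y = v := fun v =>
      Submodule.mem_sup.1 (hUY.sup_eq_top ▸ Submodule.mem_top)
    let f : V →ₗ[ℂ] V := U.subtype ∘ₗ Submodule.projectionOnto U Y hUY
    have hfU : ∀ u ∈ U, f u = u := fun u hu =>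
      congrArg Subtype.val (Submodule.projectionOnto_apply_left hUY ⟨u, hu⟩)
    have hfY : ∀ y ∈ Y, f y = 0 := fun y hy =>
      congrArg Subtype.val (Submodule.projectionOnto_apply_right hUY ⟨y, hy⟩)
    obtain ⟨c, hc⟩ := V.exists_smul_of_simple f fun g v => by
      obtain ⟨u, hu, y, hy, rfl⟩ := hf v
      rw [map_add, map_add, map_add, hfU u hu, hfY y hy, hfU _ (hU g u hu), hfY _ (hY g y hy),
        add_zero, add_zero]
    by_cases h0 : c = 0
    · left
      rw [eq_bot_iff]
      intro u hu
      rw [Submodule.mem_bot, ← hfU u hu, hc, h0, zero_smul]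
    · right
      have : Y = ⊥ := by
        rw [eq_bot_iff]
        intro y hy
        have := hfY y hy
        rw [hc] at this
        exact (smul_eq_zero.1 this).resolve_left h0
      rw [← hUY.sup_eq_top, this, sup_bot_eq]

theorem IsIrr.simple_of {V : Type} [AddCommGroup V] [Module ℂ V] [FiniteDimensional ℂ V]
    {ρ : Representation ℂ G V} (h : IsIrr ρ) : Simple (FDRep.of ρ) := by
  rw [FDRep.simple_iff_char_is_norm_one, Nat.card_eq_fintype_card, ← h.sum_character_sq]
  rfl

variable {ι : Type} [Fintype ι] (R : ι → FDRep ℂ G)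

theorem exists_character_eq_sum
    (hcomplete : ∀ ρ : FDRep ℂ G, Simple ρ → ∃ i, Nonempty (ρ ≅ R i)) (n : ℕ) :
    ∀ {V : Type} [AddCommGroup V] [Module ℂ V] [FiniteDimensional ℂ V]
      (ρ : Representation ℂ G V), Module.finrank ℂ V = n →
      ∃ m : ι → ℂ, ∀ g, ρ.character g = ∑ i, m i * (R i).character g := by
  induction n using Nat.strong_induction_on with
  | _ n ih =>
    intro V _ _ _ ρ hn
    rcases subsingleton_or_nontrivial V with _ | _
    · refine ⟨0, fun g => ?_⟩
      rw [Representation.character, Subsingleton.elim (ρ g) 0, map_zero]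
      simp
    · obtain ⟨W, -, hW0, hW, hmin⟩ := exists_minimal_invariant (ρ := ρ) ⊤
        (fun _ _ _ => Submodule.mem_top) top_ne_bot
      obtain ⟨Y, hY, hWY⟩ := exists_isCompl_invariant W hW
      have hfr := Submodule.finrank_add_eq_of_isCompl hWY
      have hpos : 0 < Module.finrank ℂ W :=
        Nat.pos_of_ne_zero fun h => hW0 (Submodule.finrank_eq_zero.1 h)
      obtain ⟨m, hm⟩ := ih _ (by omega) (subRep ρ Y hY) rfl
      obtain ⟨i, ⟨e⟩⟩ := hcomplete _ (irr_subRep hW0 hW hmin).simple_of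
      refine ⟨m + Pi.single i 1, fun g => ?_⟩
      rw [character_eq_add_of_isCompl hW hY hWY, hm g]
      simp only [Pi.add_apply, add_mul, Finset.sum_add_distrib]
      rw [add_comm]
      congr 1
      rw [Finset.sum_eq_single i (fun j _ hj => by rw [Pi.single_eq_of_ne hj, zero_mul])
        (fun h => absurd (Finset.mem_univ i) h), Pi.single_eq_same, one_mul, ← FDRep.char_iso e]
      rfl

theorem sum_finrank_mul_character (hsimple : ∀ i, Simple (R i))
    (hdistinct : ∀ i j : ι, Nonempty (R i ≅ R j) → i = j)
    (hcomplete : ∀ ρ : FDRep ℂ G, Simple ρ → ∃ i, Nonempty (ρ ≅ R i)) (g : G) :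
    ∑ i, (Module.finrank ℂ (R i) : ℂ) * (R i).character g =
      if g = 1 then (Fintype.card G : ℂ) else 0 := by
  obtain ⟨n, σ, hσ⟩ := isRepChar_card_fixed (K := G) (X := G)
  have hreg : ∀ k, σ.character k = if k = 1 then (Fintype.card G : ℂ) else 0 := by
    intro k
    rw [← congrFun hσ k, ← Nat.cast_zero, ← Nat.cast_ite, Nat.cast_inj]
    split_ifs with hk
    · rw [Fintype.card_subtype]
      simp [hk]
    · rw [Fintype.card_eq_zero_iff]
      exact ⟨fun y => hk (mul_eq_right.1 (y.2 : k * y.1 = y.1))⟩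
  obtain ⟨m, hm⟩ := exists_character_eq_sum R hcomplete _ σ rfl
  have hcard : (Nat.card G : ℂ) ≠ 0 := Nat.cast_ne_zero.2 Nat.card_pos.ne'
  have := invertibleOfNonzero hcard
  have key : ∀ j, (Module.finrank ℂ (R j) : ℂ) = m j := by
    intro j
    have := hsimple
    have h1 : (Nat.card G : ℂ)⁻¹ * ∑ k, σ.character k * (R j).character k⁻¹ = m j := by
      simp only [hm, Finset.sum_mul, mul_assoc]
      rw [Finset.sum_comm, Finset.mul_sum]
      simp only [← Finset.mul_sum, mul_left_comm _ (m _), FDRep.char_orthonormal]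
      rw [Finset.sum_eq_single j (fun i _ hi => by
        rw [if_neg fun h => hi (hdistinct i j h), mul_zero])
        (fun h => absurd (Finset.mem_univ j) h), if_pos ⟨Iso.refl _⟩, mul_one]
    rw [← h1]
    simp only [hreg, ite_mul, zero_mul, Finset.sum_ite_eq', Finset.mem_univ, if_true]
    rw [inv_one, FDRep.char_one, ← Nat.card_eq_fintype_card, inv_mul_cancel_left₀ hcard]
  simp only [key, ← hreg, hm]

/-- Sums of dimensions over the representations with a given indicator. -/
theorem sum_finrank_filter (hsimple : ∀ i, Simple (R i))
    (hdistinct : ∀ i j : ι, Nonempty (R i ≅ R j) → i = j)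
    (hcomplete : ∀ ρ : FDRep ℂ G, Simple ρ → ∃ i, Nonempty (ρ ≅ R i)) {z : G}
    (hzz : z * z = 1) {c : ι → ℂ} (hc : ∀ i, c i = 1 ∨ c i = -1)
    (hcz : ∀ i g, (R i).character (g * z) = c i * (R i).character g)
    (hcs : ∀ i, ∑ g, (R i).character (g * g) = c i * Fintype.card G)
    {δ : ℂ} (hδ : δ = 1 ∨ δ = -1) :
    ∑ i ∈ Finset.univ.filter (fun i => c i = δ), (Module.finrank ℂ (R i) : ℂ) =
      (1 / 2) * (Nat.card {g : G // g * g = z} + δ * Nat.card {g : G // g * g = 1}) := by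
  have hcard : (Fintype.card G : ℂ) ≠ 0 := Nat.cast_ne_zero.2 Fintype.card_ne_zero
  have hcount : ∀ w : G, (Nat.card {g : G // g * g = w} : ℂ) * Fintype.card G =
      ∑ i, (Module.finrank ℂ (R i) : ℂ) * ∑ g, (R i).character (g * g * w⁻¹) := by
    intro w
    simp only [Finset.mul_sum]
    rw [Finset.sum_comm]
    simp only [sum_finrank_mul_character R hsimple hdistinct hcomplete, mul_inv_eq_one]
    rw [← Finset.sum_filter, Finset.sum_const, nsmul_eq_mul, Nat.card_eq_fintype_card,
      Fintype.card_subtype]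
  have hzi : z⁻¹ = z := inv_eq_of_mul_eq_one_right hzz
  have h1 := hcount 1
  have h2 := hcount z
  simp only [inv_one, mul_one, hcs, hzi, hcz] at h1 h2
  simp only [← Finset.mul_sum, hcs, ← mul_assoc, ← Finset.sum_mul] at h1 h2
  have h1' := mul_right_cancel₀ hcard h1
  have h2' := mul_right_cancel₀ hcard h2
  rw [h1', h2', Finset.sum_filter, Finset.mul_sum, ← Finset.sum_add_distrib, Finset.mul_sum]
  refine Finset.sum_congr rfl fun i _ => ?_
  rcases hc i with h | h <;> rcases hδ with rfl | rfl <;> rw [h] <;> norm_num <;> ring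

end

section

open scoped Classical
universe u

variable {F : Type*} [Field F] {V : Type u} [AddCommGroup V] [Module F V] {G : Type*} [Group G]

/-- The data identifying a group with the isometry group of a bilinear form. -/
structure IsIsometryHom (B : LinearMap.BilinForm F V) (f : G →* (V ≃ₗ[F] V)) : Prop where
  injective : Function.Injective f
  isometry : ∀ g v w, B (f g v) (f g w) = B v w
  surjective : ∀ γ : V ≃ₗ[F] V, (∀ v w, B (γ v) (γ w) = B v w) → ∃ g, f g = γ

namespace IsIsometryHom

variable {B : LinearMap.BilinForm F V} {f : G →* (V ≃ₗ[F] V)}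

theorem exists_lift_smul (hf : IsIsometryHom B f) {c : F} (hc : c * c = -1) {t : V ≃ₗ[F] V}
    (ht : ∀ v w, B (t v) (t w) = -B v w) : ∃ g, ∀ v, f g v = c • t v := by
  have hc0 : c ≠ 0 := by rintro rfl; simp at hc
  obtain ⟨g, hg⟩ := hf.surjective (LinearEquiv.smulOfNeZero F V c hc0 * t) fun v w => by
    change B (c • t v) (c • t w) = _
    rw [map_smul, map_smul, LinearMap.smul_apply, smul_smul, hc, ht, neg_one_smul, neg_neg]
  exact ⟨g, fun v => by rw [hg]; rfl⟩

theorem conj_eq {g : G} {c : F} {t : V ≃ₗ[F] V} (hg : ∀ v, f g v = c • t v) (k : G) :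
    f (g * k * g⁻¹) = t * f k * t⁻¹ := by
  rw [map_mul, map_mul, map_inv, mul_inv_eq_iff_eq_mul]
  ext v
  change f g (f k v) = t (f k (t.symm (f g v)))
  rw [hg, hg, map_smul, map_smul, map_smul, LinearEquiv.symm_apply_apply]

theorem map_mul_self {g z : G} {c : F} (hc : c * c = -1) (hz : ∀ v, f z v = -v) {t : V ≃ₗ[F] V}
    (hg : ∀ v, f g v = c • t v) (h : G) :
    f (h * g * (h * g) * z) = f h * t * (f h * t) := by
  ext v
  simp only [map_mul, LinearEquiv.mul_apply, hz, hg, map_neg, map_smul, smul_smul, hc,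
    neg_one_smul, neg_neg]

theorem exists_conj_eq_inv [Module.Finite F V] (hf : IsIsometryHom B f) (h2 : (2 : F) ≠ 0)
    (hA : ∀ v, B v v = 0) (hB : ∀ v, (∀ w, B v w = 0) → v = 0) {c : F} (hc : c * c = -1) (x : G) :
    ∃ g, g * x * g⁻¹ = x⁻¹ := by
  obtain ⟨t, -, ht, htx⟩ := exists_skew_involution_inverting h2 B hA hB (f x) (hf.isometry x)
  obtain ⟨g, hg⟩ := hf.exists_lift_smul hc ht
  exact ⟨g, hf.injective (by rw [conj_eq hg, htx, map_inv])⟩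

theorem odd_index_comap [Finite G] [Finite V] (hf : IsIsometryHom B f) (x : G)
    {T : Subgroup (V ≃ₗ[F] V)} (hTC : T ≤ isometryCentralizer B (f x)) (hT : IsPGroup 2 T)
    (hmax : ∀ Q ≤ isometryCentralizer B (f x), IsPGroup 2 Q → Nat.card Q ≤ Nat.card T) :
    Odd ((T.comap f).subgroupOf (Subgroup.centralizer {x})).index := by
  haveI : Finite (V ≃ₗ[F] V) := DFunLike.finite _
  have hT' : IsPGroup 2 ((T.comap f).subgroupOf (Subgroup.centralizer {x})) :=
    (hT.comap_of_injective f hf.injective).comap_of_injective _ (Subgroup.subtype_injective _)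
  obtain ⟨P, hP⟩ := hT'.exists_le_sylow
  let φ : Subgroup.centralizer {x} →* (V ≃ₗ[F] V) := f.comp (Subgroup.subtype _)
  have hφ : Function.Injective φ := hf.injective.comp (Subgroup.subtype_injective _)
  have hc : Nat.card (P : Subgroup (Subgroup.centralizer {x})) ≤ Nat.card T := by
    rw [Nat.card_congr (Subgroup.equivMapOfInjective (P : Subgroup _) φ hφ).toEquiv]
    refine hmax _ ?_ (P.isPGroup'.map φ)
    rintro _ ⟨y, -, rfl⟩
    refine ⟨hf.isometry _, ?_⟩
    change f y * f x = f x * f y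
    rw [← map_mul, ← map_mul, Subgroup.mem_centralizer_singleton_iff.1 y.2]
  have hm : ((T.comap f).subgroupOf (Subgroup.centralizer {x})).map φ = T := by
    refine le_antisymm (Subgroup.map_le_iff_le_comap.2 fun y hy => hy) fun u hu => ?_
    obtain ⟨g, rfl⟩ := hf.surjective u (hTC hu).1
    exact ⟨⟨g, Subgroup.mem_centralizer_singleton_iff.2 (hf.injective (by
      rw [map_mul, map_mul]; exact (hTC hu).2))⟩, hu, rfl⟩
  have he : (T.comap f).subgroupOf (Subgroup.centralizer {x}) = P := by
    refine Subgroup.eq_of_le_of_card_ge hP (hc.trans_eq ?_)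
    rw [Nat.card_congr (Subgroup.equivMapOfInjective _ φ hφ).toEquiv, hm]
  rw [he, ← Nat.not_even_iff_odd, even_iff_two_dvd]
  exact P.not_dvd_index

theorem exists_isPosInverter [Fintype G] [Finite V] (hf : IsIsometryHom B f) (h2 : (2 : F) ≠ 0)
    (hA : ∀ v, B v v = 0) (hB : ∀ v, (∀ w, B v w = 0) → v = 0) {c : F} (hc : c * c = -1) {z : G}
    (hz : ∀ v, f z v = -v) {x : G} (hx : Odd (orderOf x)) : ∃ T g, IsPosInverter z x T g := by
  haveI : Finite (V ≃ₗ[F] V) := DFunLike.finite _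
  letI := Fintype.ofFinite (V ≃ₗ[F] V)
  obtain ⟨T, hTC, hT, hmax, t, ⟨ht, htx⟩, htT, htt, hpos⟩ :=
    hasPosTwist_isometryCentralizer h2 _ V B (f x) (Nat.lt_succ_self _) hA hB (hf.isometry x)
      (by rwa [orderOf_injective f hf.injective])
  obtain ⟨g, hg⟩ := hf.exists_lift_smul hc ht
  refine ⟨T.comap f, g, fun u hu => hf.injective ?_, hT.comap_of_injective f hf.injective,
    hf.odd_index_comap x hTC hT hmax, hf.injective (by rw [conj_eq hg, htx, map_inv]),
    fun u hu => ?_, ?_, fun d => ?_⟩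
  · rw [map_mul, map_mul]
    exact (hTC hu).2.symm
  · rw [Subgroup.mem_comap, conj_eq hg]
    exact htT _ hu
  · have := map_mul_self hc hz hg 1
    rw [one_mul, map_one, one_mul] at this
    rw [Subgroup.mem_comap, this]
    exact htt
  · let e : T.comap f ≃ T := Equiv.ofBijective (fun u => ⟨f u, u.2⟩)
      ⟨fun u v huv => Subtype.ext (hf.injective (congrArg Subtype.val huv)), fun u => by
        obtain ⟨k, hk⟩ := hf.surjective u (hTC u.2).1
        exact ⟨⟨k, by rw [Subgroup.mem_comap, hk]; exact u.2⟩, Subtype.ext hk⟩⟩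
    let d' : (V ≃ₗ[F] V) → ℝ := Function.extend f d 0
    have hd' : ∀ k, d' (f k) = d k := fun k => hf.injective.extend_apply d 0 k
    refine (((isPosFamily_iff _).1 hpos).2 d').trans_eq ?_
    rw [← Equiv.sum_comp e]
    refine Finset.sum_congr rfl fun h _ => ?_
    rw [← Finset.sum_subset (Finset.subset_univ (Finset.univ.image f)) (fun γ _ hγ => by
      have : d' γ = 0 := Function.extend_apply' _ _ _ fun ⟨k, hk⟩ =>
        hγ (Finset.mem_image.2 ⟨k, Finset.mem_univ _, hk⟩)
      rw [this, zero_mul]), Finset.sum_image fun a _ b _ hab => hf.injective hab]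
    refine Finset.sum_congr rfl fun k _ => ?_
    change d' (f k) * d' (f k * (f h * t * (f h * t))) = _
    rw [← map_mul_self hc hz hg, ← map_mul, hd', hd']

end IsIsometryHom

end

section

open scoped Classical
universe u

namespace IsIsometryHom

variable {F : Type*} [Field F] {V : Type u} [AddCommGroup V] [Module F V] {G : Type*} [Group G]
  {B : LinearMap.BilinForm F V} {f : G →* (V ≃ₗ[F] V)}

theorem natCard_sqrt (hf : IsIsometryHom B f) {s : F} (hs : s ≠ 0) {z : G}
    (hz : ∀ v, f z v = s • v) :
    Nat.card {g // g * g = z} = Nat.card {h // h ∈ isometrySqrt B s} := by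
  have hfz : ∀ g, g * g = z ↔ ∀ v, f g (f g v) = s • v := fun g => by
    rw [← hf.injective.eq_iff, map_mul, LinearEquiv.ext_iff]
    exact forall_congr' fun v => by rw [hz, LinearEquiv.mul_apply]
  refine Nat.card_congr (Equiv.ofBijective
    (fun g => ⟨(f g.1 : V →ₗ[F] V), hf.isometry g.1, (hfz g.1).1 g.2⟩) ⟨fun a b hab => ?_, ?_⟩)
  · exact Subtype.ext (hf.injective (LinearEquiv.toLinearMap_injective (congrArg Subtype.val hab)))
  · rintro ⟨h, h1, h2⟩
    let γ : V ≃ₗ[F] V := LinearEquiv.ofLinearMap h (s⁻¹ • h)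
      (LinearMap.ext fun v => by
        rw [LinearMap.comp_apply, LinearMap.smul_apply, map_smul, h2, inv_smul_smul₀ hs,
          LinearMap.id_apply])
      (LinearMap.ext fun v => by
        rw [LinearMap.comp_apply, LinearMap.smul_apply, h2, inv_smul_smul₀ hs, LinearMap.id_apply])
    obtain ⟨g, hg⟩ := hf.surjective γ h1
    exact ⟨⟨g, (hfz g).2 fun v => by rw [hg]; exact h2 v⟩, Subtype.ext (by
      change (f g : V →ₗ[F] V) = h
      rw [hg]
      rfl)⟩

end IsIsometryHom

section Symplectic

variable {F : Type*} [Field F] (n : ℕ)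

/-- The standard symplectic form. -/
def symplecticForm (n : ℕ) (F : Type*) [Field F] : LinearMap.BilinForm F (Fin n ⊕ Fin n → F) :=
  Matrix.toBilin' (Jsp n F)

theorem symplecticForm_apply (v w : Fin n ⊕ Fin n → F) :
    symplecticForm n F v w = ∑ i, (v (Sum.inl i) * w (Sum.inr i) - v (Sum.inr i) * w (Sum.inl i)) := by
  rw [symplecticForm, Matrix.toBilin'_apply', Jsp, Matrix.fromBlocks_mulVec, dotProduct,
    Fintype.sum_sum_type, ← Finset.sum_add_distrib]
  refine Finset.sum_congr rfl fun i _ => ?_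
  simp [Matrix.neg_mulVec, sub_eq_add_neg]

theorem symplecticForm_self (v : Fin n ⊕ Fin n → F) : symplecticForm n F v v = 0 := by
  rw [symplecticForm_apply]
  exact Finset.sum_eq_zero fun i _ => by ring

theorem symplecticForm_nondegenerate (v : Fin n ⊕ Fin n → F)
    (hv : ∀ w, symplecticForm n F v w = 0) : v = 0 := by
  funext i
  rcases i with i | i
  · have := hv (Pi.single (Sum.inr i) 1)
    rw [symplecticForm_apply] at this
    simpa [Pi.single_apply] using this
  · have := hv (Pi.single (Sum.inl i) 1)
    rw [symplecticForm_apply] at this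
    simpa [Pi.single_apply] using this

theorem mem_Sp_iff (g : Matrix.GeneralLinearGroup (Fin n ⊕ Fin n) F) :
    g ∈ Sp n F ↔ ∀ v w, symplecticForm n F (g.1.mulVec v) (g.1.mulVec w) =
      symplecticForm n F v w := by
  have h : ∀ v w, symplecticForm n F (g.1.mulVec v) (g.1.mulVec w) =
      Matrix.toBilin' (g.1.transpose * Jsp n F * g.1) v w := fun v w => by
    rw [symplecticForm, Matrix.toBilin'_apply', Matrix.toBilin'_apply', ← Matrix.mulVec_mulVec,
      ← Matrix.mulVec_mulVec, Matrix.dotProduct_mulVec v, Matrix.vecMul_transpose]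
  constructor
  · intro hg v w
    rw [h, show g.1.transpose * Jsp n F * g.1 = Jsp n F from hg]
    rfl
  · intro hg
    refine (Matrix.toBilin' (R₁ := F)).injective (LinearMap.ext fun v => LinearMap.ext fun w => ?_)
    rw [← h, hg]
    rfl

/-- The natural representation of the symplectic group. -/
def spHom (n : ℕ) (F : Type*) [Field F] :
    Sp n F →* ((Fin n ⊕ Fin n → F) ≃ₗ[F] (Fin n ⊕ Fin n → F)) :=
  ((LinearMap.GeneralLinearGroup.generalLinearEquiv F (Fin n ⊕ Fin n → F)).toMonoidHom.comp
    (Matrix.GeneralLinearGroup.toLin (n := Fin n ⊕ Fin n) (R := F)).toMonoidHom).comp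
    (Sp n F).subtype

theorem spHom_apply (g : Sp n F) (v : Fin n ⊕ Fin n → F) : spHom n F g v = g.1.1.mulVec v := rfl

theorem isIsometryHom_spHom : IsIsometryHom (symplecticForm n F) (spHom n F) where
  injective := ((LinearMap.GeneralLinearGroup.generalLinearEquiv F _).injective.comp
    (Matrix.GeneralLinearGroup.toLin (n := Fin n ⊕ Fin n) (R := F)).injective).comp
    Subtype.val_injective
  isometry g := (mem_Sp_iff n g.1).1 g.2
  surjective γ hγ := by
    obtain ⟨u, rfl⟩ := (LinearMap.GeneralLinearGroup.generalLinearEquiv F _).surjective γ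
    obtain ⟨g, rfl⟩ := (Matrix.GeneralLinearGroup.toLin (n := Fin n ⊕ Fin n) (R := F)).surjective u
    exact ⟨⟨g, (mem_Sp_iff n g).2 hγ⟩, rfl⟩

/-- The central involution of the symplectic group. -/
def spNegOne (n : ℕ) (F : Type*) [Field F] : Sp n F :=
  ⟨-1, (mem_Sp_iff n _).2 fun v w => by simp [Matrix.neg_mulVec]⟩

theorem spHom_spNegOne (v : Fin n ⊕ Fin n → F) : spHom n F (spNegOne n F) v = -v := by
  simp [spHom_apply, spNegOne, Matrix.neg_mulVec]

end Symplectic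

end

open Matrix CategoryTheory
open scoped Classical

noncomputable section

theorem stmt_6 (n : ℕ) (q : ℕ) (hq : ∃ p r : ℕ, p.Prime ∧ 0 < r ∧ q = p ^ r)
    (h4 : q % 4 = 1)
    (F : Type) [Field F] [Fintype F] [DecidableEq F] (hF : Fintype.card F = q)
    (ι : Type) [Fintype ι] (R : ι → FDRep ℂ ↥(Sp n F))
    (hsimple : ∀ i, Simple (R i))
    (hdistinct : ∀ i j : ι, Nonempty (R i ≅ R j) → i = j)
    (hcomplete : ∀ ρ : FDRep ℂ ↥(Sp n F), Simple ρ → ∃ i, Nonempty (ρ ≅ R i))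
    (δ : ℤ) (hδ : δ = 1 ∨ δ = -1) :
    ∑ i ∈ Finset.univ.filter
        (fun i => fsIndicator ↥(Sp n F) ((R i).character) = (δ : ℂ)),
        (Module.finrank ℂ (R i) : ℝ)
      = (1 / 2) * ((q : ℝ) ^ (n * (n + 1) / 2) * (∏ i ∈ Finset.Icc 1 n, ((q : ℝ) ^ i + 1))
        + (δ : ℝ) * ∑ k ∈ Finset.range (n + 1),
            (q : ℝ) ^ (2 * k * (n - k)) * gbinom n k ((q : ℝ) ^ 2)) := by
  have hq' : Nat.card F = q := by rw [Nat.card_eq_fintype_card, hF]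
  obtain ⟨c, hc⟩ : ∃ c : F, c * c = -1 := by
    obtain ⟨c, hc⟩ := FiniteField.isSquare_neg_one_iff.2 (show Fintype.card F % 4 ≠ 3 by omega)
    exact ⟨c, hc.symm⟩
  have h2 : (2 : F) ≠ 0 := Ring.two_ne_zero fun h => by
    have := FiniteField.even_card_of_char_two h
    omega
  have hf := isIsometryHom_spHom (F := F) n
  have hA := symplecticForm_self (F := F) n
  have hB := symplecticForm_nondegenerate (F := F) n
  have hV : Module.finrank F (Fin n ⊕ Fin n → F) = 2 * n := by
    rw [Module.finrank_fintype_fun_eq_card, Fintype.card_sum, Fintype.card_fin, two_mul]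
  have hzn := spHom_spNegOne (F := F) n
  have hz : ∀ k, spNegOne n F * k = k * spNegOne n F := fun k => hf.injective (by
    ext1 v
    rw [map_mul, map_mul, LinearEquiv.mul_apply, LinearEquiv.mul_apply, hzn, hzn, map_neg])
  have hzz : spNegOne n F * spNegOne n F = 1 := hf.injective (by
    ext1 v
    rw [map_mul, LinearEquiv.mul_apply, hzn, hzn, neg_neg, map_one]
    rfl)
  have key := fun i => (haveI := hsimple i; FDRep.isIrr_of_simple (R i)).exists_sum_character_mul_self
    hz hzz (hf.exists_conj_eq_inv h2 hA hB hc)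
    (fun x hx => hf.exists_isPosInverter h2 hA hB hc hzn hx)
  choose e he hez hes using key
  have hfs : ∀ i, fsIndicator ↥(Sp n F) ((R i).character) = e i := fun i => by
    have h1 : ∑ g, (R i).character (g * g) = e i * Fintype.card (Sp n F) := hes i
    rw [fsIndicator, h1, mul_comm, mul_assoc,
      mul_inv_cancel₀ (Nat.cast_ne_zero.2 Fintype.card_ne_zero), mul_one]
  have hcount := sum_finrank_filter R hsimple hdistinct hcomplete hzz he hez hes (δ := (δ : ℂ))
    (by rcases hδ with rfl | rfl <;> simp)
  have hm : (Nat.card {g : Sp n F // g * g = spNegOne n F} : ℝ) =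
      (q : ℝ) ^ (n * (n + 1) / 2) * ∏ i ∈ Finset.Icc 1 n, ((q : ℝ) ^ i + 1) := by
    have h3 := natCard_isometrySqrt_neg_one h2 hc n (symplecticForm n F) hA hB hV
    rw [hq'] at h3
    rw [← h3, hf.natCard_sqrt (neg_ne_zero.2 one_ne_zero)
      (fun v => (hzn v).trans (neg_one_smul F v).symm), hc]
    simp only [and_true]
  have hp : (Nat.card {g : Sp n F // g * g = 1} : ℝ) = ∑ k ∈ Finset.range (n + 1),
      (q : ℝ) ^ (2 * k * (n - k)) * gbinom n k ((q : ℝ) ^ 2) := by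
    have h3 := natCard_isometrySqrt_one h2 (symplecticForm n F) hA hB hV
    rw [hq'] at h3
    rw [← h3, hf.natCard_sqrt one_ne_zero
      (fun v => by rw [map_one, one_smul]; rfl), mul_one]
  rw [← hm, ← hp]
  simp only [hfs]
  apply Complex.ofReal_injective
  push_cast
  exact hcount

end
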